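/- arXiv:1111.6716 — 5 statements merged into one kernel-verified Lean document; each statement's English description precedes it below -/
import Mathlib

section
/- Let χ be a ray class character modulo q of K. Then the series L(s, χ, 𝔟) = Σ_𝔞 χ(𝔞)·N(𝔞)^{−s}, summed over the integral ideals 𝔞 of K of the form 𝔞 = α𝔟 with α ∈ K totally positive and with 𝔞 coprime to qO_K, converges absolutely for Re(s) > 1, and every function F analytic on a connected open set U ⊆ ℂ containing {s : Re(s) > 1} ∪ {0} and agreeing with this series on {s : Re(s) > 1} satisfies F(0) = Σ_{C=1}^{q} Σ_{D=1}^{q} χ((C + Dδ)𝔟) · Σ_{i=1}^{m} [ B₁(x^i_{C+Dδ})·B₁(y^i_{C+Dδ}) + (b_i/2)·B₂(x^i_{C+Dδ}) ]. -/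
open NumberField FractionalIdeal
open scoped nonZeroDivisors

/-- The first Bernoulli polynomial `B₁(x) = x - 1/2`. -/
noncomputable def B1 (x : ℝ) : ℝ := x - 1/2

/-- The second Bernoulli polynomial `B₂(x) = x² - x + 1/6`. -/
noncomputable def B2 (x : ℝ) : ℝ := x^2 - x + 1/6

section

open Finset Filter Topology

/-- The value `B_k(x) / k!` of the normalised Bernoulli polynomial. -/
noncomputable def bernCoeff (k : ℕ) (x : ℝ) : ℂ :=
  Polynomial.aeval (x : ℂ) (Polynomial.bernoulli k) / (k.factorial : ℂ)

lemma bernCoeff_zero (x : ℝ) : bernCoeff 0 x = 1 := by simp [bernCoeff]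

lemma bernCoeff_one (x : ℝ) : bernCoeff 1 x = x - 1 / 2 := by
  simp [bernCoeff, Polynomial.bernoulli_one]

lemma bernCoeff_two (x : ℝ) : bernCoeff 2 x = (x ^ 2 - x + 1 / 6) / 2 := by
  simp only [bernCoeff, Polynomial.bernoulli, Finset.sum_range_succ, Finset.sum_range_zero]
  simp [Polynomial.aeval_monomial, Nat.factorial, bernoulli_two]
  ring

lemma sum_bernCoeff (x : ℝ) (l : ℕ) :
    ∑ k ∈ range (l + 1), bernCoeff k x / ((l + 1 - k).factorial : ℂ)
      = (x : ℂ) ^ l / (l.factorial : ℂ) := by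
  have h := congrArg (Polynomial.aeval (x : ℂ)) (Polynomial.sum_bernoulli l)
  rw [map_sum, Polynomial.aeval_monomial] at h
  have hf : ((l + 1).factorial : ℂ) ≠ 0 := by exact_mod_cast (l + 1).factorial_ne_zero
  have hf' : (l.factorial : ℂ) ≠ 0 := by exact_mod_cast l.factorial_ne_zero
  have h2 : ((l + 1).factorial : ℂ) * ∑ k ∈ range (l + 1),
      bernCoeff k x / ((l + 1 - k).factorial : ℂ) = (l + 1) * (x : ℂ) ^ l := by
    have : (algebraMap ℚ ℂ) (l + 1) = (l : ℂ) + 1 := by simp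
    rw [← this, ← h, Finset.mul_sum]
    refine Finset.sum_congr rfl fun k hk => ?_
    have hk' : k ≤ l + 1 := by have := Finset.mem_range.1 hk; omega
    rw [map_smul, Algebra.smul_def, eq_ratCast, Rat.cast_natCast, Nat.cast_choose ℂ hk', bernCoeff]
    field_simp
  have h3 : ((l + 1).factorial : ℂ) = (l + 1) * l.factorial := by
    rw [Nat.factorial_succ]; push_cast; ring
  rw [eq_div_iff hf']
  have h4 : ((l : ℂ) + 1) ≠ 0 := by exact_mod_cast l.succ_ne_zero
  apply mul_left_cancel₀ h4
  rw [← h2, h3]; ring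

/-- Taylor's formula on `[0, 1]` for a chain of successive derivatives. -/
lemma norm_sub_taylor_le {G : ℕ → ℝ → ℂ}
    (hG : ∀ k, ∀ t ∈ Set.Icc (0 : ℝ) 1, HasDerivAt (G k) (G (k + 1) t) t) {M : ℝ} (r : ℕ) :
    ∀ j, (∀ t ∈ Set.Icc (0 : ℝ) 1, ‖G (j + r) t‖ ≤ M) → ∀ t ∈ Set.Icc (0 : ℝ) 1,
      ‖G j t - ∑ i ∈ range r, G (j + i) 0 * ((t : ℂ) ^ i / (i.factorial : ℂ))‖ ≤ M := by
  induction r with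
  | zero => intro j h t ht; simpa using h t ht
  | succ r ih =>
    intro j h t ht
    have key := ih (j + 1) (by intro t ht; have := h t ht; rwa [add_assoc, add_comm 1 r])
    set F : ℝ → ℂ := fun t => G j t
      - ∑ i ∈ range (r + 1), G (j + i) 0 * ((t : ℂ) ^ i / (i.factorial : ℂ)) with hF
    have hder : ∀ u ∈ Set.Icc (0 : ℝ) 1, HasDerivAt F (G (j + 1) u
        - ∑ i ∈ range r, G (j + 1 + i) 0 * ((u : ℂ) ^ i / (i.factorial : ℂ))) u := by
      intro u hu
      refine (hG j u hu).sub ?_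
      have : HasDerivAt (fun t : ℝ => ∑ i ∈ range (r + 1),
          G (j + i) 0 * ((t : ℂ) ^ i / (i.factorial : ℂ)))
          (∑ i ∈ range (r + 1), G (j + i) 0 * ((i : ℂ) * (u : ℂ) ^ (i - 1) / (i.factorial : ℂ))) u := by
        refine HasDerivAt.fun_sum fun i _ => ?_
        refine HasDerivAt.const_mul _ ?_
        refine HasDerivAt.div_const ?_ _
        exact (hasDerivAt_pow i (u : ℂ)).comp_ofReal
      refine this.congr_deriv ?_
      rw [Finset.sum_range_succ']
      simp only [Nat.cast_zero, zero_mul, zero_div, mul_zero, add_zero]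
      refine Finset.sum_congr rfl fun i _ => ?_
      have hi : (i.factorial : ℂ) ≠ 0 := by exact_mod_cast i.factorial_ne_zero
      have hi' : ((i : ℂ) + 1) ≠ 0 := by exact_mod_cast i.succ_ne_zero
      rw [Nat.factorial_succ, show j + 1 + i = j + (i + 1) by ring]
      push_cast
      rw [mul_div_mul_left _ _ hi']
    have h0 : F 0 = 0 := by
      simp only [hF, Finset.sum_range_succ']
      simp
    have := Convex.norm_image_sub_le_of_norm_hasDerivWithin_le (f := F) (s := Set.Icc (0:ℝ) 1)
      (C := M) (fun u hu => (hder u hu).hasDerivWithinAt) key (convex_Icc 0 1)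
      (Set.left_mem_Icc.2 zero_le_one) ht
    rw [h0, sub_zero, sub_zero] at this
    refine this.trans ?_
    have hM : 0 ≤ M := (norm_nonneg _).trans (key 0 (Set.left_mem_Icc.2 zero_le_one))
    rw [Real.norm_of_nonneg ht.1]
    exact mul_le_of_le_one_right hM ht.2

/-- The local Euler–Maclaurin remainder on `[u, u + 1]` of the chain `G` of successive
derivatives. -/
noncomputable def emRem (G : ℕ → ℝ → ℂ) (x : ℝ) (K : ℕ) (u : ℝ) : ℂ :=
  G 1 (u + x) - ∑ k ∈ range (K + 1), bernCoeff k x * (G k (u + 1) - G k u)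

/-- The constant in the bound for the Euler–Maclaurin remainder. -/
noncomputable def emConst (x : ℝ) (K : ℕ) : ℝ := 1 + ∑ k ∈ range (K + 1), ‖bernCoeff k x‖

lemma emConst_nonneg (x : ℝ) (K : ℕ) : 0 ≤ emConst x K := by
  unfold emConst; positivity

lemma norm_emRem_le {G : ℕ → ℝ → ℂ} {u M x : ℝ} (K : ℕ) (hx : x ∈ Set.Icc (0 : ℝ) 1)
    (hG : ∀ k, ∀ t ∈ Set.Icc u (u + 1), HasDerivAt (G k) (G (k + 1) t) t)
    (hM : ∀ t ∈ Set.Icc u (u + 1), ‖G (K + 1) t‖ ≤ M) :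
    ‖emRem G x K u‖ ≤ emConst x K * M := by
  set H : ℕ → ℝ → ℂ := fun k t => G k (u + t) with hH
  have hmem : ∀ t ∈ Set.Icc (0 : ℝ) 1, u + t ∈ Set.Icc u (u + 1) := fun t ht =>
    ⟨by linarith [ht.1], by linarith [ht.2]⟩
  have hHd : ∀ k, ∀ t ∈ Set.Icc (0 : ℝ) 1, HasDerivAt (H k) (H (k + 1) t) t := by
    intro k t ht
    exact (hG k (u + t) (hmem t ht)).comp_const_add u t
  have hT : ∀ j ≤ K + 1, ∀ t ∈ Set.Icc (0 : ℝ) 1,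
      ‖H j t - ∑ i ∈ range (K + 1 - j), H (j + i) 0 * ((t : ℂ) ^ i / (i.factorial : ℂ))‖ ≤ M := by
    intro j hj
    refine norm_sub_taylor_le hHd (K + 1 - j) j fun t ht => ?_
    rw [Nat.add_sub_cancel' hj]
    exact hM _ (hmem t ht)
  -- the polynomial part cancels
  have hpoly : ∑ i ∈ range K, H (1 + i) 0 * ((x : ℂ) ^ i / (i.factorial : ℂ))
      = ∑ k ∈ range (K + 1), bernCoeff k x *
        (∑ i ∈ range (K + 1 - k), H (k + i) 0 * (((1 : ℝ) : ℂ) ^ i / (i.factorial : ℂ)) - H k 0) := by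
    have h1 : ∀ k ∈ range (K + 1), bernCoeff k x *
        (∑ i ∈ range (K + 1 - k), H (k + i) 0 * (((1 : ℝ) : ℂ) ^ i / (i.factorial : ℂ)) - H k 0)
        = ∑ i ∈ range (K - k), bernCoeff k x * H (k + (i + 1)) 0 / ((i + 1).factorial : ℂ) := by
      intro k hk
      have : K + 1 - k = (K - k) + 1 := by have := Finset.mem_range.1 hk; omega
      rw [this, Finset.sum_range_succ']
      simp [Finset.mul_sum]
      exact Finset.sum_congr rfl fun i _ => by ring
    rw [Finset.sum_congr rfl h1]
    have h2 : ∀ l ∈ range K, H (1 + l) 0 * ((x : ℂ) ^ l / (l.factorial : ℂ))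
        = ∑ k ∈ range (l + 1), bernCoeff k x * H (1 + l) 0 / ((l + 1 - k).factorial : ℂ) := by
      intro l _
      rw [← sum_bernCoeff, Finset.mul_sum]
      exact Finset.sum_congr rfl fun k _ => by ring
    rw [Finset.sum_congr rfl h2, Finset.sum_sigma', Finset.sum_sigma']
    refine Finset.sum_bij' (fun p _ => ⟨p.2, p.1 - p.2⟩) (fun p _ => ⟨p.1 + p.2, p.1⟩) ?_ ?_ ?_ ?_ ?_
    · rintro ⟨l, k⟩ h; simp at h ⊢; omega
    · rintro ⟨k, i⟩ h; simp at h ⊢; omega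
    · rintro ⟨l, k⟩ h; simp at h ⊢; omega
    · rintro ⟨k, i⟩ h; simp at h ⊢
    · rintro ⟨l, k⟩ h
      simp only [Finset.mem_sigma, Finset.mem_range] at h ⊢
      rw [show k + (l - k + 1) = 1 + l by omega, show l - k + 1 = l + 1 - k by omega]
  have hrem : emRem G x K u
      = (H 1 x - ∑ i ∈ range K, H (1 + i) 0 * ((x : ℂ) ^ i / (i.factorial : ℂ)))
        - ∑ k ∈ range (K + 1), bernCoeff k x * (H k 1 - ∑ i ∈ range (K + 1 - k),
          H (k + i) 0 * (((1 : ℝ) : ℂ) ^ i / (i.factorial : ℂ))) := by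
    rw [hpoly, sub_sub, ← Finset.sum_add_distrib]
    simp only [emRem, hH, add_zero]
    congr 1
    exact Finset.sum_congr rfl fun k _ => by ring
  rw [hrem, emConst, add_mul, one_mul]
  refine (norm_sub_le _ _).trans (add_le_add (hT 1 (by omega) x hx) ?_)
  rw [Finset.sum_mul]
  refine (norm_sum_le _ _).trans (Finset.sum_le_sum fun k hk => ?_)
  rw [norm_mul]
  exact mul_le_mul_of_nonneg_left
    (hT k (Finset.mem_range.1 hk).le 1 (Set.right_mem_Icc.2 zero_le_one)) (norm_nonneg _)

/-- Euler–Maclaurin summation with an implicit remainder. -/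
lemma tsum_eq_emSum {G : ℕ → ℝ → ℂ} {x : ℝ} (K : ℕ)
    (hlim : ∀ k ≤ K, Tendsto (fun n : ℕ => G k n) atTop (𝓝 0))
    (hsum : Summable fun n : ℕ => G 1 (n + x)) (hrem : Summable fun n : ℕ => emRem G x K n) :
    ∑' n : ℕ, G 1 (n + x)
      = -∑ k ∈ range (K + 1), bernCoeff k x * G k 0 + ∑' n : ℕ, emRem G x K n := by
  have h1 := hsum.hasSum.tendsto_sum_nat
  have h2 := hrem.hasSum.tendsto_sum_nat
  have h3 : Tendsto (fun n : ℕ => ∑ k ∈ range (K + 1), bernCoeff k x * (G k n - G k 0)) atTop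
      (𝓝 (∑ k ∈ range (K + 1), bernCoeff k x * (0 - G k 0))) := by
    refine tendsto_finsetSum _ fun k hk => ?_
    exact ((hlim k (by have := Finset.mem_range.1 hk; omega)).sub_const _).const_mul _
  have h4 : ∀ N : ℕ, ∑ n ∈ range N, G 1 (n + x)
      = ∑ k ∈ range (K + 1), bernCoeff k x * (G k N - G k 0) + ∑ n ∈ range N, emRem G x K n := by
    intro N
    have : ∀ k, G k N - G k 0 = ∑ n ∈ range N, (G k (n + 1) - G k n) := by
      intro k
      have := Finset.sum_range_sub (fun n : ℕ => G k n) N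
      simpa using this.symm
    simp only [this, Finset.mul_sum]
    rw [Finset.sum_comm, ← Finset.sum_add_distrib]
    exact Finset.sum_congr rfl fun n _ => by simp [emRem]
  have h5 := tendsto_nhds_unique h1 ((h3.add h2).congr fun N => (h4 N).symm)
  rw [h5]
  simp

/-- Two linear forms `a X + b Y` and `a' X + b' Y` with positive coefficients. -/
structure FormPair where
  /-- coefficient of `X` in the first form -/
  a : ℝ
  /-- coefficient of `Y` in the first form -/
  b : ℝ
  /-- coefficient of `X` in the second form -/
  a' : ℝ
  /-- coefficient of `Y` in the second form -/
  b' : ℝ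
  ha : 0 < a
  hb : 0 < b
  ha' : 0 < a'
  hb' : 0 < b'

namespace FormPair

variable (Q : FormPair)

/-- Exchange the roles of the two variables. -/
def swap : FormPair := ⟨Q.b, Q.a, Q.b', Q.a', Q.hb, Q.ha, Q.hb', Q.ha'⟩

/-- The `n`-th derivative in `X` of `(a X + b Y) ^ (-p) * (a' X + b' Y) ^ (-r)`. -/
noncomputable def D : ℕ → ℂ → ℂ → ℝ → ℝ → ℂ
  | 0, p, r, X, Y =>
    ((Q.a * X + Q.b * Y : ℝ) : ℂ) ^ (-p) * ((Q.a' * X + Q.b' * Y : ℝ) : ℂ) ^ (-r)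
  | n + 1, p, r, X, Y => -p * Q.a * D n (p + 1) r X Y - r * Q.a' * D n p (r + 1) X Y

lemma D_succ_zero (n : ℕ) (X Y : ℝ) : Q.D (n + 1) 0 0 X Y = 0 := by simp [D]

lemma D_zero_zero {X Y : ℝ} : Q.D 0 0 0 X Y = 1 := by simp [D]

lemma form_pos {a b X Y : ℝ} (ha : 0 < a) (hb : 0 < b) (hX : 0 ≤ X) (hY : 0 < Y) :
    0 < a * X + b * Y := by positivity

lemma hasDerivAt_ofReal_cpow_form {c d X : ℝ} (h : 0 < c * X + d) (p : ℂ) :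
    HasDerivAt (fun X : ℝ => ((c * X + d : ℝ) : ℂ) ^ (-p))
      (-p * c * ((c * X + d : ℝ) : ℂ) ^ (-(p + 1))) X := by
  have h1 : HasDerivAt (fun X : ℝ => ((c * X + d : ℝ) : ℂ)) (c : ℂ) X := by
    have : HasDerivAt (fun X : ℝ => c * X + d) (c * 1) X :=
      ((hasDerivAt_id X).const_mul c).add_const d
    simpa using this.ofReal_comp
  have h0 : HasDerivAt (fun z : ℂ => z ^ (-p)) (-p * ((c * X + d : ℝ) : ℂ) ^ (-p - 1) * 1)
      ((c * X + d : ℝ) : ℂ) :=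
    (hasDerivAt_id _).cpow_const (Or.inl (by simpa only [id, Complex.ofReal_re] using h))
  have h2 := h0.scomp_of_eq X h1 rfl
  refine h2.congr_deriv ?_
  rw [show -(p + 1) = -p - 1 by ring]
  ring

lemma hasDerivAt_D {X Y : ℝ} (hX : 0 ≤ X) (hY : 0 < Y) (n : ℕ) :
    ∀ p r, HasDerivAt (fun X => Q.D n p r X Y) (Q.D (n + 1) p r X Y) X := by
  induction n with
  | zero =>
    intro p r
    have h1 := hasDerivAt_ofReal_cpow_form (form_pos Q.ha Q.hb hX hY) p
    have h2 := hasDerivAt_ofReal_cpow_form (form_pos Q.ha' Q.hb' hX hY) r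
    refine (h1.mul h2).congr_deriv ?_
    simp only [D]
    ring
  | succ n ih =>
    intro p r
    exact ((ih (p + 1) r).const_mul (-p * Q.a)).sub ((ih p (r + 1)).const_mul (r * Q.a'))

lemma differentiable_D {X Y : ℝ} (hX : 0 ≤ X) (hY : 0 < Y) (n : ℕ) :
    ∀ {P R : ℂ → ℂ}, Differentiable ℂ P → Differentiable ℂ R →
      Differentiable ℂ fun s => Q.D n (P s) (R s) X Y := by
  induction n with
  | zero =>
    intro P R hP hR
    have h1 : ((Q.a * X + Q.b * Y : ℝ) : ℂ) ≠ 0 :=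
      Complex.ofReal_ne_zero.2 (form_pos Q.ha Q.hb hX hY).ne'
    have h2 : ((Q.a' * X + Q.b' * Y : ℝ) : ℂ) ≠ 0 :=
      Complex.ofReal_ne_zero.2 (form_pos Q.ha' Q.hb' hX hY).ne'
    exact (hP.neg.const_cpow (Or.inl h1)).mul (hR.neg.const_cpow (Or.inl h2))
  | succ n ih =>
    intro P R hP hR
    exact ((hP.neg.mul_const _).mul (ih (hP.add_const 1) hR)).sub
      ((hR.mul_const _).mul (ih hP (hR.add_const 1)))

lemma D_homogeneous {Y : ℝ} (hY : 0 < Y) (n : ℕ) :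
    ∀ p r, Q.D n p r 0 Y = (Y : ℂ) ^ (-(p + r + n)) * Q.D n p r 0 1 := by
  have hY' : (Y : ℂ) ≠ 0 := Complex.ofReal_ne_zero.2 hY.ne'
  induction n with
  | zero =>
    intro p r
    simp only [D, mul_zero, zero_add, mul_one, Nat.cast_zero, add_zero]
    rw [Complex.ofReal_mul, Complex.ofReal_mul, Complex.mul_cpow_ofReal_nonneg Q.hb.le hY.le,
      Complex.mul_cpow_ofReal_nonneg Q.hb'.le hY.le, neg_add, Complex.cpow_add _ _ hY']
    ring
  | succ n ih =>
    intro p r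
    simp only [D, ih (p + 1) r, ih p (r + 1)]
    push_cast
    rw [show p + 1 + r + (n : ℂ) = p + r + (n + 1) by ring,
      show p + (r + 1) + (n : ℂ) = p + r + (n + 1) by ring]
    ring

/-- A constant comparing both forms with `X + Y` from above and below. -/
lemma exists_form_bound : ∃ C : ℝ, 1 ≤ C ∧ ∀ X Y : ℝ, 0 ≤ X → 0 < Y →
    (Q.a * X + Q.b * Y ≤ C * (X + Y) ∧ X + Y ≤ C * (Q.a * X + Q.b * Y)) ∧
    (Q.a' * X + Q.b' * Y ≤ C * (X + Y) ∧ X + Y ≤ C * (Q.a' * X + Q.b' * Y)) := by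
  have h1 := Q.ha; have h2 := Q.hb; have h3 := Q.ha'; have h4 := Q.hb'
  refine ⟨1 + Q.a + Q.b + Q.a' + Q.b' + 1 / Q.a + 1 / Q.b + 1 / Q.a' + 1 / Q.b', ?_, ?_⟩
  · have : 0 ≤ Q.a + Q.b + Q.a' + Q.b' + 1 / Q.a + 1 / Q.b + 1 / Q.a' + 1 / Q.b' := by positivity
    linarith
  · intro X Y hX hY
    set C := 1 + Q.a + Q.b + Q.a' + Q.b' + 1 / Q.a + 1 / Q.b + 1 / Q.a' + 1 / Q.b' with hC
    have p1 : 0 < 1 / Q.a := by positivity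
    have p2 : 0 < 1 / Q.b := by positivity
    have p3 : 0 < 1 / Q.a' := by positivity
    have p4 : 0 < 1 / Q.b' := by positivity
    have c1 : 1 ≤ C * Q.a := by
      have : 1 / Q.a * Q.a = 1 := by field_simp
      nlinarith [mul_le_mul_of_nonneg_right (show 1 / Q.a ≤ C by linarith) h1.le]
    have c2 : 1 ≤ C * Q.b := by
      have : 1 / Q.b * Q.b = 1 := by field_simp
      nlinarith [mul_le_mul_of_nonneg_right (show 1 / Q.b ≤ C by linarith) h2.le]
    have c3 : 1 ≤ C * Q.a' := by
      have : 1 / Q.a' * Q.a' = 1 := by field_simp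
      nlinarith [mul_le_mul_of_nonneg_right (show 1 / Q.a' ≤ C by linarith) h3.le]
    have c4 : 1 ≤ C * Q.b' := by
      have : 1 / Q.b' * Q.b' = 1 := by field_simp
      nlinarith [mul_le_mul_of_nonneg_right (show 1 / Q.b' ≤ C by linarith) h4.le]
    have d1 := mul_le_mul_of_nonneg_right (show Q.a ≤ C by linarith) hX
    have d2 := mul_le_mul_of_nonneg_right (show Q.b ≤ C by linarith) hY.le
    have d3 := mul_le_mul_of_nonneg_right (show Q.a' ≤ C by linarith) hX
    have d4 := mul_le_mul_of_nonneg_right (show Q.b' ≤ C by linarith) hY.le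
    have e1 := mul_le_mul_of_nonneg_right c1 hX
    have e2 := mul_le_mul_of_nonneg_right c2 hY.le
    have e3 := mul_le_mul_of_nonneg_right c3 hX
    have e4 := mul_le_mul_of_nonneg_right c4 hY.le
    refine ⟨⟨?_, ?_⟩, ?_, ?_⟩ <;> nlinarith

lemma rpow_neg_le_of_comparable {C l t σ R : ℝ} (hC : 1 ≤ C) (hl : 0 < l) (ht : 0 < t)
    (h1 : l ≤ C * t) (h2 : t ≤ C * l) (hσ : |σ| ≤ R) : l ^ (-σ) ≤ C ^ R * t ^ (-σ) := by
  have hC0 : 0 < C := by linarith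
  obtain ⟨hσ1, hσ2⟩ := abs_le.1 hσ
  rcases le_total 0 σ with h | h
  · have h3 : (C⁻¹ * t) ≤ l := by rw [inv_mul_le_iff₀ hC0]; exact h2
    calc l ^ (-σ) ≤ (C⁻¹ * t) ^ (-σ) :=
          Real.rpow_le_rpow_of_nonpos (by positivity) h3 (by linarith)
      _ = C ^ σ * t ^ (-σ) := by
          rw [Real.mul_rpow (by positivity) ht.le, Real.inv_rpow hC0.le, Real.rpow_neg hC0.le,
            inv_inv]
      _ ≤ C ^ R * t ^ (-σ) := by gcongr
  · calc l ^ (-σ) ≤ (C * t) ^ (-σ) := Real.rpow_le_rpow hl.le h1 (by linarith)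
      _ = C ^ (-σ) * t ^ (-σ) := Real.mul_rpow hC0.le ht.le
      _ ≤ C ^ R * t ^ (-σ) := by gcongr; linarith

lemma exists_norm_D_le (n : ℕ) : ∀ R : ℝ, 0 ≤ R → ∃ B : ℝ, 0 ≤ B ∧ ∀ p r : ℂ, ‖p‖ ≤ R → ‖r‖ ≤ R →
    ∀ X Y : ℝ, 0 ≤ X → 0 < Y → ‖Q.D n p r X Y‖ ≤ B * (X + Y) ^ (-(p.re + r.re + n)) := by
  induction n with
  | zero =>
    intro R hR
    obtain ⟨C, hC, hCb⟩ := Q.exists_form_bound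
    refine ⟨C ^ R * C ^ R, by positivity, fun p r hp hr X Y hX hY => ?_⟩
    have hf1 := form_pos Q.ha Q.hb hX hY
    have hf2 := form_pos Q.ha' Q.hb' hX hY
    have hXY : 0 < X + Y := by linarith
    obtain ⟨⟨h1, h2⟩, h3, h4⟩ := hCb X Y hX hY
    have e1 := rpow_neg_le_of_comparable hC hf1 hXY h1 h2 ((Complex.abs_re_le_norm p).trans hp)
    have e2 := rpow_neg_le_of_comparable hC hf2 hXY h3 h4 ((Complex.abs_re_le_norm r).trans hr)
    simp only [D, norm_mul]
    rw [Complex.norm_cpow_eq_rpow_re_of_pos hf1, Complex.norm_cpow_eq_rpow_re_of_pos hf2,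
      Complex.neg_re, Complex.neg_re]
    calc _ ≤ (C ^ R * (X + Y) ^ (-p.re)) * (C ^ R * (X + Y) ^ (-r.re)) := by gcongr
      _ = _ := by
        rw [show -(p.re + r.re + ((0 : ℕ) : ℝ)) = -p.re + -r.re by push_cast; ring,
          Real.rpow_add hXY]
        ring
  | succ n ih =>
    intro R hR
    obtain ⟨B, hB, hBb⟩ := ih (R + 1) (by linarith)
    have ha := Q.ha
    have ha' := Q.ha'
    refine ⟨R * Q.a * B + R * Q.a' * B, by positivity, fun p r hp hr X Y hX hY => ?_⟩
    have hXY : 0 < X + Y := by linarith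
    have h1 := hBb (p + 1) r ((norm_add_le _ _).trans (by simpa using hp)) (by linarith) X Y hX hY
    have h2 := hBb p (r + 1) (by linarith) ((norm_add_le _ _).trans (by simpa using hr)) X Y hX hY
    rw [show -((p + 1).re + r.re + (n : ℝ)) = -(p.re + r.re + ((n + 1 : ℕ) : ℝ)) by
      push_cast; simp; ring] at h1
    rw [show -(p.re + (r + 1).re + (n : ℝ)) = -(p.re + r.re + ((n + 1 : ℕ) : ℝ)) by
      push_cast; simp; ring] at h2
    simp only [D]
    refine (norm_sub_le _ _).trans ?_
    rw [norm_mul, norm_mul, norm_mul, norm_mul, norm_neg, Complex.norm_real, Complex.norm_real,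
      Real.norm_of_nonneg ha.le, Real.norm_of_nonneg ha'.le, add_mul, mul_assoc (R * Q.a),
      mul_assoc (R * Q.a')]
    have hnn : 0 ≤ (X + Y) ^ (-(p.re + r.re + ((n + 1 : ℕ) : ℝ))) := by positivity
    gcongr

/-- The `k`-th derivative in `X` of `X * (a X + b Y) ^ (-s) * (a' X + b' Y) ^ (-s)`. -/
noncomputable def G (s : ℂ) (Y : ℝ) (k : ℕ) (X : ℝ) : ℂ :=
  X * Q.D k s s X Y + k * Q.D (k - 1) s s X Y

lemma hasDerivAt_G (s : ℂ) {X Y : ℝ} (hX : 0 ≤ X) (hY : 0 < Y) (k : ℕ) :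
    HasDerivAt (Q.G s Y k) (Q.G s Y (k + 1) X) X := by
  have h1 : HasDerivAt (fun X : ℝ => (X : ℂ)) 1 X := (hasDerivAt_id X).ofReal_comp
  have h2 := (h1.mul (Q.hasDerivAt_D hX hY k s s)).add
    ((Q.hasDerivAt_D hX hY (k - 1) s s).const_mul (k : ℂ))
  refine h2.congr_deriv ?_
  rcases k with _ | k
  · simp [G]; ring
  · simp [G]; ring

lemma differentiable_G {X Y : ℝ} (hX : 0 ≤ X) (hY : 0 < Y) (k : ℕ) :
    Differentiable ℂ fun s => Q.G s Y k X :=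
  ((Q.differentiable_D hX hY k differentiable_id differentiable_id).const_mul _).add
    ((Q.differentiable_D hX hY (k - 1) differentiable_id differentiable_id).const_mul _)

lemma exists_norm_G_le (k : ℕ) (R : ℝ) (hR : 0 ≤ R) : ∃ B : ℝ, 0 ≤ B ∧ ∀ s : ℂ, ‖s‖ ≤ R →
    ∀ X Y : ℝ, 0 ≤ X → 0 < Y → ‖Q.G s Y k X‖ ≤ B * (X + Y) ^ (-(2 * s.re + k - 1)) := by
  obtain ⟨B, hB, hBb⟩ := Q.exists_norm_D_le k R hR
  obtain ⟨B', hB', hBb'⟩ := Q.exists_norm_D_le (k - 1) R hR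
  refine ⟨B + k * B', by positivity, fun s hs X Y hX hY => ?_⟩
  have hXY : 0 < X + Y := by linarith
  have h1 := hBb s s hs hs X Y hX hY
  have h2 := hBb' s s hs hs X Y hX hY
  have e1 : (X + Y) ^ (-(2 * s.re + k - 1)) = (X + Y) * (X + Y) ^ (-(s.re + s.re + k)) := by
    rw [show -(2 * s.re + k - 1) = 1 + -(s.re + s.re + (k : ℝ)) by ring, Real.rpow_add hXY,
      Real.rpow_one]
  refine (norm_add_le _ _).trans ?_
  rw [norm_mul, norm_mul, Complex.norm_real, Real.norm_of_nonneg hX, add_mul]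
  refine add_le_add ?_ ?_
  · rw [e1]
    calc X * ‖Q.D k s s X Y‖ ≤ (X + Y) * (B * (X + Y) ^ (-(s.re + s.re + k))) := by
          gcongr; linarith
      _ = _ := by ring
  · rcases k with _ | k
    · simp
    · rw [Complex.norm_natCast, mul_assoc]
      have : -(2 * s.re + ((k + 1 : ℕ) : ℝ) - 1) = -(s.re + s.re + ((k + 1 - 1 : ℕ) : ℝ)) := by
        push_cast; simp; ring
      rw [this]
      gcongr

/-- Euler's identity for the homogeneous function `((a X + b Y) (a' X + b' Y)) ^ (-s)`. -/
lemma G_one_add_swap_G_one (s : ℂ) {X Y : ℝ} (hX : 0 < X) (hY : 0 < Y) :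
    Q.G s Y 1 X + Q.swap.G s X 1 Y = (2 - 2 * s) * Q.D 0 s s X Y := by
  have hl := form_pos Q.ha Q.hb hX.le hY
  have hl' := form_pos Q.ha' Q.hb' hX.le hY
  have e1 : ((Q.a * X + Q.b * Y : ℝ) : ℂ) ≠ 0 := Complex.ofReal_ne_zero.2 hl.ne'
  have e2 : ((Q.a' * X + Q.b' * Y : ℝ) : ℂ) ≠ 0 := Complex.ofReal_ne_zero.2 hl'.ne'
  simp only [G, D, swap]
  rw [add_comm (Q.b * Y), add_comm (Q.b' * Y), neg_add, Complex.cpow_add _ _ e1,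
    Complex.cpow_add _ _ e2, Complex.cpow_neg_one, Complex.cpow_neg_one]
  simp only [Nat.cast_one, one_mul, Nat.sub_self, D]
  rw [add_comm (Q.b * Y), add_comm (Q.b' * Y)]
  have i1 := mul_inv_cancel₀ e1
  have i2 := mul_inv_cancel₀ e2
  generalize hL1 : ((Q.a * X + Q.b * Y : ℝ) : ℂ) = L1 at *
  generalize hL2 : ((Q.a' * X + Q.b' * Y : ℝ) : ℂ) = L2 at *
  push_cast at hL1 hL2
  linear_combination (-s * L1 ^ (-s) * L2 ^ (-s)) * (i1 + i2 + L1⁻¹ * hL1 + L2⁻¹ * hL2)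

end FormPair

/-- `Z`, given on `Re s > 1`, extends meromorphically to `Re s > -N` with finitely many poles
and limit `v` at `0`. -/
def HasCont (N : ℝ) (Z : ℂ → ℂ) (v : ℂ) : Prop :=
  ∃ P : Polynomial ℂ, P ≠ 0 ∧ ∃ H : ℂ → ℂ, DifferentiableOn ℂ H {s | -N < s.re} ∧
    (∀ s : ℂ, 1 < s.re → H s = P.eval s * Z s) ∧
    Tendsto (fun s => H s / P.eval s) (𝓝[≠] 0) (𝓝 v)

lemma eventually_eval_ne_zero {P : Polynomial ℂ} (hP : P ≠ 0) :
    ∀ᶠ s in 𝓝[≠] (0 : ℂ), P.eval s ≠ 0 := by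
  have hfin : {s : ℂ | P.eval s = 0}.Finite := by
    refine (P.roots.toFinset.finite_toSet).subset fun s hs => ?_
    simpa [hP] using hs
  have h2 : ({s : ℂ | P.eval s = 0} \ {0})ᶜ ∈ 𝓝 (0 : ℂ) :=
    (hfin.subset Set.sdiff_subset).isClosed.isOpen_compl.mem_nhds (by simp)
  filter_upwards [mem_nhdsWithin_of_mem_nhds h2, self_mem_nhdsWithin] with s hs hs0 h
  exact hs ⟨h, hs0⟩

namespace HasCont

variable {N : ℝ} {Z Z' : ℂ → ℂ} {v v' : ℂ}

lemma congr (h : HasCont N Z v) (hZ : ∀ s : ℂ, 1 < s.re → Z s = Z' s) : HasCont N Z' v := by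
  obtain ⟨P, hP, H, h1, h2, h3⟩ := h
  exact ⟨P, hP, H, h1, fun s hs => by rw [h2 s hs, hZ s hs], h3⟩

lemma of_differentiableOn (hN : 0 < N) (h : DifferentiableOn ℂ Z {s | -N < s.re}) :
    HasCont N Z (Z 0) := by
  refine ⟨1, one_ne_zero, Z, h, by simp, ?_⟩
  have hopen : IsOpen {s : ℂ | -N < s.re} := isOpen_lt continuous_const Complex.continuous_re
  have : ContinuousAt Z 0 :=
    (h.differentiableAt (hopen.mem_nhds (by simpa using hN))).continuousAt
  simpa using this.tendsto.mono_left nhdsWithin_le_nhds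

lemma add (h : HasCont N Z v) (h' : HasCont N Z' v') :
    HasCont N (fun s => Z s + Z' s) (v + v') := by
  obtain ⟨P, hP, H, h1, h2, h3⟩ := h
  obtain ⟨P', hP', H', h1', h2', h3'⟩ := h'
  refine ⟨P * P', mul_ne_zero hP hP', fun s => H s * P'.eval s + H' s * P.eval s, ?_, ?_, ?_⟩
  · exact (h1.mul P'.differentiable.differentiableOn).add
      (h1'.mul P.differentiable.differentiableOn)
  · intro s hs
    simp only [h2 s hs, h2' s hs, Polynomial.eval_mul]
    ring
  · refine (h3.add h3').congr' ?_
    filter_upwards [eventually_eval_ne_zero hP, eventually_eval_ne_zero hP'] with s hs hs'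
    rw [Polynomial.eval_mul]
    field_simp

lemma sum {ι : Type*} (t : Finset ι) {Z : ι → ℂ → ℂ} {v : ι → ℂ}
    (h : ∀ i ∈ t, HasCont N (Z i) (v i)) :
    HasCont N (fun s => ∑ i ∈ t, Z i s) (∑ i ∈ t, v i) := by
  classical
  induction t using Finset.induction_on with
  | empty =>
    exact ⟨1, one_ne_zero, fun _ => 0, differentiableOn_const _, by simp, by simp⟩
  | insert i t hi ih =>
    simp only [Finset.sum_insert hi]
    exact (h i (Finset.mem_insert_self i t)).add
      (ih fun j hj => h j (Finset.mem_insert_of_mem hj))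

lemma mul_entire (h : HasCont N Z v) {g : ℂ → ℂ} (hg : Differentiable ℂ g) :
    HasCont N (fun s => g s * Z s) (g 0 * v) := by
  obtain ⟨P, hP, H, h1, h2, h3⟩ := h
  refine ⟨P, hP, fun s => g s * H s, hg.differentiableOn.mul h1, ?_, ?_⟩
  · intro s hs
    simp only [h2 s hs]
    ring
  · have h4 : Tendsto g (𝓝[≠] 0) (𝓝 (g 0)) :=
      hg.continuous.continuousAt.tendsto.mono_left nhdsWithin_le_nhds
    exact (h4.mul h3).congr fun s => by ring

lemma div_polynomial {p : Polynomial ℂ} (hp : p.eval 0 ≠ 0)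
    (h : HasCont N (fun s => p.eval s * Z s) v) : HasCont N Z (v / p.eval 0) := by
  obtain ⟨P, hP, H, h1, h2, h3⟩ := h
  have hp0 : p ≠ 0 := by rintro rfl; simp at hp
  refine ⟨P * p, mul_ne_zero hP hp0, H, h1, ?_, ?_⟩
  · intro s hs
    rw [h2 s hs, Polynomial.eval_mul, mul_assoc]
  · have h4 : Tendsto (fun s => p.eval s) (𝓝[≠] 0) (𝓝 (p.eval 0)) :=
      p.continuous.continuousAt.tendsto.mono_left nhdsWithin_le_nhds
    refine (h3.div h4 hp).congr fun s => ?_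
    rw [Pi.div_apply, Polynomial.eval_mul, div_div]

/-- An analytic continuation along any connected open set takes the value predicted by the
meromorphic continuations to half planes. -/
lemma eq_of_analyticOnNhd (h : ∀ N : ℝ, 0 < N → HasCont N Z v) {U : Set ℂ} {F : ℂ → ℂ}
    (hU : IsOpen U) (hc : IsConnected U) (hsub : ({s : ℂ | 1 < s.re} ∪ {0}) ⊆ U)
    (hF : AnalyticOnNhd ℂ F U) (heq : ∀ s : ℂ, 1 < s.re → F s = Z s) : F 0 = v := by
  have h0U : (0 : ℂ) ∈ U := hsub (Or.inr rfl)
  have h2U : (2 : ℂ) ∈ U := hsub (Or.inl (by simp))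
  have hp : IsPathConnected U := hU.isConnected_iff_isPathConnected.1 hc
  obtain ⟨γ, hγ⟩ := hp.joinedIn 2 h2U 0 h0U
  obtain ⟨N, hN, hγN⟩ : ∃ N : ℝ, 0 < N ∧ ∀ t, -N < (γ t).re := by
    have hcpt : IsCompact (Set.range γ) := isCompact_range γ.continuous
    obtain ⟨R, hR⟩ := hcpt.isBounded.exists_norm_le
    refine ⟨|R| + 1, by positivity, fun t => ?_⟩
    have h1 := hR _ ⟨t, rfl⟩
    have h2 := neg_abs_le (γ t).re
    have h3 := Complex.abs_re_le_norm (γ t)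
    have h4 := le_abs_self R
    linarith
  obtain ⟨P, hP, H, h1, h2, h3⟩ := h N hN
  have hO : IsOpen {s : ℂ | -N < s.re} := isOpen_lt continuous_const Complex.continuous_re
  set W := U ∩ {s : ℂ | -N < s.re} with hW
  have hWo : IsOpen W := hU.inter hO
  set V := connectedComponentIn W 2 with hV
  have hVo : IsOpen V := hWo.connectedComponentIn
  have hVW : V ⊆ W := connectedComponentIn_subset W 2
  have hrange : Set.range γ ⊆ V := by
    refine IsPreconnected.subset_connectedComponentIn (isPreconnected_range γ.continuous)
      ⟨0, γ.source⟩ ?_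
    rintro _ ⟨t, rfl⟩
    exact ⟨hγ t, hγN t⟩
  have h2V : (2 : ℂ) ∈ V := hrange ⟨0, γ.source⟩
  have h0V : (0 : ℂ) ∈ V := hrange ⟨1, γ.target⟩
  have hVan : ∀ s ∈ V, AnalyticAt ℂ F s := fun s hs => hF s (hVW hs).1
  have hHan : AnalyticOnNhd ℂ H V := (h1.analyticOnNhd hO).mono fun s hs => (hVW hs).2
  have hPF : AnalyticOnNhd ℂ (fun s => P.eval s * F s) V := fun s hs =>
    (P.differentiable.analyticAt s).mul (hVan s hs)
  have key : Set.EqOn H (fun s => P.eval s * F s) V := by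
    refine hHan.eqOn_of_preconnected_of_eventuallyEq hPF isPreconnected_connectedComponentIn h2V ?_
    have hmem : {s : ℂ | 1 < s.re} ∈ 𝓝 (2 : ℂ) :=
      (isOpen_lt continuous_const Complex.continuous_re).mem_nhds (by simp)
    filter_upwards [hmem] with s hs
    rw [h2 s hs, heq s hs]
  have h4 : Tendsto F (𝓝[≠] 0) (𝓝 (F 0)) :=
    (hVan 0 h0V).continuousAt.tendsto.mono_left nhdsWithin_le_nhds
  refine tendsto_nhds_unique h4 (h3.congr' ?_)
  filter_upwards [eventually_eval_ne_zero hP, mem_nhdsWithin_of_mem_nhds (hVo.mem_nhds h0V)]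
    with s hs hsV
  rw [key hsV]
  field_simp

end HasCont

lemma rpow_neg_le_mul_rpow_neg {T y a e M : ℝ} (hy : 0 < y) (hy1 : y ≤ 1) (hT : y ≤ T)
    (h1 : e ≤ a) (h2 : a ≤ e + M) : T ^ (-a) ≤ y ^ (-M) * T ^ (-e) := by
  have hT0 : 0 < T := hy.trans_le hT
  have h3 : T ^ (-a) = T ^ (-(a - e)) * T ^ (-e) := by
    rw [← Real.rpow_add hT0]; congr 1; ring
  rw [h3]
  refine mul_le_mul_of_nonneg_right ?_ (by positivity)
  calc T ^ (-(a - e)) ≤ y ^ (-(a - e)) := Real.rpow_le_rpow_of_nonpos hy hT (by linarith)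
    _ ≤ y ^ (-M) := Real.rpow_le_rpow_of_exponent_ge hy hy1 (by linarith)

lemma summable_nat_add_rpow_neg {y e : ℝ} (hy : 0 < y) (he : 1 < e) :
    Summable fun n : ℕ => ((n : ℝ) + y) ^ (-e) := by
  refine ((Real.summable_one_div_nat_add_rpow y e).2 he).congr fun n => ?_
  have : 0 < (n : ℝ) + y := by positivity
  rw [abs_of_pos this, Real.rpow_neg this.le, one_div]

lemma summable_nat_add_nat_add_rpow_neg {y e : ℝ} (hy : 0 < y) (he : 2 < e) :
    Summable fun p : ℕ × ℕ => ((p.1 : ℝ) + p.2 + y) ^ (-e) := by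
  have h1 := summable_nat_add_rpow_neg (half_pos hy) (show 1 < e / 2 by linarith)
  have h2 := h1.mul_of_nonneg h1 (fun n => by positivity) (fun n => by positivity)
  refine Summable.of_nonneg_of_le (fun p => by positivity) (fun p => ?_) h2
  set A : ℝ := p.1 + y / 2
  set B : ℝ := p.2 + y / 2
  have hA : 0 < A := by positivity
  have hB : 0 < B := by positivity
  have : ((p.1 : ℝ) + p.2 + y) = A + B := by simp only [A, B]; ring
  rw [this, ← Real.mul_rpow hA.le hB.le]
  have h3 : (A + B) ^ (-e) = ((A + B) ^ 2) ^ (-(e / 2)) := by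
    rw [← Real.rpow_natCast, ← Real.rpow_mul (by positivity)]
    congr 1; push_cast; ring
  rw [h3]
  exact Real.rpow_le_rpow_of_nonpos (by positivity) (by nlinarith) (by linarith)

lemma tendsto_nat_add_rpow_neg {y e : ℝ} (he : 0 < e) :
    Tendsto (fun n : ℕ => ((n : ℝ) + y) ^ (-e)) atTop (𝓝 0) :=
  (tendsto_rpow_neg_atTop he).comp
    (tendsto_atTop_add_const_right _ _ tendsto_natCast_atTop_atTop)

lemma emRem_eq_zero {G : ℕ → ℝ → ℂ} {x u : ℝ} (K : ℕ) (h0 : G 0 (u + 1) - G 0 u = G 1 (u + x))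
    (h : ∀ k, G (k + 1) (u + 1) = G (k + 1) u) : emRem G x K u = 0 := by
  rw [emRem, Finset.sum_range_succ']
  simp [h, h0, bernCoeff_zero]

lemma differentiable_emRem {G : ℂ → ℕ → ℝ → ℂ} {x u : ℝ} (K : ℕ) (hx : 0 ≤ x) (hu : 0 ≤ u)
    (hG : ∀ k, ∀ t : ℝ, 0 ≤ t → Differentiable ℂ fun s => G s k t) :
    Differentiable ℂ fun s => emRem (G s) x K u := by
  unfold emRem
  refine (hG 1 _ (by linarith)).sub ?_
  refine Differentiable.fun_sum fun k _ => ?_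
  exact ((hG k _ (by linarith)).sub (hG k _ hu)).const_mul _

/-- A series of entire functions dominated by `T i ^ (-(c Re s + K))` is holomorphic on a half
plane. -/
lemma differentiableOn_tsum_of_norm_le_rpow {ι : Type*} {f : ι → ℂ → ℂ} {T : ι → ℝ}
    {y c K N e : ℝ} (hy : 0 < y) (hy1 : y ≤ 1) (hc : 0 ≤ c) (hT : ∀ i, y ≤ T i)
    (he : e = K - c * N) (hsum : Summable fun i => T i ^ (-e))
    (hf : ∀ i, Differentiable ℂ (f i))
    (hb : ∀ R : ℝ, 0 ≤ R → ∃ B : ℝ, 0 ≤ B ∧ ∀ s : ℂ, ‖s‖ ≤ R → -N < s.re →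
      ∀ i, ‖f i s‖ ≤ B * T i ^ (-(c * s.re + K))) :
    DifferentiableOn ℂ (fun s => ∑' i, f i s) {s : ℂ | -N < s.re} := by
  intro s₀ hs₀
  obtain ⟨B, hB, hBb⟩ := hb (‖s₀‖ + 1) (by positivity)
  have hO : IsOpen (Metric.ball (0 : ℂ) (‖s₀‖ + 1) ∩ {s : ℂ | -N < s.re}) :=
    Metric.isOpen_ball.inter (isOpen_lt continuous_const Complex.continuous_re)
  have hmem : s₀ ∈ Metric.ball (0 : ℂ) (‖s₀‖ + 1) ∩ {s : ℂ | -N < s.re} :=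
    ⟨by simp, hs₀⟩
  have := Complex.differentiableOn_tsum_of_summable_norm
    (hsum.mul_left (B * y ^ (-(c * (‖s₀‖ + 1) + c * N))))
    (fun i => (hf i).differentiableOn) hO (fun i s hs => ?_)
  · exact (this.differentiableAt (hO.mem_nhds hmem)).differentiableWithinAt
  · have hs1 : ‖s‖ ≤ ‖s₀‖ + 1 := (mem_ball_zero_iff.1 hs.1).le
    have hs2 : -N < s.re := hs.2
    refine (hBb s hs1 hs2 i).trans ?_
    rw [mul_assoc]
    refine mul_le_mul_of_nonneg_left ?_ hB
    have h1 := (Complex.re_le_norm s).trans hs1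
    refine rpow_neg_le_mul_rpow_neg hy hy1 (hT i) ?_ ?_
    · rw [he]; nlinarith
    · rw [he]; nlinarith

namespace FormPair

variable (Q : FormPair)

lemma exists_norm_emRem_G_le (K : ℕ) {x : ℝ} (hx : x ∈ Set.Icc (0 : ℝ) 1) (R : ℝ) (hR : 0 ≤ R) :
    ∃ B : ℝ, 0 ≤ B ∧ ∀ s : ℂ, ‖s‖ ≤ R → 0 ≤ 2 * s.re + K → ∀ u Y : ℝ, 0 ≤ u → 0 < Y →
      ‖emRem (Q.G s Y) x K u‖ ≤ B * (u + Y) ^ (-(2 * s.re + K)) := by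
  obtain ⟨B, hB, hBb⟩ := Q.exists_norm_G_le (K + 1) R hR
  refine ⟨emConst x K * B, mul_nonneg (emConst_nonneg x K) hB, fun s hs hsK u Y hu hY => ?_⟩
  rw [mul_assoc]
  refine norm_emRem_le K hx (fun k t ht => Q.hasDerivAt_G s (hu.trans ht.1) hY k) fun t ht => ?_
  refine (hBb s hs t Y (hu.trans ht.1) hY).trans (mul_le_mul_of_nonneg_left ?_ hB)
  rw [show 2 * s.re + ((K + 1 : ℕ) : ℝ) - 1 = 2 * s.re + K by push_cast; ring]
  exact Real.rpow_le_rpow_of_nonpos (by linarith) (by linarith [ht.1]) (by linarith)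

/-- The sum over lattice points of the `X`-derivative of `X` times the form. -/
noncomputable def row (x y : ℝ) (s : ℂ) : ℂ :=
  ∑' p : ℕ × ℕ, Q.G s (p.1 + y) 1 (p.2 + x)

noncomputable def rowRem (x y : ℝ) (K : ℕ) (s : ℂ) : ℂ :=
  ∑' p : ℕ × ℕ, emRem (Q.G s (p.1 + y)) x K p.2

lemma rowRem_zero (x y : ℝ) (K : ℕ) : Q.rowRem x y K 0 = 0 := by
  have : ∀ p : ℕ × ℕ, emRem (Q.G 0 (p.1 + y)) x K p.2 = 0 := by
    intro p
    refine emRem_eq_zero K ?_ fun k => ?_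
    · simp [G, D_succ_zero, D_zero_zero]
    · rcases k with _ | k <;> simp [G, D_succ_zero, D_zero_zero]
  simp [rowRem, this]

lemma differentiableOn_rowRem {x y : ℝ} (hx : x ∈ Set.Icc (0 : ℝ) 1) (hy : 0 < y) (hy1 : y ≤ 1)
    {K : ℕ} {N : ℝ} (hK : 2 < K - 2 * N) :
    DifferentiableOn ℂ (Q.rowRem x y K) {s : ℂ | -N < s.re} := by
  unfold rowRem
  refine differentiableOn_tsum_of_norm_le_rpow
    (f := fun (p : ℕ × ℕ) s => emRem (Q.G s (p.1 + y)) x K p.2)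
    (T := fun p : ℕ × ℕ => (p.1 : ℝ) + p.2 + y) hy hy1 zero_le_two
    (fun p => by have : (0 : ℝ) ≤ p.1 + p.2 := by positivity
                 linarith) rfl (summable_nat_add_nat_add_rpow_neg hy hK) ?_ ?_
  · exact fun p => differentiable_emRem K hx.1 (by positivity)
      fun k t ht => Q.differentiable_G ht (by positivity) k
  · intro R hR
    obtain ⟨B, hB, hBb⟩ := Q.exists_norm_emRem_G_le K hx R hR
    refine ⟨B, hB, fun s hs hsN p => ?_⟩
    have := hBb s hs (by linarith) p.2 (p.1 + y) (by positivity) (by positivity)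
    rwa [show (p.2 : ℝ) + (p.1 + y) = p.1 + p.2 + y by ring] at this

lemma summable_emRem {x y : ℝ} (hx : x ∈ Set.Icc (0 : ℝ) 1) (hy : 0 < y) (K : ℕ) {s : ℂ}
    (hs : 1 < s.re) : Summable fun p : ℕ × ℕ => emRem (Q.G s (p.1 + y)) x K p.2 := by
  obtain ⟨B, hB, hBb⟩ := Q.exists_norm_emRem_G_le K hx ‖s‖ (norm_nonneg _)
  have hK : (0 : ℝ) ≤ K := by positivity
  refine Summable.of_norm_bounded ((summable_nat_add_nat_add_rpow_neg (e := 2 * s.re + K) hy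
    (by linarith)).mul_left B) fun p => ?_
  have := hBb s le_rfl (by linarith) p.2 (p.1 + y) (by positivity) (by positivity)
  rwa [show (p.2 : ℝ) + (p.1 + y) = p.1 + p.2 + y by ring] at this

lemma summable_row {x y : ℝ} (hx : 0 ≤ x) (hy : 0 < y) {s : ℂ} (hs : 1 < s.re) :
    Summable fun p : ℕ × ℕ => Q.G s (p.1 + y) 1 (p.2 + x) := by
  obtain ⟨B, hB, hBb⟩ := Q.exists_norm_G_le 1 ‖s‖ (norm_nonneg _)
  refine Summable.of_norm_bounded ((summable_nat_add_nat_add_rpow_neg (y := x + y) (e := 2 * s.re)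
    (by linarith) (by linarith)).mul_left B) fun p => ?_
  have := hBb s le_rfl (p.2 + x) (p.1 + y) (by positivity) (by positivity)
  rwa [show (p.2 : ℝ) + x + (p.1 + y) = p.1 + p.2 + (x + y) by ring,
    show 2 * s.re + ((1 : ℕ) : ℝ) - 1 = 2 * s.re by push_cast; ring] at this

end FormPair

/-- The Hurwitz series. -/
noncomputable def hurwitzSum (y : ℝ) (w : ℂ) : ℂ := ∑' n : ℕ, (((n : ℝ) + y : ℝ) : ℂ) ^ (-w)

lemma summable_hurwitzSum {y : ℝ} (hy : 0 < y) {w : ℂ} (hw : 1 < w.re) :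
    Summable fun n : ℕ => (((n : ℝ) + y : ℝ) : ℂ) ^ (-w) := by
  refine Summable.of_norm_bounded (summable_nat_add_rpow_neg hy hw) fun n => ?_
  rw [Complex.norm_cpow_eq_rpow_re_of_pos (by positivity), Complex.neg_re]

namespace FormPair

variable (Q : FormPair)

lemma G_zero_right (s : ℂ) {Y : ℝ} (hY : 0 < Y) (k : ℕ) :
    Q.G s Y k 0 = k * Q.D (k - 1) s s 0 1 * (Y : ℂ) ^ (-(2 * s + k - 1)) := by
  rcases k with _ | k
  · simp [G]
  · simp only [G, Complex.ofReal_zero, zero_mul, zero_add, Nat.add_sub_cancel]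
    rw [Q.D_homogeneous hY k s s]
    push_cast
    rw [show 2 * s + ((k : ℂ) + 1) - 1 = s + s + k by ring]
    ring

lemma row_eq {x y : ℝ} (hx : x ∈ Set.Icc (0 : ℝ) 1) (hy : 0 < y) (K : ℕ) {s : ℂ}
    (hs : 1 < s.re) : Q.row x y s = -∑ k ∈ range (K + 1),
      bernCoeff k x * (k * Q.D (k - 1) s s 0 1) * hurwitzSum y (2 * s + k - 1)
      + Q.rowRem x y K s := by
  have h1 := Q.summable_row hx.1 hy hs
  have h2 := Q.summable_emRem hx hy K hs
  have h3 : ∀ n : ℕ, ∑' j : ℕ, Q.G s (n + y) 1 (j + x)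
      = -∑ k ∈ range (K + 1), bernCoeff k x * Q.G s (n + y) k 0
        + ∑' j : ℕ, emRem (Q.G s (n + y)) x K j := by
    intro n
    refine tsum_eq_emSum K (fun k _ => ?_) (h1.prod_factor n) (h2.prod_factor n)
    obtain ⟨B, hB, hBb⟩ := Q.exists_norm_G_le k ‖s‖ (norm_nonneg _)
    have hk : (0 : ℝ) ≤ k := by positivity
    have hlim := (tendsto_nat_add_rpow_neg (y := n + y)
      (show 0 < 2 * s.re + k - 1 by linarith)).const_mul B
    rw [mul_zero] at hlim
    exact squeeze_zero_norm
      (fun j => hBb s le_rfl j (n + y) (by positivity) (by positivity)) hlim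
  have h4 : ∀ k : ℕ, Summable fun n : ℕ => bernCoeff k x * Q.G s (n + y) k 0 := by
    intro k
    rcases Nat.eq_zero_or_pos k with rfl | hk
    · simp [G]
    · have hk' : (1 : ℝ) ≤ k := by exact_mod_cast hk
      refine Summable.mul_left _ ?_
      refine ((summable_hurwitzSum hy (w := 2 * s + k - 1) ?_).mul_left
        (k * Q.D (k - 1) s s 0 1)).congr fun n => ?_
      · simp; linarith
      · rw [Q.G_zero_right s (by positivity)]
  rw [row, h1.tsum_prod, rowRem, h2.tsum_prod]
  simp only [h3]
  rw [Summable.tsum_add (summable_sum fun k _ => h4 k).neg h2.prod, tsum_neg,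
    Summable.tsum_finsetSum fun k _ => h4 k]
  congr 2
  refine Finset.sum_congr rfl fun k _ => ?_
  rw [tsum_mul_left, mul_assoc]
  congr 1
  rw [hurwitzSum, ← tsum_mul_left]
  exact tsum_congr fun n => Q.G_zero_right s (by positivity) k

end FormPair

namespace FormPair

/-- The pair of forms `X + Y`, `X + Y`. -/
noncomputable def diag : FormPair :=
  ⟨1, 1, 1, 1, one_pos, one_pos, one_pos, one_pos⟩

end FormPair

lemma exists_hurwitzSum_cont {y : ℝ} (hy : 0 < y) (hy1 : y ≤ 1) (N : ℝ) :
    ∃ H : ℂ → ℂ, DifferentiableOn ℂ H {s | -N < s.re} ∧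
      (∀ s : ℂ, 1 < s.re → H s = (s - 1) * hurwitzSum y s) ∧ H 0 = y - 1 / 2 ∧ H 1 = 1 := by
  obtain ⟨n, hn⟩ := exists_nat_gt N
  set K := n + 2 with hK
  set Q := FormPair.diag
  have hKN : 1 < (K : ℝ) - 1 * N := by rw [hK]; push_cast; linarith
  set g : ℂ → ℕ → ℝ → ℂ := fun s k t => Q.D k (s - 1) 0 t y with hg
  have hgd : ∀ k, ∀ t : ℝ, 0 ≤ t → Differentiable ℂ fun s => g s k t := fun k t ht =>
    Q.differentiable_D ht hy k (differentiable_id.sub_const 1) (differentiable_const 0)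
  have hx : (0 : ℝ) ∈ Set.Icc (0 : ℝ) 1 := by simp
  have hrem : ∀ R : ℝ, 0 ≤ R → ∃ B : ℝ, 0 ≤ B ∧ ∀ s : ℂ, ‖s‖ ≤ R → 0 ≤ s.re + K →
      ∀ n : ℕ, ‖emRem (g s) 0 K n‖ ≤ B * ((n : ℝ) + y) ^ (-(1 * s.re + K)) := by
    intro R hR
    obtain ⟨B, hB, hBb⟩ := Q.exists_norm_D_le (K + 1) (R + 1) (by linarith)
    refine ⟨emConst 0 K * B, mul_nonneg (emConst_nonneg 0 K) hB, fun s hs hsK n => ?_⟩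
    have hn : (0 : ℝ) ≤ n := by positivity
    rw [mul_assoc]
    refine norm_emRem_le K hx (fun k t ht => Q.hasDerivAt_D (hn.trans ht.1) hy k _ _)
      fun t ht => ?_
    refine (hBb (s - 1) 0 ((norm_sub_le _ _).trans (by simpa using hs)) (by simp; linarith) t y
      (hn.trans ht.1) hy).trans (mul_le_mul_of_nonneg_left ?_ hB)
    rw [show (s - 1).re + (0 : ℂ).re + ((K + 1 : ℕ) : ℝ) = 1 * s.re + K by push_cast; simp]
    exact Real.rpow_le_rpow_of_nonpos (by linarith) (by linarith [ht.1]) (by linarith)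
  have hg0 : ∀ s k, g s k 0 = Q.D k (s - 1) 0 0 y := fun _ _ => rfl
  have hg1 : ∀ s : ℂ, ∀ t : ℝ, g s 1 t = (1 - s) * ((t + y : ℝ) : ℂ) ^ (-s) := by
    intro s t
    simp [hg, FormPair.D, Q, FormPair.diag]
  set E : ℂ → ℂ := fun s => ∑' n : ℕ, emRem (g s) 0 K n with hE
  have hEd : DifferentiableOn ℂ E {s : ℂ | -N < s.re} := by
    refine differentiableOn_tsum_of_norm_le_rpow (f := fun (n : ℕ) s => emRem (g s) 0 K n)
      (T := fun n : ℕ => (n : ℝ) + y) hy hy1 zero_le_one (fun n => by simp) rfl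
      (summable_nat_add_rpow_neg hy hKN) (fun n => differentiable_emRem K le_rfl (by positivity) hgd)
      fun R hR => ?_
    obtain ⟨B, hB, hBb⟩ := hrem R hR
    exact ⟨B, hB, fun s hs hsN n => hBb s hs (by linarith) n⟩
  refine ⟨fun s => ∑ k ∈ range (K + 1), bernCoeff k 0 * g s k 0 - E s, ?_, ?_, ?_, ?_⟩
  · refine DifferentiableOn.sub (Differentiable.differentiableOn ?_) hEd
    exact Differentiable.fun_sum fun k _ => (hgd k 0 le_rfl).const_mul _
  · intro s hs
    have hsum : Summable fun n : ℕ => g s 1 (n + 0) := by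
      simp only [add_zero, hg1]
      exact (summable_hurwitzSum hy hs).mul_left _
    have hsr : Summable fun n : ℕ => emRem (g s) 0 K n := by
      obtain ⟨B, hB, hBb⟩ := hrem ‖s‖ (norm_nonneg _)
      have hK0 : (0 : ℝ) ≤ K := by positivity
      exact Summable.of_norm_bounded
        ((summable_nat_add_rpow_neg (e := 1 * s.re + K) hy (by linarith)).mul_left B)
        fun n => hBb s le_rfl (by linarith) n
    have hlim : ∀ k ≤ K, Tendsto (fun n : ℕ => g s k n) atTop (𝓝 0) := by
      intro k _
      obtain ⟨B, hB, hBb⟩ := Q.exists_norm_D_le k (‖s‖ + 1) (by positivity)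
      have hk : (0 : ℝ) ≤ k := by positivity
      have hlim := (tendsto_nat_add_rpow_neg (y := y)
        (show 0 < s.re - 1 + k by linarith)).const_mul B
      rw [mul_zero] at hlim
      refine squeeze_zero_norm (fun n => ?_) hlim
      have := hBb (s - 1) 0 ((norm_sub_le _ _).trans (by simp)) (by simp; positivity) n y
        (by positivity) hy
      simpa using this
    have key := tsum_eq_emSum K hlim hsum hsr
    simp only [add_zero, hg1, tsum_mul_left] at key
    change (1 - s) * hurwitzSum y s = _ at key
    rw [hE]
    linear_combination key
  · have h2 : ∀ k, ∀ t, 0 ≤ t → g 0 0 t = t + y ∧ g 0 1 t = 1 ∧ g 0 (k + 2) t = 0 := by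
      intro k t ht
      have hk : ∀ t : ℝ, 0 ≤ t → g 0 1 t = 1 := fun t ht => by rw [hg1]; simp
      refine ⟨?_, hk t ht, ?_⟩
      · simp [hg, FormPair.D, Q, FormPair.diag]
      · simp only [hg]
        rw [FormPair.D, show (0 : ℂ) - 1 + 1 = 0 by ring, FormPair.D_succ_zero]
        simp
    have hE0 : E 0 = 0 := by
      rw [hE]
      refine (tsum_congr fun n => ?_).trans tsum_zero
      have hn : (0 : ℝ) ≤ n := by positivity
      refine emRem_eq_zero K ?_ fun k => ?_
      · rw [(h2 0 _ (by positivity)).1, (h2 0 _ hn).1, (h2 0 _ (by positivity)).2.1]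
        push_cast; ring
      · rcases k with _ | k
        · rw [(h2 0 _ (by positivity)).2.1, (h2 0 _ hn).2.1]
        · rw [(h2 k _ (by positivity)).2.2, (h2 k _ hn).2.2]
    change ∑ k ∈ range (K + 1), bernCoeff k 0 * g 0 k 0 - E 0 = _
    rw [hE0, hK, Finset.sum_range_succ', Finset.sum_range_succ']
    rw [Finset.sum_eq_zero fun k _ => by rw [(h2 k 0 le_rfl).2.2, mul_zero]]
    rw [(h2 0 0 le_rfl).1, (h2 0 0 le_rfl).2.1, bernCoeff_zero, zero_add, bernCoeff_one]
    push_cast; ring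
  · have h2 : ∀ k, ∀ t, 0 ≤ t → g 1 0 t = 1 ∧ g 1 (k + 1) t = 0 := by
      intro k t ht
      simp only [hg, sub_self]
      exact ⟨Q.D_zero_zero, Q.D_succ_zero k t y⟩
    have hE0 : E 1 = 0 := by
      rw [hE]
      refine (tsum_congr fun n => ?_).trans tsum_zero
      have hn : (0 : ℝ) ≤ n := by positivity
      refine emRem_eq_zero K ?_ fun k => ?_
      · rw [(h2 0 _ (by positivity)).1, (h2 0 _ hn).1, (h2 0 _ (by positivity)).2, sub_self]
      · rw [(h2 k _ (by positivity)).2, (h2 k _ hn).2]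
    change ∑ k ∈ range (K + 1), bernCoeff k 0 * g 1 k 0 - E 1 = _
    rw [hE0, Finset.sum_range_succ']
    rw [Finset.sum_eq_zero fun k _ => by rw [(h2 k 0 le_rfl).2, mul_zero]]
    rw [(h2 0 0 le_rfl).1, bernCoeff_zero]
    ring

namespace FormPair

variable (Q : FormPair)

lemma hasCont_hurwitz_term {y : ℝ} (hy : 0 < y) (hy1 : y ≤ 1) {N : ℝ} (hN : 0 < N) (c : ℂ)
    (k : ℕ) : HasCont N (fun s => c * (k * Q.D (k - 1) s s 0 1) * hurwitzSum y (2 * s + k - 1))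
      (if k = 1 then c * (1 / 2 - y) else
        if k = 2 then -c * (Q.a / Q.b + Q.a' / Q.b') else 0) := by
  obtain ⟨H, hH, hHe, hH0, hH1⟩ := exists_hurwitzSum_cont hy hy1 (2 * N + 1)
  have hO : IsOpen {s : ℂ | -N < s.re} := isOpen_lt continuous_const Complex.continuous_re
  have hD : Differentiable ℂ fun s => c * (k * Q.D (k - 1) s s 0 1) :=
    ((Q.differentiable_D le_rfl one_pos (k - 1) differentiable_id
      differentiable_id).const_mul _).const_mul _
  have hlin : Differentiable ℂ fun s : ℂ => 2 * s + k - 1 :=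
    ((differentiable_id.const_mul 2).add_const _).sub_const _
  have hHk : DifferentiableOn ℂ (fun s => H (2 * s + k - 1)) {s : ℂ | -N < s.re} := by
    refine hH.comp hlin.differentiableOn fun s hs => ?_
    have hs' : -N < s.re := hs
    have : (0 : ℝ) ≤ k := by positivity
    simp
    linarith
  have hmem0 : (0 : ℂ) ∈ {s : ℂ | -N < s.re} := by simpa using hN
  have hHk0 : Tendsto (fun s => H (2 * s + k - 1)) (𝓝[≠] 0) (𝓝 (H (2 * 0 + k - 1))) :=
    ((hHk.differentiableAt (hO.mem_nhds hmem0)).continuousAt).tendsto.mono_left nhdsWithin_le_nhds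
  set P : Polynomial ℂ := Polynomial.C 2 * Polynomial.X + Polynomial.C ((k : ℂ) - 2) with hP
  have hPe : ∀ s, P.eval s = 2 * s + (k - 2) := fun s => by simp [hP]
  have hP0 : P ≠ 0 := by
    intro h
    have h1 := hPe 0
    have h2 := hPe 1
    rw [h] at h1 h2
    simp at h1 h2
    rw [← h2] at h1
    norm_num at h1
  rcases Nat.eq_zero_or_pos k with rfl | hk
  · have := HasCont.of_differentiableOn (Z := fun _ => 0) hN (differentiableOn_const _)
    simpa using this
  refine ⟨P, hP0, fun s => c * (k * Q.D (k - 1) s s 0 1) * H (2 * s + k - 1),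
    hD.differentiableOn.mul hHk, ?_, ?_⟩
  · intro s hs
    have hk' : (1 : ℝ) ≤ k := by exact_mod_cast hk
    beta_reduce
    rw [hHe _ (by simp; linarith), hPe]
    ring
  · rcases eq_or_ne k 2 with rfl | hk2
    · simp only [hPe]
      have hw : Differentiable ℂ fun s => -c * (Q.a * Q.D 0 (s + 1) s 0 1
          + Q.a' * Q.D 0 s (s + 1) 0 1) := by
        refine Differentiable.const_mul (Differentiable.add ?_ ?_) _
        · exact (Q.differentiable_D le_rfl one_pos 0 (differentiable_id.add_const 1)
            differentiable_id).const_mul _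
        · exact (Q.differentiable_D le_rfl one_pos 0 differentiable_id
            (differentiable_id.add_const 1)).const_mul _
      have h1 := (hw.continuous.continuousAt (x := 0)).tendsto.mono_left
        (nhdsWithin_le_nhds (s := {0}ᶜ))
      have h2 := h1.mul hHk0
      have hv : (-c * (Q.a * Q.D 0 (0 + 1) 0 0 1 + Q.a' * Q.D 0 0 (0 + 1) 0 1))
          * H (2 * 0 + ((2 : ℕ) : ℂ) - 1) = -c * (Q.a / Q.b + Q.a' / Q.b') := by
        rw [show (2 * 0 + ((2 : ℕ) : ℂ) - 1) = 1 by norm_num, hH1]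
        simp [D, Complex.cpow_neg_one, div_eq_mul_inv]
      rw [hv] at h2
      simp only [OfNat.ofNat_ne_one, if_false, if_true]
      refine h2.congr' ?_
      filter_upwards [self_mem_nhdsWithin] with s hs
      have hs0 : s ≠ 0 := hs
      simp only [D, Nat.add_one_sub_one]
      rw [eq_div_iff (by simpa using hs0)]
      push_cast
      ring
    · have hPne : P.eval 0 ≠ 0 := by
        rw [hPe, mul_zero, zero_add, sub_ne_zero]
        exact_mod_cast hk2
      have h1 := (hD.continuous.continuousAt (x := 0)).tendsto.mono_left
        (nhdsWithin_le_nhds (s := {0}ᶜ))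
      have h3 : Tendsto (fun s => P.eval s) (𝓝[≠] 0) (𝓝 (P.eval 0)) :=
        P.continuous.continuousAt.tendsto.mono_left nhdsWithin_le_nhds
      have h4 := (h1.mul hHk0).div h3 hPne
      refine (Tendsto.congr (fun s => rfl) h4).trans (le_of_eq ?_)
      congr 1
      rcases eq_or_ne k 1 with rfl | hk1
      · rw [hPe, show (2 * 0 + ((1 : ℕ) : ℂ) - 1) = 0 by norm_num, hH0]
        simp [D_zero_zero]
        ring
      · obtain ⟨j, rfl⟩ : ∃ j, k = j + 3 := ⟨k - 3, by omega⟩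
        rw [if_neg hk1, if_neg hk2, show j + 3 - 1 = (j + 1) + 1 from rfl, D_succ_zero]
        simp

lemma hasCont_row {x y : ℝ} (hx : x ∈ Set.Icc (0 : ℝ) 1) (hy : 0 < y) (hy1 : y ≤ 1) {N : ℝ}
    (hN : 0 < N) : HasCont N (Q.row x y)
      ((x - 1 / 2) * (y - 1 / 2) + (x ^ 2 - x + 1 / 6) / 2 * (Q.a / Q.b + Q.a' / Q.b')) := by
  obtain ⟨n, hn⟩ := exists_nat_gt (2 * N)
  set K := n + 2 with hK
  have hKN : 2 < (K : ℝ) - 2 * N := by rw [hK]; push_cast; linarith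
  have h1 := HasCont.sum (N := N) (range (K + 1)) fun k _ =>
    Q.hasCont_hurwitz_term hy hy1 hN (bernCoeff k x) k
  have h2 := HasCont.of_differentiableOn hN (Q.differentiableOn_rowRem hx hy hy1 hKN)
  have h3 := (h1.mul_entire (differentiable_const (-1))).add h2
  rw [rowRem_zero, add_zero, hK, Finset.sum_range_succ', Finset.sum_range_succ',
    Finset.sum_range_succ', Finset.sum_eq_zero fun k _ => by
      rw [if_neg (by omega), if_neg (by omega)]] at h3
  simp only [zero_add, Nat.reduceAdd, if_true, OfNat.ofNat_ne_one, if_false, zero_ne_one,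
    OfNat.zero_ne_ofNat, bernCoeff_one, bernCoeff_two, add_zero] at h3
  have h4 := h3.congr (Z' := Q.row x y) fun s hs => by
    rw [Q.row_eq hx hy (n + 2) hs]; ring
  convert h4 using 1
  ring

/-- The zeta function of the translated lattice cone. -/
noncomputable def zeta (x y : ℝ) (s : ℂ) : ℂ := ∑' p : ℕ × ℕ, Q.D 0 s s (p.1 + x) (p.2 + y)

lemma summable_zeta {x y : ℝ} (hx : 0 ≤ x) (hy : 0 < y) {s : ℂ} (hs : 1 < s.re) :
    Summable fun p : ℕ × ℕ => Q.D 0 s s (p.1 + x) (p.2 + y) := by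
  obtain ⟨B, hB, hBb⟩ := Q.exists_norm_D_le 0 ‖s‖ (norm_nonneg _)
  refine Summable.of_norm_bounded ((summable_nat_add_nat_add_rpow_neg (y := x + y) (e := 2 * s.re)
    (by linarith) (by linarith)).mul_left B) fun p => ?_
  have := hBb s s le_rfl le_rfl (p.1 + x) (p.2 + y) (by positivity) (by positivity)
  rwa [show (p.1 : ℝ) + x + (p.2 + y) = p.1 + p.2 + (x + y) by ring,
    show s.re + s.re + ((0 : ℕ) : ℝ) = 2 * s.re by push_cast; ring] at this

/-- Shintani's formula for the value at `0`. -/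
lemma hasCont_zeta {x y : ℝ} (hx : 0 < x) (hx1 : x ≤ 1) (hy : 0 < y) (hy1 : y ≤ 1) {N : ℝ}
    (hN : 0 < N) : HasCont N (Q.zeta x y)
      ((x - 1 / 2) * (y - 1 / 2) + ((x ^ 2 - x + 1 / 6) * (Q.a / Q.b + Q.a' / Q.b')
        + (y ^ 2 - y + 1 / 6) * (Q.b / Q.a + Q.b' / Q.a')) / 4) := by
  have h1 := (Q.hasCont_row (x := x) ⟨hx.le, hx1⟩ hy hy1 hN).add
    (Q.swap.hasCont_row (x := y) ⟨hy.le, hy1⟩ hx hx1 hN)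
  have h2 := h1.congr (Z' := fun s => (Polynomial.C 2 - Polynomial.C 2 * Polynomial.X
      : Polynomial ℂ).eval s * Q.zeta x y s) fun s hs => by
    have e1 := Q.summable_row hx.le hy hs
    have e2 := Q.swap.summable_row hy.le hx hs
    simp only [row, zeta, Polynomial.eval_sub, Polynomial.eval_C, Polynomial.eval_mul,
      Polynomial.eval_X]
    have e3 : Summable fun p : ℕ × ℕ => Q.G s (p.2 + y) 1 (p.1 + x) :=
      (Equiv.prodComm ℕ ℕ).summable_iff.2 e1
    have e4 : ∑' p : ℕ × ℕ, Q.G s (p.1 + y) 1 (p.2 + x)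
        = ∑' p : ℕ × ℕ, Q.G s (p.2 + y) 1 (p.1 + x) :=
      ((Equiv.prodComm ℕ ℕ).tsum_eq fun p : ℕ × ℕ => Q.G s (p.1 + y) 1 (p.2 + x)).symm
    rw [e4, ← e3.tsum_add e2, ← tsum_mul_left]
    exact tsum_congr fun p => Q.G_one_add_swap_G_one s (by positivity) (by positivity)
  have h3 := h2.div_polynomial (by simp)
  convert h3 using 1
  simp [swap]
  ring

lemma hasSum_nat_prod_split {f : ℕ × ℕ → ℂ} {u v : ℂ} (hu : HasSum (fun n : ℕ => f (n, 0)) u)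
    (hv : HasSum (fun p : ℕ × ℕ => f (p.1, p.2 + 1)) v) : HasSum f (u + v) := by
  have hi : Function.Injective fun n : ℕ => ((n, 0) : ℕ × ℕ) := fun a b h => by simpa using h
  have hj : Function.Injective fun p : ℕ × ℕ => ((p.1, p.2 + 1) : ℕ × ℕ) := by
    rintro ⟨a, b⟩ ⟨c, d⟩ h
    simpa using h
  have hcompl : IsCompl (Set.range fun n : ℕ => ((n, 0) : ℕ × ℕ))
      (Set.range fun p : ℕ × ℕ => ((p.1, p.2 + 1) : ℕ × ℕ)) := by
    refine isCompl_iff.2 ⟨Set.disjoint_left.2 ?_, codisjoint_iff.2 ?_⟩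
    · rintro _ ⟨n, rfl⟩ ⟨p, hp⟩
      simp at hp
    · ext ⟨a, b⟩
      rcases b with _ | b <;> simp
  exact HasSum.add_isCompl hcompl ((hi.hasSum_range_iff (f := f)).2 hu)
    ((hj.hasSum_range_iff (f := f)).2 hv)

lemma hasSum_zeta_zero {x : ℝ} (hx : 0 < x) {s : ℂ} (hs : 1 < s.re) :
    HasSum (fun p : ℕ × ℕ => Q.D 0 s s (p.1 + x) (p.2 + (0 : ℝ)))
      (Q.D 0 s s 1 0 * hurwitzSum x (2 * s) + Q.zeta x 1 s) := by
  refine hasSum_nat_prod_split ?_ ?_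
  · refine ((summable_hurwitzSum hx (w := 2 * s) (by simp; linarith)).hasSum.mul_left
      (Q.D 0 s s 1 0)).congr_fun fun n => ?_
    have := Q.swap.D_homogeneous (Y := n + x) (by positivity) 0 s s
    simp only [D, swap, mul_zero, zero_add, add_zero, Nat.cast_zero, ← two_mul] at this ⊢
    rw [this]
    ring
  · refine ((Q.summable_zeta hx.le one_pos hs).hasSum).congr_fun fun p => ?_
    simp

lemma hasCont_zeta_zero {x : ℝ} (hx : 0 < x) (hx1 : x ≤ 1) {N : ℝ}
    (hN : 0 < N) : HasCont N (Q.zeta x 0)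
      ((x - 1 / 2) * ((0 : ℝ) - 1 / 2) + ((x ^ 2 - x + 1 / 6) * (Q.a / Q.b + Q.a' / Q.b')
        + ((0 : ℝ) ^ 2 - (0 : ℝ) + 1 / 6) * (Q.b / Q.a + Q.b' / Q.a')) / 4) := by
  have h1 := (Q.hasCont_zeta hx hx1 one_pos le_rfl hN).add
    (Q.swap.hasCont_hurwitz_term hx hx1 hN 1 1)
  have h2 := h1.congr (Z' := Q.zeta x 0) fun s hs => by
    rw [show Q.zeta x 0 s = _ from (Q.hasSum_zeta_zero hx hs).tsum_eq]
    simp [D, swap]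
    ring
  convert h2 using 1
  simp
  ring

end FormPair

lemma int_periodic_of_succ {P : ℤ → Prop} {m : ℕ} (hm : 0 < m) (h0 : P 0)
    (hper : ∀ i, P i → P (i - m)) (h : ∀ i, P i → P (i + 1)) (i : ℤ) : P i := by
  have h1 : ∀ k : ℕ, P (-(k * m)) := by
    intro k
    induction k with
    | zero => simpa using h0
    | succ k ih =>
      have := hper _ ih
      convert this using 1
      push_cast; ring
  have h2 : ∀ (n : ℕ) (j : ℤ), P j → P (j + n) := by
    intro n j hj
    induction n with
    | zero => simpa using hj
    | succ n ih =>
      have := h _ ih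
      convert this using 1
      push_cast; ring
  have hm' : (1 : ℤ) ≤ m := by exact_mod_cast hm
  have h3 : 0 ≤ i + (i.natAbs : ℤ) * m := by
    have : -(i.natAbs : ℤ) ≤ i := by omega
    nlinarith [Int.natCast_nonneg i.natAbs]
  have := h2 (i + (i.natAbs : ℤ) * m).toNat _ (h1 i.natAbs)
  rw [Int.toNat_of_nonneg h3] at this
  convert this using 1
  ring

/-- A ray class character together with a periodic minus continued fraction. -/
structure ConeData (K : Type*) [Field K] [NumberField K] where
  σ : K →+* ℝ
  σ' : K →+* ℝ
  hdeg : Module.finrank ℚ K = 2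
  hσσ' : σ ≠ σ'
  q : ℕ
  hq : 0 < q
  𝔟 : Ideal (𝓞 K)
  δ : K
  hδ2 : 2 < σ δ
  hδ'0 : 0 < σ' δ
  hδ'1 : σ' δ < 1
  hbinv : ∀ z : K,
    z ∈ ((𝔟 : FractionalIdeal (𝓞 K)⁰ K))⁻¹ ↔ ∃ a b : ℤ, z = (a : K) + (b : K) * δ
  χ : FractionalIdeal (𝓞 K)⁰ K → ℂ
  hχmul : ∀ I J : FractionalIdeal (𝓞 K)⁰ K,
    (∃ I₁ I₂ : Ideal (𝓞 K), IsCoprime I₁ (Ideal.span {(q : 𝓞 K)}) ∧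
      IsCoprime I₂ (Ideal.span {(q : 𝓞 K)}) ∧ I₂ ≠ 0 ∧
      I = (I₁ : FractionalIdeal (𝓞 K)⁰ K) / (I₂ : FractionalIdeal (𝓞 K)⁰ K)) →
    (∃ J₁ J₂ : Ideal (𝓞 K), IsCoprime J₁ (Ideal.span {(q : 𝓞 K)}) ∧
      IsCoprime J₂ (Ideal.span {(q : 𝓞 K)}) ∧ J₂ ≠ 0 ∧
      J = (J₁ : FractionalIdeal (𝓞 K)⁰ K) / (J₂ : FractionalIdeal (𝓞 K)⁰ K)) →
    I ≠ 0 → J ≠ 0 → χ (I * J) = χ I * χ J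
  hχprin : ∀ a : K, 0 < σ a → 0 < σ' a → (∃ y : 𝓞 K, a = 1 + (q : 𝓞 K) * y) →
    χ (spanSingleton (𝓞 K)⁰ a) = 1
  hχzero : ∀ I : FractionalIdeal (𝓞 K)⁰ K,
    ¬ (I ≠ 0 ∧ ∃ I₁ I₂ : Ideal (𝓞 K), IsCoprime I₁ (Ideal.span {(q : 𝓞 K)}) ∧
      IsCoprime I₂ (Ideal.span {(q : 𝓞 K)}) ∧ I₂ ≠ 0 ∧
      I = (I₁ : FractionalIdeal (𝓞 K)⁰ K) / (I₂ : FractionalIdeal (𝓞 K)⁰ K)) →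
    χ I = 0
  m : ℕ
  hm : 0 < m
  b : ℤ → ℤ
  hb2 : ∀ i, 2 ≤ b i
  hbper : ∀ i, b (i + m) = b i
  δseq : ℤ → K
  hδ0 : δseq 0 = δ
  hδne : ∀ i, δseq i ≠ 0
  hδrec : ∀ i, δseq i = (b i : K) - 1 / δseq (i + 1)
  hδper : ∀ i, δseq (i + m) = δseq i
  A : ℤ → K
  hAm1 : A (-1) = δ
  hA0 : A 0 = 1
  hArec : ∀ i : ℤ, A (i + 1) = (b i : K) * A i - A (i - 1)
  hAbasis : ∀ i : ℤ, ∀ z : K,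
    z ∈ ((𝔟 : FractionalIdeal (𝓞 K)⁰ K))⁻¹ ↔ ∃ u v : ℤ, z = (u : K) * A (i - 1) + (v : K) * A i
  ε : (𝓞 K)ˣ
  hεpos : 0 < σ ((ε : 𝓞 K) : K) ∧ 0 < σ' ((ε : 𝓞 K) : K)
  hεfund : ∀ u : (𝓞 K)ˣ, 0 < σ ((u : 𝓞 K) : K) → 0 < σ' ((u : 𝓞 K) : K) →
    ∃ j : ℤ, ((u : 𝓞 K) : K) = (((ε : 𝓞 K) : K)) ^ j
  hshift : ∀ i : ℤ, ((ε : 𝓞 K) : K) * A i = A (i - m)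

namespace ConeData

variable {K : Type*} [Field K] [NumberField K] (S : ConeData K)

lemma A_sub_one (i : ℤ) : S.A (i - 1) = S.δseq i * S.A i := by
  induction i using Int.induction_on with
  | zero => simp [S.hAm1, S.hA0, S.hδ0]
  | succ i ih =>
    have h1 := S.hArec i
    have h2 := S.hδrec i
    have h3 := S.hδne (i + 1)
    rw [add_sub_cancel_right, h1, ih]
    have : (S.b i : K) = S.δseq i + 1 / S.δseq (i + 1) := by rw [h2]; ring
    rw [this]
    field_simp
    ring
  | pred i ih =>
    have h1 := S.hArec (-(i : ℤ) - 1)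
    have h2 := S.hδrec (-(i : ℤ) - 1)
    rw [sub_add_cancel] at h1 h2
    have h3 := S.hδne (-(i : ℤ))
    have h4 : S.A (-(i : ℤ)) = 1 / S.δseq (-(i : ℤ)) * S.A (-(i : ℤ) - 1) := by
      rw [ih]; field_simp
    rw [h2, sub_mul, ← h4]
    linear_combination h1

lemma one_lt_σδ (i : ℤ) : 1 < S.σ (S.δseq i) := by
  have := int_periodic_of_succ (P := fun i => 1 < S.σ (S.δseq (-i))) S.hm ?_ ?_ ?_ (-i)
  · simpa using this
  · simp only [neg_zero, S.hδ0]; linarith [S.hδ2]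
  · intro i hi
    rwa [show -(i - (S.m : ℤ)) = -i + S.m by ring, S.hδper]
  · intro i hi
    have h1 := congrArg S.σ (S.hδrec (-(i + 1)))
    rw [show -(i + 1) + 1 = -i by ring] at h1
    rw [h1, map_sub, map_div₀, map_one, map_intCast]
    have h2 : (2 : ℝ) ≤ S.b (-(i + 1)) := by exact_mod_cast S.hb2 _
    have h3 : 1 / S.σ (S.δseq (-i)) < 1 := by
      rw [div_lt_one (by linarith)]; exact hi
    linarith

lemma σ'δ_mem (i : ℤ) : 0 < S.σ' (S.δseq i) ∧ S.σ' (S.δseq i) < 1 := by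
  refine int_periodic_of_succ (P := fun i => 0 < S.σ' (S.δseq i) ∧ S.σ' (S.δseq i) < 1)
    S.hm ?_ ?_ ?_ i
  · rw [S.hδ0]; exact ⟨S.hδ'0, S.hδ'1⟩
  · intro i hi
    have := S.hδper (i - S.m)
    rw [sub_add_cancel] at this
    rwa [← this]
  · intro i hi
    have h1 := congrArg S.σ' (S.hδrec i)
    rw [map_sub, map_div₀, map_one, map_intCast] at h1
    have h2 : (2 : ℝ) ≤ S.b i := by exact_mod_cast S.hb2 _
    have h3 : 1 < (S.σ' (S.δseq (i + 1)))⁻¹ := by rw [← one_div]; linarith [hi.2]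
    have h4 : 0 < S.σ' (S.δseq (i + 1)) := by
      have : 0 < (S.σ' (S.δseq (i + 1)))⁻¹ := by linarith
      exact inv_pos.1 this
    exact ⟨h4, (one_lt_inv₀ h4).1 h3⟩

lemma pos_of_δ (τ : K →+* ℝ) (h : ∀ i, 0 < τ (S.δseq i)) (i : ℤ) : 0 < τ (S.A i) := by
  induction i using Int.induction_on with
  | zero => simp [S.hA0]
  | succ i ih =>
    have h1 := S.A_sub_one (i + 1)
    rw [add_sub_cancel_right] at h1
    rw [h1, map_mul] at ih
    exact (pos_iff_pos_of_mul_pos ih).1 (h _)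
  | pred i ih =>
    rw [S.A_sub_one, map_mul]
    exact mul_pos (h _) ih

lemma σA_pos (i : ℤ) : 0 < S.σ (S.A i) :=
  S.pos_of_δ S.σ (fun i => by linarith [S.one_lt_σδ i]) i

lemma σ'A_pos (i : ℤ) : 0 < S.σ' (S.A i) :=
  S.pos_of_δ S.σ' (fun i => (S.σ'δ_mem i).1) i

lemma det_pos (i : ℤ) :
    0 < S.σ (S.A (i - 1)) * S.σ' (S.A i) - S.σ (S.A i) * S.σ' (S.A (i - 1)) := by
  rw [S.A_sub_one i, map_mul, map_mul]
  have h1 := mul_pos (S.σA_pos i) (S.σ'A_pos i)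
  have h2 := S.one_lt_σδ i
  have h3 := (S.σ'δ_mem i).2
  nlinarith

/-- Coordinates with respect to `A (i - 1)`, `A i` are unique, already over the reals. -/
lemma coord_unique (i : ℤ) {u v u' v' : ℝ}
    (h : u * S.σ (S.A (i - 1)) + v * S.σ (S.A i) = u' * S.σ (S.A (i - 1)) + v' * S.σ (S.A i))
    (h' : u * S.σ' (S.A (i - 1)) + v * S.σ' (S.A i)
      = u' * S.σ' (S.A (i - 1)) + v' * S.σ' (S.A i)) : u = u' ∧ v = v' := by
  have hd := (S.det_pos i).ne'
  constructor
  · apply mul_right_cancel₀ hd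
    linear_combination S.σ' (S.A i) * h - S.σ (S.A i) * h'
  · apply mul_right_cancel₀ hd
    linear_combination S.σ (S.A (i - 1)) * h' - S.σ' (S.A (i - 1)) * h

lemma int_coord_unique (i : ℤ) {u v u' v' : ℤ}
    (h : (u : K) * S.A (i - 1) + v * S.A i = u' * S.A (i - 1) + v' * S.A i) :
    u = u' ∧ v = v' := by
  have h1 := congrArg S.σ h
  have h2 := congrArg S.σ' h
  simp only [map_add, map_mul, map_intCast] at h1 h2
  obtain ⟨h3, h4⟩ := S.coord_unique i h1 h2
  exact ⟨by exact_mod_cast h3, by exact_mod_cast h4⟩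

/-- The slope of the ray spanned by `α`. -/
noncomputable def slope (α : K) : ℝ := S.σ α / S.σ' α

lemma slope_A_lt (i : ℤ) : S.slope (S.A i) < S.slope (S.A (i - 1)) := by
  rw [slope, slope, div_lt_div_iff₀ (S.σ'A_pos i) (S.σ'A_pos (i - 1))]
  linarith [S.det_pos i]

lemma slope_A_strictAnti : StrictAnti fun i => S.slope (S.A i) :=
  strictAnti_int_of_succ_lt fun i => by simpa using S.slope_A_lt (i + 1)

lemma ε_ne_zero : ((S.ε : 𝓞 K) : K) ≠ 0 := fun h => by simpa [h] using S.hεpos.1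

lemma ε_zpow_mul_A (j i : ℤ) : ((S.ε : 𝓞 K) : K) ^ j * S.A i = S.A (i - j * S.m) := by
  induction j using Int.induction_on with
  | zero => simp
  | succ j ih =>
    rw [zpow_add_one₀ S.ε_ne_zero, mul_right_comm, ih, mul_comm, S.hshift]
    congr 1; ring
  | pred j ih =>
    rw [zpow_sub_one₀ S.ε_ne_zero, mul_right_comm, ih]
    have := S.hshift (i - (-(j : ℤ) - 1) * S.m)
    rw [show i - (-(j : ℤ) - 1) * S.m - S.m = i - -(j : ℤ) * S.m by ring] at this
    rw [← this, mul_right_comm, mul_inv_cancel₀ S.ε_ne_zero, one_mul]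

lemma slope_A_shift (j : ℤ) :
    S.slope (S.A (-(j * S.m))) = S.slope ((S.ε : 𝓞 K) : K) ^ j := by
  have h := S.ε_zpow_mul_A j 0
  rw [S.hA0, mul_one, zero_sub] at h
  rw [← h, slope, slope, map_zpow₀, map_zpow₀, div_zpow]

lemma one_lt_slope_ε : 1 < S.slope ((S.ε : 𝓞 K) : K) := by
  have h := S.slope_A_shift 1
  rw [zpow_one, one_mul] at h
  have hm : (0 : ℤ) < S.m := by exact_mod_cast S.hm
  have := S.slope_A_strictAnti (show -(S.m : ℤ) < 0 by omega)
  simp only [h, S.hA0] at this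
  simpa [slope] using this

lemma exists_slope_between {ρ : ℝ} (hρ : 0 < ρ) :
    ∃ i : ℤ, S.slope (S.A i) < ρ ∧ ρ ≤ S.slope (S.A (i - 1)) := by
  have h1 := S.one_lt_slope_ε
  obtain ⟨n, hn⟩ := pow_unbounded_of_one_lt ρ h1
  obtain ⟨k, hk⟩ := pow_unbounded_of_one_lt ρ⁻¹ h1
  have hb : ρ < S.slope (S.A (-((n : ℤ) * S.m))) := by
    rw [slope_A_shift, zpow_natCast]; exact hn
  have ha : S.slope (S.A (-(-(k : ℤ) * S.m))) < ρ := by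
    rw [slope_A_shift, zpow_neg, zpow_natCast]
    exact inv_lt_of_inv_lt₀ hρ hk
  obtain ⟨i, hi, hmin⟩ := Int.exists_least_of_bdd (P := fun i => S.slope (S.A i) < ρ)
    ⟨-((n : ℤ) * S.m), fun z hz => by
      by_contra! hlt
      have := S.slope_A_strictAnti hlt
      simp only at this
      linarith⟩ ⟨_, ha⟩
  refine ⟨i, hi, ?_⟩
  by_contra! hlt
  have := hmin _ hlt
  omega

lemma slope_unique {ρ : ℝ} {i j : ℤ} (hi : S.slope (S.A i) < ρ ∧ ρ ≤ S.slope (S.A (i - 1)))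
    (hj : S.slope (S.A j) < ρ ∧ ρ ≤ S.slope (S.A (j - 1))) : i = j := by
  have h1 : j - 1 < i := S.slope_A_strictAnti.lt_iff_gt.1 (hi.1.trans_le hj.2)
  have h2 : i - 1 < j := S.slope_A_strictAnti.lt_iff_gt.1 (hj.1.trans_le hi.2)
  omega

/-- `α` lies in the half-open cone spanned by `A (i - 1)` (included) and `A i` (excluded). -/
lemma slope_mem_iff (i : ℤ) {α : K} (hα' : 0 < S.σ' α) {u v : ℤ}
    (h : α = u * S.A (i - 1) + v * S.A i) :
    (S.slope (S.A i) < S.slope α ∧ S.slope α ≤ S.slope (S.A (i - 1))) ↔ 0 < u ∧ 0 ≤ v := by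
  have e1 := congrArg S.σ h
  have e2 := congrArg S.σ' h
  simp only [map_add, map_mul, map_intCast] at e1 e2
  have hd := S.det_pos i
  rw [slope, slope, slope, div_lt_div_iff₀ (S.σ'A_pos i) hα', div_le_div_iff₀ hα' (S.σ'A_pos _)]
  have h1 : S.σ α * S.σ' (S.A i) - S.σ (S.A i) * S.σ' α
      = u * (S.σ (S.A (i - 1)) * S.σ' (S.A i) - S.σ (S.A i) * S.σ' (S.A (i - 1))) := by
    rw [e1, e2]; ring
  have h2 : S.σ (S.A (i - 1)) * S.σ' α - S.σ α * S.σ' (S.A (i - 1))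
      = v * (S.σ (S.A (i - 1)) * S.σ' (S.A i) - S.σ (S.A i) * S.σ' (S.A (i - 1))) := by
    rw [e1, e2]; ring
  rw [← sub_pos, h1, ← sub_nonneg, h2, mul_pos_iff_of_pos_right hd, mul_nonneg_iff_of_pos_right hd]
  norm_cast

lemma cone_pos (i : ℤ) {u v : ℤ} (hu : 0 < u) (hv : 0 ≤ v) :
    0 < S.σ (u * S.A (i - 1) + v * S.A i) ∧ 0 < S.σ' (u * S.A (i - 1) + v * S.A i) := by
  have hu' : (0 : ℝ) < u := by exact_mod_cast hu
  have hv' : (0 : ℝ) ≤ v := by exact_mod_cast hv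
  simp only [map_add, map_mul, map_intCast]
  have h1 := S.σA_pos i
  have h2 := S.σ'A_pos i
  have h3 := S.σA_pos (i - 1)
  have h4 := S.σ'A_pos (i - 1)
  constructor <;> positivity

end ConeData

namespace FormPair

variable (Q : FormPair)

lemma summable_cone {x y : ℝ} (hx : 0 < x) (hy : 0 ≤ y) {s : ℂ} (hs : 1 < s.re) :
    Summable fun p : ℕ × ℕ => Q.D 0 s s (p.1 + x) (p.2 + y) := by
  rcases hy.eq_or_lt with rfl | hy
  · exact (Q.hasSum_zeta_zero hx hs).summable
  · exact Q.summable_zeta hx.le hy hs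

lemma hasCont_cone {x y : ℝ} (hx : 0 < x) (hx1 : x ≤ 1) (hy : 0 ≤ y) (hy1 : y ≤ 1) {N : ℝ}
    (hN : 0 < N) : HasCont N (Q.zeta x y)
      ((B1 x * B1 y + (B2 x * (Q.a / Q.b + Q.a' / Q.b')
        + B2 y * (Q.b / Q.a + Q.b' / Q.a')) / 4 : ℝ) : ℂ) := by
  rcases hy.eq_or_lt with rfl | hy
  · convert Q.hasCont_zeta_zero hx hx1 hN using 1
    simp only [B1, B2]; push_cast; ring
  · convert Q.hasCont_zeta hx hx1 hy hy1 hN using 1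
    simp only [B1, B2]; push_cast; ring

end FormPair

namespace ConeData

variable {K : Type*} [Field K] [NumberField K] (S : ConeData K)

/-- The fractional ideal `α𝔟`. -/
noncomputable def frac (α : K) : FractionalIdeal (𝓞 K)⁰ K := spanSingleton (𝓞 K)⁰ α * S.𝔟

/-- The lattice `𝔟⁻¹`. -/
noncomputable def L : FractionalIdeal (𝓞 K)⁰ K := (S.𝔟 : FractionalIdeal (𝓞 K)⁰ K)⁻¹

lemma coe_𝔟_ne_zero : (S.𝔟 : FractionalIdeal (𝓞 K)⁰ K) ≠ 0 := fun h => by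
  have h1 := (S.hbinv 1).2 ⟨1, 0, by simp⟩
  rw [h, inv_zero', FractionalIdeal.mem_zero_iff] at h1
  exact one_ne_zero h1

lemma mem_L {α : K} : α ∈ S.L ↔ ∀ t ∈ (S.𝔟 : FractionalIdeal (𝓞 K)⁰ K), ∃ r : 𝓞 K, (r : K) = α * t := by
  rw [L, FractionalIdeal.mem_inv_iff S.coe_𝔟_ne_zero]
  refine forall₂_congr fun t _ => ?_
  rw [FractionalIdeal.mem_one_iff]

lemma add_mem {α β : K} (hα : α ∈ S.L) (hβ : β ∈ S.L) : α + β ∈ S.L := Submodule.add_mem _ hα hβ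

lemma neg_mem {α : K} (hα : α ∈ S.L) : -α ∈ S.L := Submodule.neg_mem _ hα

lemma int_mul_mem (n : ℤ) {α : K} (hα : α ∈ S.L) : (n : K) * α ∈ S.L := by
  rw [← zsmul_eq_mul]; exact zsmul_mem (S := Submodule (𝓞 K) K) hα n

lemma comb_mem (i u v : ℤ) : (u : K) * S.A (i - 1) + v * S.A i ∈ S.L :=
  (S.hAbasis i _).2 ⟨u, v, rfl⟩

lemma mem_frac {α x : K} :
    x ∈ S.frac α ↔ ∃ t ∈ (S.𝔟 : FractionalIdeal (𝓞 K)⁰ K), x = α * t :=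
  FractionalIdeal.mem_singleton_mul

lemma exists_ideal {α : K} (hα : α ∈ S.L) :
    ∃ I : Ideal (𝓞 K), (I : FractionalIdeal (𝓞 K)⁰ K) = S.frac α := by
  rw [← FractionalIdeal.le_one_iff_exists_coeIdeal]
  intro x hx
  obtain ⟨t, ht, rfl⟩ := S.mem_frac.1 hx
  exact (FractionalIdeal.mem_one_iff _).2 (S.mem_L.1 hα t ht)

lemma mem_L_of_frac {α : K} {I : Ideal (𝓞 K)} (h : (I : FractionalIdeal (𝓞 K)⁰ K) = S.frac α) :
    α ∈ S.L := by
  rw [S.mem_L]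
  intro t ht
  have h1 : α * t ∈ S.frac α := S.mem_frac.2 ⟨t, ht, rfl⟩
  rw [← h, FractionalIdeal.mem_coeIdeal] at h1
  obtain ⟨r, -, hr⟩ := h1
  exact ⟨r, hr⟩

lemma frac_ne_zero {α : K} (hα : α ≠ 0) : S.frac α ≠ 0 :=
  mul_ne_zero (by rwa [Ne, FractionalIdeal.spanSingleton_eq_zero_iff]) S.coe_𝔟_ne_zero

/-- Coprimality to the modulus. -/
def Cop (I : Ideal (𝓞 K)) : Prop := IsCoprime I (Ideal.span {(S.q : 𝓞 K)})

lemma χ_eq_zero {I : Ideal (𝓞 K)} (h : ¬ S.Cop I) : S.χ I = 0 := by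
  refine S.hχzero _ fun ⟨h0, I₁, I₂, c₁, c₂, h2, e⟩ => h ?_
  have h2' : (I₂ : FractionalIdeal (𝓞 K)⁰ K) ≠ 0 := FractionalIdeal.coeIdeal_ne_zero.2 h2
  rw [eq_div_iff h2', ← FractionalIdeal.coeIdeal_mul, FractionalIdeal.coeIdeal_inj] at e
  rw [← e] at c₁
  exact c₁.of_mul_left_left

lemma χ_mul {I J : Ideal (𝓞 K)} (hI : S.Cop I) (hJ : S.Cop J) (hI0 : I ≠ 0) (hJ0 : J ≠ 0) :
    S.χ (I * J : FractionalIdeal (𝓞 K)⁰ K) = S.χ I * S.χ J := by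
  refine S.hχmul _ _ ⟨I, 1, hI, isCoprime_one_left, one_ne_zero, by simp⟩
    ⟨J, 1, hJ, isCoprime_one_left, one_ne_zero, by simp⟩ ?_ ?_
  · exact FractionalIdeal.coeIdeal_ne_zero.2 hI0
  · exact FractionalIdeal.coeIdeal_ne_zero.2 hJ0

lemma sup_le_of_sub {α β γ : K} (hγ : γ ∈ S.L) (h : α - β = S.q * γ) {I J : Ideal (𝓞 K)}
    (hI : (I : FractionalIdeal (𝓞 K)⁰ K) = S.frac α)
    (hJ : (J : FractionalIdeal (𝓞 K)⁰ K) = S.frac β) :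
    I ⊔ Ideal.span {(S.q : 𝓞 K)} ≤ J ⊔ Ideal.span {(S.q : 𝓞 K)} := by
  refine sup_le (fun x hx => ?_) le_sup_right
  have h1 : (x : K) ∈ S.frac α := by
    rw [← hI]; exact FractionalIdeal.mem_coeIdeal_of_mem _ hx
  obtain ⟨t, ht, hxt⟩ := S.mem_frac.1 h1
  obtain ⟨r, hr⟩ := S.mem_L.1 hγ t ht
  have h2 : β * t ∈ S.frac β := S.mem_frac.2 ⟨t, ht, rfl⟩
  rw [← hJ, FractionalIdeal.mem_coeIdeal] at h2
  obtain ⟨y, hy, hyt⟩ := h2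
  have e : x = y + r * S.q := by
    apply NumberField.RingOfIntegers.coe_injective
    have hyt' : (y : K) = β * t := hyt
    rw [map_add, map_mul, map_natCast]
    change (x : K) = (y : K) + (r : K) * S.q
    rw [hxt, hyt', hr]
    linear_combination t * h
  rw [e]
  exact Submodule.add_mem_sup hy (Ideal.mul_mem_left _ _ (Ideal.mem_span_singleton_self _))

lemma χ_principal {c : 𝓞 K} (h : 0 < S.σ c) (h' : 0 < S.σ' c) (hc : ∃ y : 𝓞 K, c = 1 + S.q * y) :
    S.χ (Ideal.span {c} : Ideal (𝓞 K)) = 1 ∧ S.Cop (Ideal.span {c}) := by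
  obtain ⟨y, hy⟩ := hc
  constructor
  · rw [FractionalIdeal.coeIdeal_span_singleton]
    refine S.hχprin _ h h' ⟨y, ?_⟩
    rw [hy]; push_cast; rfl
  · rw [Cop, Ideal.isCoprime_span_singleton_iff]
    exact ⟨1, -y, by rw [hy]; ring⟩

lemma exists_totally_positive {J : Ideal (𝓞 K)} (hJ : S.Cop J) (hJ0 : J ≠ 0) :
    ∃ c ∈ J, 0 < S.σ c ∧ 0 < S.σ' c ∧ ∃ y : 𝓞 K, c = 1 + S.q * y := by
  have h1 : ∃ c ∈ J, c ≠ 0 ∧ ∃ y : 𝓞 K, c = 1 + S.q * y := by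
    rw [Cop, Ideal.isCoprime_iff_exists] at hJ
    obtain ⟨j, hj, k, hk, e⟩ := hJ
    obtain ⟨y, rfl⟩ := Ideal.mem_span_singleton'.1 hk
    by_cases h0 : j = 0
    · obtain ⟨c, hc, hc0⟩ := Submodule.exists_mem_ne_zero_of_ne_bot hJ0
      refine ⟨c, hc, hc0, -(y * (1 - c)), ?_⟩
      rw [h0, zero_add] at e
      linear_combination (1 - c) * e
    · exact ⟨j, hj, h0, -y, by linear_combination e⟩
  obtain ⟨c, hc, hc0, y, hy⟩ := h1
  have hc0' : (c : K) ≠ 0 := by simpa using hc0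
  refine ⟨c * c, J.mul_mem_left _ hc, ?_, ?_, 2 * y + S.q * y ^ 2, by rw [hy]; ring⟩
  · push_cast; rw [map_mul]; exact mul_self_pos.2 (by simpa using hc0)
  · push_cast; rw [map_mul]; exact mul_self_pos.2 (by simpa using hc0)

/-- `χ(α𝔟)` depends only on the class of `α` modulo `q𝔟⁻¹`. -/
lemma χ_congr {α β γ : K} (hα : α ∈ S.L) (hβ : β ∈ S.L) (hγ : γ ∈ S.L)
    (h : α - β = S.q * γ) (hα1 : 0 < S.σ α) (hα2 : 0 < S.σ' α)
    (hβ1 : 0 < S.σ β) (hβ2 : 0 < S.σ' β) : S.χ (S.frac α) = S.χ (S.frac β) := by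
  obtain ⟨I, hI⟩ := S.exists_ideal hα
  obtain ⟨J, hJ⟩ := S.exists_ideal hβ
  have hα0 : α ≠ 0 := fun h => by simp [h] at hα1
  have hβ0 : β ≠ 0 := fun h => by simp [h] at hβ1
  have hI0 : I ≠ 0 := FractionalIdeal.coeIdeal_ne_zero.1 (hI ▸ S.frac_ne_zero hα0)
  have hJ0 : J ≠ 0 := FractionalIdeal.coeIdeal_ne_zero.1 (hJ ▸ S.frac_ne_zero hβ0)
  have hIJ : S.Cop I ↔ S.Cop J := by
    rw [Cop, Cop, Ideal.isCoprime_iff_sup_eq, Ideal.isCoprime_iff_sup_eq,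
      le_antisymm (S.sup_le_of_sub hγ h hI hJ)
        (S.sup_le_of_sub (S.neg_mem hγ) (by linear_combination -h) hJ hI)]
  rw [← hI, ← hJ]
  by_cases hc : S.Cop J
  swap
  · rw [S.χ_eq_zero hc, S.χ_eq_zero (mt hIJ.1 hc)]
  obtain ⟨c, hcJ, hc1, hc2, y, hy⟩ := S.exists_totally_positive hc hJ0
  have hcJ' : (c : K) ∈ S.frac β := by
    rw [← hJ]; exact FractionalIdeal.mem_coeIdeal_of_mem _ hcJ
  obtain ⟨t, ht, hct⟩ := S.mem_frac.1 hcJ'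
  obtain ⟨d, hd⟩ := S.mem_L.1 hα t ht
  obtain ⟨e, he⟩ := S.mem_L.1 hγ t ht
  have hde : d = 1 + S.q * (y + e) := by
    apply NumberField.RingOfIntegers.coe_injective
    have hy' : (c : K) = 1 + S.q * y := by rw [hy]; push_cast; rfl
    rw [map_add, map_mul, map_add, map_one, map_natCast]
    change (d : K) = 1 + S.q * ((y : K) + (e : K))
    rw [hd, mul_add, ← add_assoc, ← hy', he, hct]
    linear_combination t * h
  have hpos : ∀ τ : K →+* ℝ, 0 < τ α → 0 < τ β → 0 < τ c → 0 < τ d := by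
    intro τ h1 h2 h3
    rw [hct, map_mul] at h3
    rw [hd, map_mul]
    exact mul_pos h1 ((pos_iff_pos_of_mul_pos h3).1 h2)
  obtain ⟨hχc, hcc⟩ := S.χ_principal hc1 hc2 ⟨y, hy⟩
  obtain ⟨hχd, hcd⟩ := S.χ_principal (hpos _ hα1 hβ1 hc1) (hpos _ hα2 hβ2 hc2) ⟨_, hde⟩
  have hne : ∀ (τ : K →+* ℝ) (z : 𝓞 K), 0 < τ z → (Ideal.span {z} : Ideal (𝓞 K)) ≠ 0 := by
    intro τ z hz h0
    have : z = 0 := by simpa using h0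
    simp [this] at hz
  have hcI := S.χ_mul hcc (hIJ.2 hc) (hne _ _ hc1) hI0
  have hdJ := S.χ_mul hcd hc (hne _ _ (hpos _ hα1 hβ1 hc1)) hJ0
  rw [hχc, one_mul] at hcI
  rw [hχd, one_mul] at hdJ
  rw [← hcI, ← hdJ, hI, hJ, frac, frac, FractionalIdeal.coeIdeal_span_singleton,
    FractionalIdeal.coeIdeal_span_singleton, ← mul_assoc, ← mul_assoc,
    FractionalIdeal.spanSingleton_mul_spanSingleton, FractionalIdeal.spanSingleton_mul_spanSingleton]
  congr 3
  change (c : K) * α = (d : K) * β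
  rw [hct, hd]; ring

end ConeData

lemma hasSum_fintype_prod {ι κ : Type*} [Fintype ι] {f : ι × κ → ℂ}
    (hf : ∀ i, Summable fun k => f (i, k)) : HasSum f (∑ i, ∑' k, f (i, k)) := by
  have h1 : Summable f := by
    rw [← summable_norm_iff, summable_prod_of_nonneg fun _ => norm_nonneg _]
    exact ⟨fun i => (hf i).norm, (hasSum_fintype _).summable⟩
  have h2 := h1.tsum_prod
  rw [tsum_fintype (L := .unconditional ι)] at h2
  rw [← h2]
  exact h1.hasSum

namespace ConeData

variable {K : Type*} [Field K] [NumberField K] (S : ConeData K)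

lemma norm_eq (α : K) : ((Algebra.norm ℚ α : ℚ) : ℝ) = S.σ α * S.σ' α := by
  classical
  let f : (K →+* ℝ) → (K →ₐ[ℚ] ℂ) := fun τ => (Complex.ofRealHom.comp τ).toRatAlgHom
  have hne : f S.σ ≠ f S.σ' := fun h => S.hσσ' <| RingHom.ext fun x => by
    simpa [f] using DFunLike.congr_fun h x
  have huniv : ({f S.σ, f S.σ'} : Finset (K →ₐ[ℚ] ℂ)) = Finset.univ := by
    refine Finset.eq_of_subset_of_card_le (Finset.subset_univ _) ?_
    rw [Finset.card_univ, AlgHom.card, S.hdeg, Finset.card_pair hne]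
  have h := Algebra.norm_eq_prod_embeddings ℚ ℂ α
  rw [← huniv, Finset.prod_pair hne] at h
  have h' : (((Algebra.norm ℚ α : ℚ) : ℝ) : ℂ) = ((S.σ α * S.σ' α : ℝ) : ℂ) := by
    push_cast
    simpa [f] using h
  exact_mod_cast h'

lemma absNorm_eq {α : K} (h : 0 < S.σ α) (h' : 0 < S.σ' α) {I : Ideal (𝓞 K)}
    (hI : (I : FractionalIdeal (𝓞 K)⁰ K) = S.frac α) :
    (Ideal.absNorm I : ℝ) = S.σ α * S.σ' α * Ideal.absNorm S.𝔟 := by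
  have h1 := congrArg FractionalIdeal.absNorm hI
  rw [frac, map_mul, coeIdeal_absNorm, coeIdeal_absNorm, absNorm_span_singleton] at h1
  have h2 := congrArg (fun r : ℚ => (r : ℝ)) h1
  simp only [Rat.cast_mul, Rat.cast_natCast, Rat.cast_abs, S.norm_eq] at h2
  rwa [abs_of_pos (mul_pos h h')] at h2

lemma frac_unit_mul (j : ℤ) (α : K) : S.frac (((S.ε : 𝓞 K) : K) ^ j * α) = S.frac α := by
  have h : spanSingleton (𝓞 K)⁰ (((S.ε : 𝓞 K) : K) ^ j * α) = spanSingleton (𝓞 K)⁰ α := by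
    rw [eq_comm, FractionalIdeal.spanSingleton_eq_spanSingleton]
    refine ⟨S.ε ^ j, ?_⟩
    rw [Units.smul_def, Algebra.smul_def]
    congr 1
    simpa using NumberField.Units.coe_zpow S.ε j
  rw [frac, h, frac]

lemma exists_zpow_of_frac_eq {α β : K} (hα : 0 < S.σ α) (hα' : 0 < S.σ' α) (hβ : 0 < S.σ β)
    (hβ' : 0 < S.σ' β) (h : S.frac α = S.frac β) :
    ∃ j : ℤ, β = ((S.ε : 𝓞 K) : K) ^ j * α := by
  have h1 := mul_right_cancel₀ S.coe_𝔟_ne_zero h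
  rw [FractionalIdeal.spanSingleton_eq_spanSingleton] at h1
  obtain ⟨u, hu⟩ := h1
  rw [Units.smul_def, Algebra.smul_def] at hu
  change ((u : 𝓞 K) : K) * α = β at hu
  have hpos : ∀ τ : K →+* ℝ, 0 < τ α → 0 < τ β → 0 < τ ((u : 𝓞 K) : K) := by
    intro τ h1 h2
    rw [← hu, map_mul] at h2
    exact (pos_iff_pos_of_mul_pos h2).2 h1
  obtain ⟨j, hj⟩ := S.hεfund u (hpos _ hα hβ) (hpos _ hα' hβ')
  exact ⟨j, by rw [← hj, hu]⟩

/-- The point with coordinates `u`, `v` in the cone spanned by `A (i - 1)` and `A i`. -/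
noncomputable def pt (i u v : ℤ) : K := (u : K) * S.A (i - 1) + (v : K) * S.A i

lemma pt_mem (i u v : ℤ) : S.pt i u v ∈ S.L := S.comb_mem i u v

lemma ε_zpow_mul_pt (j i u v : ℤ) :
    ((S.ε : 𝓞 K) : K) ^ j * S.pt i u v = S.pt (i - j * S.m) u v := by
  rw [pt, mul_add, mul_left_comm, mul_left_comm _ (v : K), ε_zpow_mul_A, ε_zpow_mul_A, pt,
    sub_right_comm]

lemma frac_pt_injective {i u v i' u' v' : ℤ} (hi : i ∈ Icc (1 : ℤ) S.m)
    (hi' : i' ∈ Icc (1 : ℤ) S.m) (hu : 0 < u) (hv : 0 ≤ v) (hu' : 0 < u') (hv' : 0 ≤ v')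
    (h : S.frac (S.pt i u v) = S.frac (S.pt i' u' v')) : i = i' ∧ u = u' ∧ v = v' := by
  obtain ⟨p1, p2⟩ := S.cone_pos i hu hv
  obtain ⟨p1', p2'⟩ := S.cone_pos i' hu' hv'
  obtain ⟨j, hj⟩ := S.exists_zpow_of_frac_eq p1 p2 p1' p2' h
  change S.pt i' u' v' = _ * S.pt i u v at hj
  rw [ε_zpow_mul_pt] at hj
  have s1 := (S.slope_mem_iff i' p2' rfl).2 ⟨hu', hv'⟩
  have s2 := (S.slope_mem_iff (i - j * S.m) (S.cone_pos (i - j * S.m) hu hv).2 rfl).2 ⟨hu, hv⟩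
  change _ < S.slope (S.pt i' u' v') ∧ S.slope (S.pt i' u' v') ≤ _ at s1
  rw [hj] at s1
  have e : i' = i - j * S.m := S.slope_unique s1 s2
  rw [Finset.mem_Icc] at hi hi'
  have hj0 : j = 0 := by
    have h1 : j < 1 := by
      by_contra! hc
      nlinarith [S.hm]
    have h2 : -1 < j := by
      by_contra! hc
      nlinarith [S.hm]
    omega
  rw [hj0, zero_mul, sub_zero] at e hj
  subst e
  obtain ⟨h1, h2⟩ := S.int_coord_unique _ hj
  exact ⟨rfl, h1.symm, h2.symm⟩

lemma exists_frac_pt {I : Ideal (𝓞 K)} {a : K} (ha : 0 < S.σ a) (ha' : 0 < S.σ' a)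
    (h : (I : FractionalIdeal (𝓞 K)⁰ K) = S.frac a) :
    ∃ i u v : ℤ, i ∈ Icc (1 : ℤ) S.m ∧ 0 < u ∧ 0 ≤ v ∧
      (I : FractionalIdeal (𝓞 K)⁰ K) = S.frac (S.pt i u v) := by
  obtain ⟨i, hi⟩ := S.exists_slope_between (div_pos ha ha')
  obtain ⟨u, v, huv⟩ := (S.hAbasis i a).1 (S.mem_L_of_frac h)
  obtain ⟨hu, hv⟩ := (S.slope_mem_iff i ha' huv).1 hi
  have hm : (0 : ℤ) < S.m := by exact_mod_cast S.hm
  refine ⟨i - (i - 1) / S.m * S.m, u, v, ?_, hu, hv, ?_⟩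
  · rw [Finset.mem_Icc]
    have h1 := Int.emod_nonneg (i - 1) hm.ne'
    have h2 := Int.emod_lt_of_pos (i - 1) hm
    have h3 := Int.ediv_mul_add_emod (i - 1) S.m
    constructor <;> linarith
  · rw [← ε_zpow_mul_pt, frac_unit_mul, h, huv, pt]

/-- The finite index set of Shintani cone classes. -/
abbrev Idx : Type := Icc (1 : ℤ) S.m × Fin S.q × Fin S.q

/-- Enumeration of the points of the fundamental cones by class and lattice translation. -/
noncomputable def enum (p : S.Idx × (ℕ × ℕ)) : K :=
  S.pt p.1.1 (p.1.2.1 + 1 + S.q * p.2.1) (p.1.2.2 + S.q * p.2.2)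

/-- The integral ideal attached to an enumerated point. -/
noncomputable def enumIdeal (p : S.Idx × (ℕ × ℕ)) : Ideal (𝓞 K) :=
  (S.exists_ideal (S.pt_mem p.1.1 (p.1.2.1 + 1 + S.q * p.2.1) (p.1.2.2 + S.q * p.2.2))).choose

lemma coe_enumIdeal (p : S.Idx × (ℕ × ℕ)) :
    (S.enumIdeal p : FractionalIdeal (𝓞 K)⁰ K) = S.frac (S.enum p) :=
  (S.exists_ideal (S.pt_mem p.1.1 (p.1.2.1 + 1 + S.q * p.2.1) (p.1.2.2 + S.q * p.2.2))).choose_spec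

lemma enum_pos (p : S.Idx × (ℕ × ℕ)) : 0 < S.σ (S.enum p) ∧ 0 < S.σ' (S.enum p) :=
  S.cone_pos _ (by positivity) (by positivity)

lemma fin_add_mul_injective {q : ℕ} {a a' : Fin q} {k k' : ℕ}
    (h : (a : ℤ) + q * k = a' + q * k') : a = a' ∧ k = k' := by
  have h' : (a : ℕ) + q * k = a' + q * k' := by exact_mod_cast h
  have hq : 0 < q := a.pos
  have h1 := congrArg (· % q) h'
  simp only [Nat.add_mul_mod_self_left, Nat.mod_eq_of_lt a.2, Nat.mod_eq_of_lt a'.2] at h1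
  rw [h1] at h'
  exact ⟨Fin.ext h1, Nat.eq_of_mul_eq_mul_left hq (by omega)⟩

lemma enumIdeal_injective : Function.Injective S.enumIdeal := by
  rintro ⟨⟨⟨i, hi⟩, a, c⟩, k, l⟩ ⟨⟨⟨i', hi'⟩, a', c'⟩, k', l'⟩ h
  have h1 := (S.coe_enumIdeal _).symm.trans ((congrArg _ h).trans (S.coe_enumIdeal _))
  obtain ⟨e1, e2, e3⟩ := S.frac_pt_injective hi hi' (by positivity) (by positivity)
    (by positivity) (by positivity) h1
  obtain ⟨rfl, rfl⟩ := fin_add_mul_injective (show (a : ℤ) + S.q * k = a' + S.q * k' by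
    simp only at e2; linarith)
  obtain ⟨rfl, rfl⟩ := fin_add_mul_injective (show (c : ℤ) + S.q * l = c' + S.q * l' from e3)
  subst e1
  rfl

lemma exists_fin_add_mul {q : ℕ} (hq : 0 < q) {z : ℤ} (hz : 0 ≤ z) :
    ∃ (a : Fin q) (k : ℕ), z = a + q * k := by
  lift z to ℕ using hz
  refine ⟨⟨z % q, Nat.mod_lt _ hq⟩, z / q, ?_⟩
  exact_mod_cast (Nat.mod_add_div z q).symm

lemma mem_range_enumIdeal {I : Ideal (𝓞 K)} {a : K} (ha : 0 < S.σ a) (ha' : 0 < S.σ' a)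
    (h : (I : FractionalIdeal (𝓞 K)⁰ K) = S.frac a) : I ∈ Set.range S.enumIdeal := by
  obtain ⟨i, u, v, hi, hu, hv, e⟩ := S.exists_frac_pt ha ha' h
  obtain ⟨c, k, hk⟩ := exists_fin_add_mul S.hq (show 0 ≤ u - 1 by omega)
  obtain ⟨d, l, hl⟩ := exists_fin_add_mul S.hq hv
  refine ⟨⟨⟨⟨i, hi⟩, c, d⟩, k, l⟩, ?_⟩
  have h1 : (S.enumIdeal ⟨⟨⟨i, hi⟩, c, d⟩, k, l⟩ : FractionalIdeal (𝓞 K)⁰ K) = I := by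
    rw [S.coe_enumIdeal, e, enum]
    simp only
    rw [hl, show (c : ℤ) + 1 + S.q * k = u by linarith]
  exact FractionalIdeal.coeIdeal_injective h1

/-- A sum over the ideals `α𝔟` coprime to the modulus is a sum over the fundamental cones. -/
lemma hasSum_ideal {h : Ideal (𝓞 K) → ℂ} (h0 : ∀ I, ¬ S.Cop I → h I = 0) {a : ℂ}
    (hs : HasSum (fun p => h (S.enumIdeal p)) a) :
    HasSum (fun 𝔞 : {𝔞 : Ideal (𝓞 K) //
          (∃ a : K, (0 < S.σ a ∧ 0 < S.σ' a) ∧ (𝔞 : FractionalIdeal (𝓞 K)⁰ K)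
            = spanSingleton (𝓞 K)⁰ a * (S.𝔟 : FractionalIdeal (𝓞 K)⁰ K))
          ∧ IsCoprime 𝔞 (Ideal.span {(S.q : 𝓞 K)})} => h 𝔞.1) a := by
  let T : Set (Ideal (𝓞 K)) := {𝔞 |
          (∃ a : K, (0 < S.σ a ∧ 0 < S.σ' a) ∧ (𝔞 : FractionalIdeal (𝓞 K)⁰ K)
            = spanSingleton (𝓞 K)⁰ a * (S.𝔟 : FractionalIdeal (𝓞 K)⁰ K))
          ∧ IsCoprime 𝔞 (Ideal.span {(S.q : 𝓞 K)})}
  have h1 : HasSum (T.indicator h) a := by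
    rw [← S.enumIdeal_injective.hasSum_iff]
    · refine hs.congr_fun fun p => ?_
      by_cases hc : S.Cop (S.enumIdeal p)
      · rw [Function.comp_apply, Set.indicator_of_mem]
        exact ⟨⟨_, S.enum_pos p, S.coe_enumIdeal p⟩, hc⟩
      · rw [Function.comp_apply, h0 _ hc, Set.indicator_apply_eq_zero]
        exact fun _ => h0 _ hc
    · intro I hI
      refine Set.indicator_of_notMem (fun hT => hI ?_) _
      obtain ⟨⟨a, ⟨ha, ha'⟩, e⟩, -⟩ := hT
      exact S.mem_range_enumIdeal ha ha' e
  exact hasSum_subtype_iff_indicator.2 h1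

end ConeData

lemma sum_Icc_one_eq_range {M : Type*} [AddCommMonoid M] (n : ℕ) (f : ℤ → M) :
    ∑ i ∈ Icc (1 : ℤ) n, f i = ∑ k ∈ range n, f (k + 1) := by
  refine (Finset.sum_bij (s := range n) (f := fun k : ℕ => f (k + 1)) (g := f)
    (fun k _ => (k : ℤ) + 1) ?_ ?_ ?_ fun _ _ => rfl).symm
  · intro k hk
    simp only [Finset.mem_range, Finset.mem_Icc] at hk ⊢
    omega
  · intro k _ l _ h
    omega
  · intro i hi
    rw [Finset.mem_Icc] at hi
    exact ⟨(i - 1).toNat, by rw [Finset.mem_range]; omega, by omega⟩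

lemma sum_Icc_one_eq_fin {M : Type*} [AddCommMonoid M] (n : ℕ) (f : ℤ → M) :
    ∑ i ∈ Icc (1 : ℤ) n, f i = ∑ k : Fin n, f (k + 1) := by
  rw [sum_Icc_one_eq_range, Finset.sum_range]

lemma sum_Icc_one_pred {M : Type*} [AddCommGroup M] (n : ℕ) {f : ℤ → M}
    (hf : ∀ i, f (i + n) = f i) : ∑ i ∈ Icc (1 : ℤ) n, f (i - 1) = ∑ i ∈ Icc (1 : ℤ) n, f i := by
  rw [sum_Icc_one_eq_range, sum_Icc_one_eq_range]
  have h1 := Finset.sum_range_succ (fun k : ℕ => f k) n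
  rw [Finset.sum_range_succ'] at h1
  have h2 : f (n : ℤ) = f 0 := by simpa using hf 0
  push_cast at h1
  rw [h2] at h1
  simpa using (add_right_cancel h1).symm

lemma B2_one_sub (x : ℝ) : B2 (1 - x) = B2 x := by simp only [B2]; ring

namespace ConeData

variable {K : Type*} [Field K] [NumberField K] (S : ConeData K)

/-- The two linear forms attached to the cone spanned by `A (i - 1)` and `A i`. -/
noncomputable def form (i : ℤ) : FormPair where
  a := S.σ (S.A (i - 1))
  b := S.σ (S.A i)
  a' := S.σ' (S.A (i - 1))
  b' := S.σ' (S.A i)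
  ha := S.σA_pos _
  hb := S.σA_pos _
  ha' := S.σ'A_pos _
  hb' := S.σ'A_pos _

/-- The character value on a cone class. -/
noncomputable def coef (i : ℤ) (w : Fin S.q × Fin S.q) : ℂ := S.χ (S.frac (S.pt i (w.1 + 1) w.2))

lemma χ_enumIdeal (j : S.Idx) (k : ℕ × ℕ) : S.χ (S.enumIdeal (j, k)) = S.coef j.1 j.2 := by
  rw [coe_enumIdeal, coef]
  obtain ⟨p1, p2⟩ := S.enum_pos (j, k)
  obtain ⟨r1, r2⟩ := S.cone_pos j.1 (u := j.2.1 + 1) (v := j.2.2) (by positivity) (by positivity)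
  refine S.χ_congr (S.pt_mem _ _ _) (S.pt_mem _ _ _) (S.pt_mem j.1 k.1 k.2) ?_ p1 p2 r1 r2
  simp only [enum, pt]
  push_cast
  ring

lemma absNorm_enumIdeal (j : S.Idx) (k : ℕ × ℕ) (s : ℂ) :
    (Ideal.absNorm (S.enumIdeal (j, k)) : ℂ) ^ (-s)
      = ((Ideal.absNorm S.𝔟 * S.q ^ 2 : ℝ) : ℂ) ^ (-s) * (S.form j.1).D 0 s s
        (k.1 + ((j.2.1 : ℕ) + 1 : ℝ) / S.q) (k.2 + ((j.2.2 : ℕ) : ℝ) / S.q) := by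
  have hq : (0 : ℝ) < S.q := by exact_mod_cast S.hq
  obtain ⟨p1, p2⟩ := S.enum_pos (j, k)
  have h := S.absNorm_eq p1 p2 (S.coe_enumIdeal (j, k))
  have e : ∀ τ : K →+* ℝ, τ (S.enum (j, k)) = S.q *
      (τ (S.A (j.1 - 1)) * (k.1 + ((j.2.1 : ℕ) + 1 : ℝ) / S.q)
        + τ (S.A j.1) * (k.2 + ((j.2.2 : ℕ) : ℝ) / S.q)) := by
    intro τ
    simp only [enum, pt, map_add, map_mul, map_intCast]
    push_cast
    field_simp
    ring
  rw [e] at p1 p2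
  have p1' := (pos_iff_pos_of_mul_pos p1).1 hq
  have p2' := (pos_iff_pos_of_mul_pos p2).1 hq
  have h2 : (Ideal.absNorm (S.enumIdeal (j, k)) : ℂ) =
      ((Ideal.absNorm (S.enumIdeal (j, k)) : ℝ) : ℂ) := by push_cast; rfl
  rw [h2, h, e, e]
  simp only [FormPair.D, form]
  rw [← Complex.mul_cpow_ofReal_nonneg p1'.le p2'.le, ← Complex.ofReal_mul,
    ← Complex.mul_cpow_ofReal_nonneg (by positivity) (mul_pos p1' p2').le, ← Complex.ofReal_mul]
  congr 2
  ring

/-- The zeta function of the cone sum. -/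
noncomputable def coneZeta (s : ℂ) : ℂ :=
  ((Ideal.absNorm S.𝔟 * S.q ^ 2 : ℝ) : ℂ) ^ (-s) * ∑ j : S.Idx, S.coef j.1 j.2 *
    (S.form j.1).zeta (((j.2.1 : ℕ) + 1 : ℝ) / S.q) (((j.2.2 : ℕ) : ℝ) / S.q) s

lemma fin_mem (a : Fin S.q) : 0 < ((a : ℕ) + 1 : ℝ) / S.q ∧ ((a : ℕ) + 1 : ℝ) / S.q ≤ 1 ∧
    0 ≤ ((a : ℕ) : ℝ) / S.q ∧ ((a : ℕ) : ℝ) / S.q ≤ 1 := by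
  have hq : (0 : ℝ) < S.q := by exact_mod_cast S.hq
  have h : ((a : ℕ) : ℝ) + 1 ≤ S.q := by exact_mod_cast a.2
  refine ⟨by positivity, (div_le_one hq).2 h, by positivity, (div_le_one hq).2 (by linarith)⟩

lemma hasSum_enum {s : ℂ} (hs : 1 < s.re) :
    HasSum (fun p => S.χ (S.enumIdeal p) * (Ideal.absNorm (S.enumIdeal p) : ℂ) ^ (-s))
      (S.coneZeta s) := by
  have h1 : ∀ j : S.Idx, HasSum (fun k => S.χ (S.enumIdeal (j, k)) *
      (Ideal.absNorm (S.enumIdeal (j, k)) : ℂ) ^ (-s))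
      (((Ideal.absNorm S.𝔟 * S.q ^ 2 : ℝ) : ℂ) ^ (-s) * (S.coef j.1 j.2 *
        (S.form j.1).zeta (((j.2.1 : ℕ) + 1 : ℝ) / S.q) (((j.2.2 : ℕ) : ℝ) / S.q) s)) := by
    intro j
    have := ((S.form j.1).summable_cone (S.fin_mem j.2.1).1 (S.fin_mem j.2.2).2.2.1 hs).hasSum
    refine ((this.mul_left (S.coef j.1 j.2)).mul_left
      (((Ideal.absNorm S.𝔟 * S.q ^ 2 : ℝ) : ℂ) ^ (-s))).congr_fun fun k => ?_
    rw [χ_enumIdeal, absNorm_enumIdeal]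
    ring
  have h2 := hasSum_fintype_prod (f := fun p : S.Idx × (ℕ × ℕ) => S.χ (S.enumIdeal p) *
    (Ideal.absNorm (S.enumIdeal p) : ℂ) ^ (-s)) fun j => (h1 j).summable
  rw [coneZeta, Finset.mul_sum]
  simpa only [(h1 _).tsum_eq] using h2

/-- The value at `0` of the contribution of the cone `i`. -/
noncomputable def coneValue (i : ℤ) (x y : ℝ) : ℝ :=
  B1 x * B1 y + (B2 x * ((S.form i).a / (S.form i).b + (S.form i).a' / (S.form i).b')
    + B2 y * ((S.form i).b / (S.form i).a + (S.form i).b' / (S.form i).a')) / 4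

lemma hasCont_coneZeta {N : ℝ} (hN : 0 < N) :
    HasCont N S.coneZeta (∑ j : S.Idx, S.coef j.1 j.2 *
      S.coneValue j.1 (((j.2.1 : ℕ) + 1 : ℝ) / S.q) (((j.2.2 : ℕ) : ℝ) / S.q)) := by
  have hq : (0 : ℝ) < S.q := by exact_mod_cast S.hq
  have hb : 0 < Ideal.absNorm S.𝔟 := by
    refine Nat.pos_of_ne_zero fun h => S.coe_𝔟_ne_zero ?_
    rw [Ideal.absNorm_eq_zero_iff] at h
    simp [h]
  have hc : ((Ideal.absNorm S.𝔟 * S.q ^ 2 : ℝ) : ℂ) ≠ 0 := by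
    have : (0 : ℝ) < Ideal.absNorm S.𝔟 := by exact_mod_cast hb
    exact_mod_cast (by positivity : (Ideal.absNorm S.𝔟 * S.q ^ 2 : ℝ) ≠ 0)
  have h1 := HasCont.sum (N := N) (t := (Finset.univ : Finset S.Idx)) (Z := fun j s =>
    S.coef j.1 j.2 *
      (S.form j.1).zeta (((j.2.1 : ℕ) + 1 : ℝ) / S.q) (((j.2.2 : ℕ) : ℝ) / S.q) s)
    (v := fun j => S.coef j.1 j.2 *
      S.coneValue j.1 (((j.2.1 : ℕ) + 1 : ℝ) / S.q) (((j.2.2 : ℕ) : ℝ) / S.q)) fun j _ =>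
    ((S.form j.1).hasCont_cone (S.fin_mem j.2.1).1 (S.fin_mem j.2.1).2.1 (S.fin_mem j.2.2).2.2.1
      (S.fin_mem j.2.2).2.2.2 hN).mul_entire (differentiable_const _)
  have h2 := h1.mul_entire (g := fun s => ((Ideal.absNorm S.𝔟 * S.q ^ 2 : ℝ) : ℂ) ^ (-s))
    (fun s => (differentiableAt_id.neg).const_cpow (Or.inl hc))
  rw [neg_zero, Complex.cpow_zero, one_mul] at h2
  exact h2

/-- The defining property of the coordinates `X`, `Y`. -/
def IsCoord (X Y : ℤ → ℤ → ℤ → ℝ) : Prop :=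
  ∀ C D i : ℤ, X C D i ∈ Set.Ioc (0 : ℝ) 1 ∧ Y C D i ∈ Set.Ico (0 : ℝ) 1 ∧
    ∃ z : K, (z - ((C : K) + (D : K) * S.δ) / (S.q : K)) ∈
        ((S.𝔟 : FractionalIdeal (𝓞 K)⁰ K))⁻¹ ∧
      X C D i * S.σ (S.A (i - 1)) + Y C D i * S.σ (S.A i) = S.σ z ∧
      X C D i * S.σ' (S.A (i - 1)) + Y C D i * S.σ' (S.A i) = S.σ' z

variable {S} {X Y : ℤ → ℤ → ℤ → ℝ}

lemma IsCoord.exists_fin (h : S.IsCoord X Y) (C D i : ℤ) :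
    ∃ w : Fin S.q × Fin S.q, X C D i = ((w.1 : ℕ) + 1 : ℝ) / S.q ∧ Y C D i = ((w.2 : ℕ) : ℝ) / S.q ∧
      ∃ γ ∈ S.L, S.pt i (w.1 + 1) w.2 - ((C : K) + D * S.δ) = S.q * γ := by
  have hq : (0 : ℝ) < S.q := by exact_mod_cast S.hq
  have hqK : (S.q : K) ≠ 0 := by exact_mod_cast S.hq.ne'
  obtain ⟨⟨x0, x1⟩, ⟨y0, y1⟩, z, hz, e1, e2⟩ := h C D i
  have hCD : (C : K) + D * S.δ ∈ S.L := (S.hbinv _).2 ⟨C, D, rfl⟩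
  have hqz : (S.q : K) * z ∈ S.L := by
    have := S.add_mem hCD (S.int_mul_mem S.q hz)
    convert this using 1
    push_cast
    field_simp
    ring
  obtain ⟨u, v, huv⟩ := (S.hAbasis i _).1 hqz
  have f1 := congrArg S.σ huv
  have f2 := congrArg S.σ' huv
  simp only [map_add, map_mul, map_intCast, map_natCast] at f1 f2
  obtain ⟨hu, hv⟩ := S.coord_unique i (u := S.q * X C D i) (v := S.q * Y C D i) (u' := u) (v' := v)
    (by rw [← f1, ← e1]; ring) (by rw [← f2, ← e2]; ring)
  have u0 : 0 < u := by
    have : (0 : ℝ) < u := by rw [← hu]; positivity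
    exact_mod_cast this
  have u1 : u ≤ S.q := by
    have : (u : ℝ) ≤ S.q := by rw [← hu]; nlinarith
    exact_mod_cast this
  have v0 : 0 ≤ v := by
    have : (0 : ℝ) ≤ v := by rw [← hv]; positivity
    exact_mod_cast this
  have v1 : v < S.q := by
    have : (v : ℝ) < S.q := by rw [← hv]; nlinarith
    exact_mod_cast this
  lift v to ℕ using v0
  obtain ⟨w, rfl⟩ : ∃ w : ℕ, u = w + 1 := ⟨(u - 1).toNat, by omega⟩
  refine ⟨(⟨w, by omega⟩, ⟨v, by omega⟩), ?_, ?_, _, hz, ?_⟩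
  · rw [eq_div_iff hq.ne', mul_comm, hu]; push_cast; rfl
  · rw [eq_div_iff hq.ne', mul_comm, hv]; push_cast; rfl
  · rw [pt, ← huv]
    field_simp

lemma IsCoord.sum_eq (h : S.IsCoord X Y) (i : ℤ) (Φ : ℝ → ℝ → ℂ) :
    ∑ C ∈ Icc (1 : ℤ) S.q, ∑ D ∈ Icc (1 : ℤ) S.q,
      S.χ (S.frac ((C : K) + D * S.δ)) * Φ (X C D i) (Y C D i) =
    ∑ w : Fin S.q × Fin S.q, S.coef i w * Φ (((w.1 : ℕ) + 1 : ℝ) / S.q) (((w.2 : ℕ) : ℝ) / S.q) := by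
  simp only [sum_Icc_one_eq_fin]
  rw [← Fintype.sum_prod_type' (f := fun k l : Fin S.q =>
    S.χ (S.frac (((k + 1 : ℤ) : K) + (l + 1 : ℤ) * S.δ)) * Φ (X (k + 1) (l + 1) i) (Y (k + 1) (l + 1) i))]
  choose g hgX hgY γ hγ hg using fun p : Fin S.q × Fin S.q => h.exists_fin (p.1 + 1) (p.2 + 1) i
  have hinj : Function.Injective g := by
    intro p p' e
    have h1 := hg p
    rw [e] at h1
    have h2 : S.q * (γ p' - γ p) = (((p.1 : ℤ) - p'.1 : ℤ) : K) + ((p.2 : ℤ) - p'.2 : ℤ) * S.δ := by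
      have h3 := hg p'
      push_cast at h1 h3 ⊢
      linear_combination h1 - h3
    have h4 : γ p' - γ p ∈ S.L := by
      rw [sub_eq_add_neg]; exact S.add_mem (hγ _) (S.neg_mem (hγ _))
    obtain ⟨c, d, hcd⟩ := (S.hbinv _).1 h4
    have h5 := S.int_coord_unique 0 (u := S.q * d) (v := S.q * c) (u' := (p.2 : ℤ) - p'.2)
      (v' := (p.1 : ℤ) - p'.1) (by
        rw [hcd] at h2
        simp only [zero_sub, S.hAm1, S.hA0]
        push_cast at h2 ⊢
        linear_combination h2)
    have key : ∀ (a a' : Fin S.q) (e : ℤ), S.q * e = (a : ℤ) - a' → a = a' := by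
      intro a a' e he
      have ha := a.2
      have ha' := a'.2
      have e1 : e < 1 := by
        by_contra! hc
        nlinarith
      have e2 : -1 < e := by
        by_contra! hc
        nlinarith
      obtain rfl : e = 0 := by omega
      ext
      omega
    exact Prod.ext (key _ _ _ h5.2) (key _ _ _ h5.1)
  have hbij : Function.Bijective g := Finite.injective_iff_bijective.1 hinj
  refine Fintype.sum_bijective g hbij _ _ fun p => ?_
  rw [hgX, hgY]
  congr 1
  have hCD : (((p.1 + 1 : ℤ) : K) + (p.2 + 1 : ℤ) * S.δ) ∈ S.L := (S.hbinv _).2 ⟨_, _, rfl⟩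
  obtain ⟨r1, r2⟩ := S.cone_pos i (u := (g p).1 + 1) (v := (g p).2) (by positivity) (by positivity)
  have hδ : 0 < S.σ S.δ := by linarith [S.hδ2]
  have hδ' := S.hδ'0
  refine (S.χ_congr (S.pt_mem _ _ _) hCD (hγ p) (hg p) r1 r2 ?_ ?_).symm
  · simp only [map_add, map_mul, map_intCast]; push_cast; positivity
  · simp only [map_add, map_mul, map_intCast]; push_cast; positivity

lemma IsCoord.Y_eq (h : S.IsCoord X Y) (C D i : ℤ) : Y C D i = 1 - X C D (i - 1) := by
  obtain ⟨-, ⟨y0, y1⟩, z, hz, e1, e2⟩ := h C D i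
  obtain ⟨⟨x0, x1⟩, -, w, hw, f1, f2⟩ := h C D (i - 1)
  have hzw : z - w ∈ S.L := by
    have := S.add_mem hz (S.neg_mem hw)
    convert this using 1
    ring
  obtain ⟨u, v, huv⟩ := (S.hAbasis i _).1 hzw
  have hr := S.hArec (i - 1)
  rw [sub_add_cancel] at hr
  have g1 := congrArg S.σ huv
  have g2 := congrArg S.σ' huv
  have r1 := congrArg S.σ hr
  have r2 := congrArg S.σ' hr
  simp only [map_add, map_sub, map_mul, map_intCast] at g1 g2 r1 r2
  obtain ⟨-, hv⟩ := S.coord_unique i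
    (u := X C D i - X C D (i - 1) * S.b (i - 1) - Y C D (i - 1))
    (v := Y C D i + X C D (i - 1)) (u' := u) (v' := v)
    (by linear_combination g1 + e1 - f1 + X C D (i - 1) * r1)
    (by linear_combination g2 + e2 - f2 + X C D (i - 1) * r2)
  have v0 : 0 < v := by
    have : (0 : ℝ) < v := by linarith
    exact_mod_cast this
  have v1 : v < 2 := by
    have : (v : ℝ) < 2 := by linarith
    exact_mod_cast this
  obtain rfl : v = 1 := by omega
  push_cast at hv
  linarith

lemma coef_add_m (i : ℤ) (w : Fin S.q × Fin S.q) : S.coef (i + S.m) w = S.coef i w := by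
  rw [coef, coef]
  have := S.ε_zpow_mul_pt 1 (i + S.m) (w.1 + 1) w.2
  rw [one_mul, add_sub_cancel_right] at this
  rw [← this, frac_unit_mul]

lemma coneValue_eq (i : ℤ) (x y : ℝ) : S.coneValue i x y =
    B1 x * B1 y + (B2 x * (S.σ (S.δseq i) + S.σ' (S.δseq i))
      + B2 y * (2 * S.b (i - 1) - (S.σ (S.δseq (i - 1)) + S.σ' (S.δseq (i - 1))))) / 4 := by
  have key : ∀ τ : K →+* ℝ, 0 < τ (S.A i) → 0 < τ (S.A (i - 1)) →
      τ (S.A (i - 1)) / τ (S.A i) = τ (S.δseq i) ∧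
      τ (S.A i) / τ (S.A (i - 1)) = S.b (i - 1) - τ (S.δseq (i - 1)) := by
    intro τ h1 h2
    have e := congrArg τ (S.A_sub_one i)
    have e' := congrArg τ (S.A_sub_one (i - 1))
    have r := congrArg τ (S.hArec (i - 1))
    rw [sub_add_cancel] at r
    simp only [map_mul, map_sub, map_intCast] at e e' r
    rw [div_eq_iff h1.ne', div_eq_iff h2.ne', e]
    refine ⟨rfl, ?_⟩
    rw [← e, r, e']
    ring
  obtain ⟨k1, k2⟩ := key S.σ (S.σA_pos _) (S.σA_pos _)
  obtain ⟨k3, k4⟩ := key S.σ' (S.σ'A_pos _) (S.σ'A_pos _)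
  simp only [coneValue, form, k1, k2, k3, k4]
  ring

lemma IsCoord.value_eq (h : S.IsCoord X Y) :
    ∑ j : S.Idx, S.coef j.1 j.2 *
      S.coneValue j.1 (((j.2.1 : ℕ) + 1 : ℝ) / S.q) (((j.2.2 : ℕ) : ℝ) / S.q) =
    ∑ C ∈ Icc (1 : ℤ) S.q, ∑ D ∈ Icc (1 : ℤ) S.q, S.χ (S.frac ((C : K) + D * S.δ)) *
      ((∑ i ∈ Icc (1 : ℤ) S.m,
        (B1 (X C D i) * B1 (Y C D i) + (S.b i : ℝ) / 2 * B2 (X C D i)) : ℝ) : ℂ) := by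
  let V : ℤ → ℂ := fun i => ∑ C ∈ Icc (1 : ℤ) S.q, ∑ D ∈ Icc (1 : ℤ) S.q,
    S.χ (S.frac ((C : K) + D * S.δ)) * B2 (X C D i)
  let U : ℤ → ℂ := fun i => ∑ C ∈ Icc (1 : ℤ) S.q, ∑ D ∈ Icc (1 : ℤ) S.q,
    S.χ (S.frac ((C : K) + D * S.δ)) * (B1 (X C D i) * B1 (Y C D i))
  let t : ℤ → ℂ := fun i => ((S.σ (S.δseq i) + S.σ' (S.δseq i) : ℝ) : ℂ)
  have hVper : ∀ i, V (i + S.m) = V i := fun i => by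
    have h1 := fun i => h.sum_eq i fun x _ => (B2 x : ℂ)
    simp only [V, h1, coef_add_m]
  have htper : ∀ i, t (i + S.m) = t i := fun i => by simp only [t, S.hδper]
  have hcone : ∀ i, ∑ w : Fin S.q × Fin S.q, S.coef i w *
      S.coneValue i (((w.1 : ℕ) + 1 : ℝ) / S.q) (((w.2 : ℕ) : ℝ) / S.q) =
      U i + (t i * V i + (2 * S.b (i - 1) * V (i - 1) - t (i - 1) * V (i - 1))) / 4 := by
    intro i
    rw [← h.sum_eq i fun x y => (S.coneValue i x y : ℂ)]
    simp only [U, V, t, Finset.mul_sum, ← Finset.sum_sub_distrib, ← Finset.sum_add_distrib,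
      Finset.sum_div]
    refine Finset.sum_congr rfl fun C _ => ?_
    refine Finset.sum_congr rfl fun D _ => ?_
    rw [coneValue_eq, h.Y_eq C D i, B2_one_sub]
    push_cast
    ring
  have h3 := sum_Icc_one_pred S.m (f := fun i => (2 * S.b i * V i - t i * V i))
    fun i => by simp only [hVper, htper, S.hbper]
  calc
    _ = ∑ i ∈ Icc (1 : ℤ) S.m, (U i + (t i * V i +
          (2 * S.b (i - 1) * V (i - 1) - t (i - 1) * V (i - 1))) / 4) := by
      rw [Fintype.sum_prod_type, ← Finset.sum_coe_sort (Icc (1 : ℤ) S.m)]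
      exact Finset.sum_congr rfl fun i _ => hcone i
    _ = ∑ i ∈ Icc (1 : ℤ) S.m, (U i + S.b i / 2 * V i) := by
      simp only [Finset.sum_add_distrib, ← Finset.sum_div]
      rw [h3, ← Finset.sum_add_distrib, Finset.sum_div]
      congr 1
      refine Finset.sum_congr rfl fun i _ => ?_
      ring
    _ = _ := by
      simp only [U, V, Complex.ofReal_sum, Finset.mul_sum, ← Finset.sum_add_distrib]
      rw [Finset.sum_comm]
      refine Finset.sum_congr rfl fun C _ => ?_
      rw [Finset.sum_comm]
      refine Finset.sum_congr rfl fun D _ => Finset.sum_congr rfl fun i _ => ?_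
      push_cast
      ring

end ConeData

end

/-- Proposition 2.9 of Jun–Lee: for a ray class character `χ` modulo `q` the partial Hecke
`L`-series `L(s,χ,𝔟) = Σ_𝔞 χ(𝔞)N(𝔞)^{-s}` (over integral `𝔞 = α𝔟`, `α` totally positive,
`𝔞` coprime to `qO_K`) converges absolutely for `Re(s) > 1` and any analytic continuation
`F` of it to a connected open set containing the half plane and `0` satisfies
`F(0) = Σ_{C=1}^{q} Σ_{D=1}^{q} χ((C+Dδ)𝔟) Σ_{i=1}^{m}
  [B₁(x^i_{C+Dδ})B₁(y^i_{C+Dδ}) + (b_i/2)B₂(x^i_{C+Dδ})]`. -/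
theorem stmt_9 {K : Type*} [Field K] [NumberField K]
    (hdeg : Module.finrank ℚ K = 2)
    (σ σ' : K →+* ℝ) (hσσ' : σ ≠ σ')
    (q : ℕ) (hq : 0 < q)
    (𝔟 : Ideal (𝓞 K)) (hbcop : IsCoprime 𝔟 (Ideal.span {(q : 𝓞 K)}))
    (δ : K) (hδ2 : 2 < σ δ) (hδ'0 : 0 < σ' δ) (hδ'1 : σ' δ < 1)
    (hbinv : ∀ z : K,
      z ∈ ((𝔟 : FractionalIdeal (𝓞 K)⁰ K))⁻¹ ↔ ∃ a b : ℤ, z = (a : K) + (b : K) * δ)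
    -- the ray class character `χ` modulo `q`
    (χ : FractionalIdeal (𝓞 K)⁰ K → ℂ)
    (hχmul : ∀ I J : FractionalIdeal (𝓞 K)⁰ K,
      (∃ I₁ I₂ : Ideal (𝓞 K), IsCoprime I₁ (Ideal.span {(q : 𝓞 K)}) ∧
        IsCoprime I₂ (Ideal.span {(q : 𝓞 K)}) ∧ I₂ ≠ 0 ∧
        I = (I₁ : FractionalIdeal (𝓞 K)⁰ K) / (I₂ : FractionalIdeal (𝓞 K)⁰ K)) →
      (∃ J₁ J₂ : Ideal (𝓞 K), IsCoprime J₁ (Ideal.span {(q : 𝓞 K)}) ∧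
        IsCoprime J₂ (Ideal.span {(q : 𝓞 K)}) ∧ J₂ ≠ 0 ∧
        J = (J₁ : FractionalIdeal (𝓞 K)⁰ K) / (J₂ : FractionalIdeal (𝓞 K)⁰ K)) →
      I ≠ 0 → J ≠ 0 → χ (I * J) = χ I * χ J)
    (hχne : ∀ I : FractionalIdeal (𝓞 K)⁰ K,
      (∃ I₁ I₂ : Ideal (𝓞 K), IsCoprime I₁ (Ideal.span {(q : 𝓞 K)}) ∧
        IsCoprime I₂ (Ideal.span {(q : 𝓞 K)}) ∧ I₂ ≠ 0 ∧
        I = (I₁ : FractionalIdeal (𝓞 K)⁰ K) / (I₂ : FractionalIdeal (𝓞 K)⁰ K)) →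
      I ≠ 0 → χ I ≠ 0)
    (hχprin : ∀ a : K, 0 < σ a → 0 < σ' a → (∃ y : 𝓞 K, a = 1 + (q : 𝓞 K) * y) →
      χ (spanSingleton (𝓞 K)⁰ a) = 1)
    (hχzero : ∀ I : FractionalIdeal (𝓞 K)⁰ K,
      ¬ (I ≠ 0 ∧ ∃ I₁ I₂ : Ideal (𝓞 K), IsCoprime I₁ (Ideal.span {(q : 𝓞 K)}) ∧
        IsCoprime I₂ (Ideal.span {(q : 𝓞 K)}) ∧ I₂ ≠ 0 ∧
        I = (I₁ : FractionalIdeal (𝓞 K)⁰ K) / (I₂ : FractionalIdeal (𝓞 K)⁰ K)) →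
      χ I = 0)
    -- the minus continued fraction data
    (m : ℕ) (hm : 0 < m)
    (b : ℤ → ℤ) (hb2 : ∀ i, 2 ≤ b i) (hbper : ∀ i, b (i + m) = b i)
    (δseq : ℤ → K) (hδ0 : δseq 0 = δ) (hδne : ∀ i, δseq i ≠ 0)
    (hδrec : ∀ i, δseq i = (b i : K) - 1 / δseq (i+1)) (hδper : ∀ i, δseq (i + m) = δseq i)
    (A : ℤ → K) (hAm1 : A (-1) = δ) (hA0 : A 0 = 1)
    (hArec : ∀ i : ℤ, A (i+1) = (b i : K) * A i - A (i-1))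
    (hAbasis : ∀ i : ℤ, ∀ z : K,
      z ∈ ((𝔟 : FractionalIdeal (𝓞 K)⁰ K))⁻¹ ↔ ∃ u v : ℤ, z = (u : K) * A (i-1) + (v : K) * A i)
    -- the totally positive fundamental unit `ε > 1`
    (ε : (𝓞 K)ˣ) (hεpos : 0 < σ ((ε : 𝓞 K) : K) ∧ 0 < σ' ((ε : 𝓞 K) : K))
    (hε1 : 1 < σ ((ε : 𝓞 K) : K))
    (hεfund : ∀ u : (𝓞 K)ˣ, 0 < σ ((u : 𝓞 K) : K) → 0 < σ' ((u : 𝓞 K) : K) →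
      ∃ j : ℤ, ((u : 𝓞 K) : K) = (((ε : 𝓞 K) : K)) ^ j)
    (hshift : ∀ i : ℤ, ((ε : 𝓞 K) : K) * A i = A (i - m))
    -- the pairs `(x^i_{C+Dδ}, y^i_{C+Dδ})`
    (X Y : ℤ → ℤ → ℤ → ℝ)
    (hXY : ∀ C D i : ℤ, X C D i ∈ Set.Ioc (0:ℝ) 1 ∧ Y C D i ∈ Set.Ico (0:ℝ) 1 ∧
      ∃ z : K, (z - ((C : K) + (D : K) * δ) / (q : K)) ∈ ((𝔟 : FractionalIdeal (𝓞 K)⁰ K))⁻¹ ∧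
        X C D i * σ (A (i-1)) + Y C D i * σ (A i) = σ z ∧
        X C D i * σ' (A (i-1)) + Y C D i * σ' (A i) = σ' z) :
    (∀ s : ℂ, 1 < s.re →
      Summable (fun 𝔞 : {𝔞 : Ideal (𝓞 K) //
          (∃ a : K, (0 < σ a ∧ 0 < σ' a) ∧ (𝔞 : FractionalIdeal (𝓞 K)⁰ K)
            = spanSingleton (𝓞 K)⁰ a * (𝔟 : FractionalIdeal (𝓞 K)⁰ K))
          ∧ IsCoprime 𝔞 (Ideal.span {(q : 𝓞 K)})} =>
        ‖χ (𝔞.1 : FractionalIdeal (𝓞 K)⁰ K) * (Ideal.absNorm 𝔞.1 : ℂ) ^ (-s)‖)) ∧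
    (∀ (U : Set ℂ) (F : ℂ → ℂ), IsOpen U → IsConnected U →
      ({s : ℂ | 1 < s.re} ∪ {0}) ⊆ U → AnalyticOnNhd ℂ F U →
      (∀ s ∈ {s : ℂ | 1 < s.re},
        F s = ∑' 𝔞 : {𝔞 : Ideal (𝓞 K) //
          (∃ a : K, (0 < σ a ∧ 0 < σ' a) ∧ (𝔞 : FractionalIdeal (𝓞 K)⁰ K)
            = spanSingleton (𝓞 K)⁰ a * (𝔟 : FractionalIdeal (𝓞 K)⁰ K))
          ∧ IsCoprime 𝔞 (Ideal.span {(q : 𝓞 K)})},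
          χ (𝔞.1 : FractionalIdeal (𝓞 K)⁰ K) * (Ideal.absNorm 𝔞.1 : ℂ) ^ (-s)) →
      F 0 = ∑ C ∈ Finset.Icc (1:ℤ) (q:ℤ), ∑ D ∈ Finset.Icc (1:ℤ) (q:ℤ),
        χ (spanSingleton (𝓞 K)⁰ ((C : K) + (D : K) * δ) * (𝔟 : FractionalIdeal (𝓞 K)⁰ K))
        * ((∑ i ∈ Finset.Icc (1:ℤ) (m:ℤ),
            (B1 (X C D i) * B1 (Y C D i) + (b i : ℝ)/2 * B2 (X C D i)) : ℝ) : ℂ)) := by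
  let S : ConeData K :=
    { σ := σ, σ' := σ', hdeg := hdeg, hσσ' := hσσ', q := q, hq := hq, 𝔟 := 𝔟, δ := δ
      hδ2 := hδ2, hδ'0 := hδ'0, hδ'1 := hδ'1, hbinv := hbinv, χ := χ, hχmul := hχmul
      hχprin := hχprin, hχzero := hχzero, m := m, hm := hm, b := b, hb2 := hb2, hbper := hbper
      δseq := δseq, hδ0 := hδ0, hδne := hδne, hδrec := hδrec, hδper := hδper, A := A
      hAm1 := hAm1, hA0 := hA0, hArec := hArec, hAbasis := hAbasis, ε := ε, hεpos := hεpos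
      hεfund := hεfund, hshift := hshift }
  have hsum := fun (s : ℂ) (hs : 1 < s.re) => S.hasSum_ideal
    (h := fun I => χ I * (Ideal.absNorm I : ℂ) ^ (-s))
    (fun I hI => by rw [show χ I = 0 from S.χ_eq_zero hI, zero_mul]) (S.hasSum_enum hs)
  refine ⟨fun s hs => (hsum s hs).summable.norm, fun U F hU hc hsub hF heq => ?_⟩
  have hX : S.IsCoord X Y := hXY
  refine (HasCont.eq_of_analyticOnNhd (Z := S.coneZeta) (fun N hN => S.hasCont_coneZeta hN)
    hU hc hsub hF fun s hs => ?_).trans hX.value_eq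
  rw [heq s hs]
  exact (hsum s hs).tsum_eq
end

section
/- Let s ≥ 1 be an integer and a₀, …, a_{s−1} positive integers, extended to all indices i ≥ 0 by a_{i+s} = a_i. Let δ be the real number such that δ − 1 = [[a₀, …, a_{s−1}]]. Define S₀ = 0 and S_j = S_{j−1} + a_{2j−1} for j ≥ 1; set m = a₁ + a₃ + ⋯ + a_{s−1} (= S_{s/2}) if s is even, and m = a₀ + a₁ + ⋯ + a_{s−1} (= S_s) if s is odd; and for 0 ≤ i ≤ m−1 set b_i = a_{2j} + 2 if i = S_j for some j ≥ 0, and b_i = 2 otherwise, extended to all i ≥ 0 by b_{i+m} = b_i. Then b_i ≥ 2 for all i, and the sequence defined by δ^{(0)} = δ and δ^{(i+1)} = 1/(b_i − δ^{(i)}) is well defined and satisfies δ^{(i)} > 1 and δ^{(i)} = b_i − 1/δ^{(i+1)} for all i ≥ 0, and δ^{(m)} = δ^{(0)}; that is, δ = ((b₀, …, b_{m−1})) is a purely periodic minus continued fraction expansion of δ of period m. -/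
/-- A strictly increasing sequence of natural numbers starting at `0` cuts `ℕ` into blocks:
no term lies strictly inside the block `[S j, S (j + 1))`. -/
lemma StrictMono.add_ne_of_lt {S : ℕ → ℕ} (hS : StrictMono S) {j k : ℕ} (hk : 0 < k)
    (hlt : S j + k < S (j + 1)) (l : ℕ) : S j + k ≠ S l := by
  intro h
  have h1 : j < l := hS.lt_iff_lt.mp (by omega)
  have h2 : l < j + 1 := hS.lt_iff_lt.mp (by omega)
  omega

/-- If `b` is `S p`-periodic and `S (j + p) = S j + S p`, then the values of `b` on the range of
`S` and off it are determined by its values on `[0, S p)`. -/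
lemma values_of_periodic {S b c : ℕ → ℕ} {p : ℕ} (hp : 0 < p) (hS : StrictMono S)
    (hadd : ∀ j, S (j + p) = S j + S p) (hb : ∀ i, b (i + S p) = b i)
    (hc : ∀ j, c (j + p) = c j)
    (hbS : ∀ i < S p, ∀ j, i = S j → b i = c j + 2)
    (hbn : ∀ i < S p, (¬ ∃ j, i = S j) → b i = 2) :
    (∀ j, b (S j) = c j + 2) ∧ ∀ i, (∀ j, i ≠ S j) → b i = 2 := by
  have hpos : 0 < S p := hp.trans_le hS.le_apply
  constructor
  · intro j
    induction j using Nat.strong_induction_on with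
    | _ j ih =>
      rcases lt_or_ge j p with h | h
      · exact hbS _ (hS h) j rfl
      · obtain ⟨l, rfl⟩ := Nat.exists_eq_add_of_le' h
        rw [hadd, hb, hc, ih l (by omega)]
  · intro i
    induction i using Nat.strong_induction_on with
    | _ i ih =>
      intro hi
      rcases lt_or_ge i (S p) with h | h
      · exact hbn i h (by simpa using hi)
      · obtain ⟨l, rfl⟩ := Nat.exists_eq_add_of_le' h
        rw [hb]
        refine ih l (by omega) fun j hj => hi (j + p) ?_
        rw [hadd, hj]

/-- The complete quotients of a minus continued fraction, expressed at the indices `S j + k` of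
each block through the complete quotients `t` of the corresponding plus continued fraction. -/
lemma minus_quotient_of_plus_quotient {a S b : ℕ → ℕ} {t e : ℕ → ℝ}
    (ha : ∀ i, 1 ≤ a i) (ht1 : ∀ i, 1 < t i)
    (htrec : ∀ i, t i = a i + 1 / t (i + 1))
    (hS0 : S 0 = 0) (hSrec : ∀ j, S (j + 1) = S j + a (2 * j + 1))
    (hbS : ∀ j, b (S j) = a (2 * j) + 2)
    (hbn : ∀ i, (∀ j, i ≠ S j) → b i = 2)
    (he0 : e 0 = 1 + t 0) (herec : ∀ i, e (i + 1) = 1 / ((b i : ℝ) - e i)) (i : ℕ) :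
    1 < e i ∧ 0 < (b i : ℝ) - e i ∧ ∃ j k, i = S j + k ∧ k < a (2 * j + 1) ∧
      ((k = 0 ∧ e i = 1 + t (2 * j)) ∨ (0 < k ∧ e i = 1 + 1 / (t (2 * j + 1) - k))) := by
  have hSmono : StrictMono S := strictMono_nat_of_lt_succ fun j => by
    have := ha (2 * j + 1); rw [hSrec]; omega
  have hta : ∀ n, (a n : ℝ) < t n := fun n => by
    have h0 : 0 < 1 / t (n + 1) := one_div_pos.mpr (by linarith [ht1 (n + 1)])
    linarith [htrec n]
  have hgap : ∀ {i j k : ℕ}, i = S j + k → k < a (2 * j + 1) →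
      ((k = 0 ∧ e i = 1 + t (2 * j)) ∨ (0 < k ∧ e i = 1 + 1 / (t (2 * j + 1) - k))) →
      1 < e i ∧ 1 < t (2 * j + 1) - k ∧
        (b i : ℝ) - e i = 1 - 1 / (t (2 * j + 1) - k) := by
    intro i j k hi hk h
    have hk1 : (k : ℝ) + 1 ≤ a (2 * j + 1) := by exact_mod_cast hk
    have hu : 1 < t (2 * j + 1) - k := by linarith [hta (2 * j + 1)]
    refine ⟨?_, hu, ?_⟩
    · rcases h with ⟨-, h⟩ | ⟨-, h⟩
      · linarith [ht1 (2 * j)]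
      · have : 0 < 1 / (t (2 * j + 1) - k) := one_div_pos.mpr (by linarith)
        linarith
    · rcases h with ⟨rfl, h⟩ | ⟨hk0, h⟩
      · rw [h, hi, add_zero, hbS, htrec (2 * j)]
        push_cast
        ring
      · rw [h, hbn i fun l => hi ▸ hSmono.add_ne_of_lt hk0 (by rw [hSrec]; omega) l]
        push_cast
        ring
  have hblock : ∃ j k, i = S j + k ∧ k < a (2 * j + 1) ∧
      ((k = 0 ∧ e i = 1 + t (2 * j)) ∨ (0 < k ∧ e i = 1 + 1 / (t (2 * j + 1) - k))) := by
    induction i with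
    | zero => exact ⟨0, 0, by simp [hS0], ha _, Or.inl ⟨rfl, by simpa using he0⟩⟩
    | succ i ih =>
      obtain ⟨j, k, hi, hk, h⟩ := ih
      obtain ⟨-, hu, hd⟩ := hgap hi hk h
      have he : e (i + 1) = 1 + 1 / (t (2 * j + 1) - (k + 1 : ℕ)) := by
        have h1 : t (2 * j + 1) - k ≠ 0 := by linarith
        have h2 : t (2 * j + 1) - k - 1 ≠ 0 := by linarith
        rw [herec, hd, one_sub_div h1, one_div_div]
        push_cast
        rw [← sub_sub, div_eq_iff h2, add_mul, one_div_mul_cancel h2]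
        ring
      rcases Nat.lt_or_eq_of_le (Nat.succ_le_of_lt hk) with hlt | heq
      · exact ⟨j, k + 1, by omega, hlt, Or.inr ⟨k.succ_pos, he⟩⟩
      · refine ⟨j + 1, 0, by rw [hSrec]; omega, ha _, Or.inl ⟨rfl, ?_⟩⟩
        rw [he, show k + 1 = a (2 * j + 1) from heq, htrec (2 * j + 1), add_sub_cancel_left,
          one_div_one_div, mul_add, mul_one]
  obtain ⟨j, k, hi, hk, h⟩ := hblock
  obtain ⟨he, hu, hd⟩ := hgap hi hk h
  refine ⟨he, ?_, j, k, hi, hk, h⟩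
  rw [hd, sub_pos]
  exact (div_lt_one (by linarith)).mpr hu


/-- Conversion of a purely periodic (plus) continued fraction to a purely periodic minus
continued fraction.  Here `δ - 1 = [[a₀,…,a_{s-1}]]` is encoded through the sequence
`t_i` of complete quotients: `t₀ = δ - 1`, `t_i = a_i + 1/t_{i+1}`, `t_i > 1`,
`t_{i+s} = t_i`.  With `S₀ = 0`, `S_j = S_{j-1} + a_{2j-1}`, `m = S_{s/2}` (s even) or
`m = S_s` (s odd), and `b_i = a_{2j} + 2` if `i = S_j`, `b_i = 2` otherwise (extended
`m`-periodically), the conclusion is that `b_i ≥ 2` for all `i` and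
`δ = ((b₀,…,b_{m-1}))`: there is a sequence `δ⁽ⁱ⁾` with `δ⁽⁰⁾ = δ`,
`δ⁽ⁱ⁺¹⁾ = 1/(b_i - δ⁽ⁱ⁾)`, `δ⁽ⁱ⁾ > 1`, `δ⁽ⁱ⁾ = b_i - 1/δ⁽ⁱ⁺¹⁾`, and `δ⁽ᵐ⁾ = δ⁽⁰⁾`. -/
theorem stmt_10 (s : ℕ) (hs : 1 ≤ s) (a : ℕ → ℕ) (ha : ∀ i, 1 ≤ a i)
    (haper : ∀ i, a (i + s) = a i)
    (δ : ℝ) (t : ℕ → ℝ)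
    (ht0 : t 0 = δ - 1) (ht1 : ∀ i, 1 < t i)
    (htrec : ∀ i, t i = a i + 1 / t (i+1)) (htper : ∀ i, t (i + s) = t i)
    (S : ℕ → ℕ) (hS0 : S 0 = 0) (hSrec : ∀ j : ℕ, S (j+1) = S j + a (2*j+1))
    (m : ℕ) (hmodd : Odd s → m = S s) (hmeven : Even s → m = S (s/2))
    (b : ℕ → ℕ)
    (hbS : ∀ i < m, ∀ j : ℕ, i = S j → b i = a (2*j) + 2)
    (hbn : ∀ i < m, (¬ ∃ j : ℕ, i = S j) → b i = 2)
    (hbper : ∀ i, b (i + m) = b i) :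
    (∀ i, 2 ≤ b i) ∧
    ∃ e : ℕ → ℝ, e 0 = δ ∧ (∀ i, 1 < e i) ∧
      (∀ i, (b i : ℝ) - e i ≠ 0 ∧ e (i+1) = 1 / ((b i : ℝ) - e i)) ∧
      (∀ i, e i = (b i : ℝ) - 1 / e (i+1)) ∧
      e m = e 0 := by
  obtain ⟨p, hp, hm, q, hq⟩ : ∃ p, 0 < p ∧ m = S p ∧ ∃ q, 2 * p = q * s := by
    rcases Nat.even_or_odd s with h | h
    · obtain ⟨r, rfl⟩ := h
      exact ⟨(r + r) / 2, by omega, hmeven ⟨r, rfl⟩, 1, by omega⟩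
    · exact ⟨s, hs, hmodd h, 2, rfl⟩
  subst hm
  have hap : ∀ i, a (i + 2 * p) = a i := by
    rw [hq]; exact Function.Periodic.nat_mul haper q
  have htp : ∀ i, t (i + 2 * p) = t i := by
    rw [hq]; exact Function.Periodic.nat_mul htper q
  have hSmono : StrictMono S := strictMono_nat_of_lt_succ fun j => by
    have := ha (2 * j + 1); rw [hSrec]; omega
  have hadd : ∀ j, S (j + p) = S j + S p := by
    intro j
    induction j with
    | zero => simp [hS0]
    | succ j ih =>
      rw [Nat.add_right_comm, hSrec, ih, hSrec, ← hap (2 * j + 1),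
        show 2 * (j + p) + 1 = 2 * j + 1 + 2 * p by ring]
      ring
  obtain ⟨hbS', hbn'⟩ := values_of_periodic (c := fun j => a (2 * j)) hp hSmono hadd hbper
    (fun j => by simp only [mul_add, hap]) hbS hbn
  refine ⟨fun i => ?_, ?_⟩
  · by_cases h : ∃ j, i = S j
    · obtain ⟨j, rfl⟩ := h
      rw [hbS']
      omega
    · exact (hbn' i (by simpa using h)).ge
  obtain ⟨e, he0, herec⟩ : ∃ e : ℕ → ℝ, e 0 = δ ∧ ∀ i, e (i + 1) = 1 / ((b i : ℝ) - e i) :=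
    ⟨fun i => Nat.rec δ (fun i x => 1 / ((b i : ℝ) - x)) i, rfl, fun _ => rfl⟩
  have key := minus_quotient_of_plus_quotient ha ht1 htrec hS0 hSrec hbS' hbn'
    (by rw [he0, ht0]; ring) herec
  refine ⟨e, he0, fun i => (key i).1, fun i => ⟨(key i).2.1.ne', herec i⟩, fun i => ?_, ?_⟩
  · rw [herec, one_div_one_div, sub_sub_cancel]
  · obtain ⟨-, -, j, k, hi, hk, h⟩ := key (S p)
    rcases h with ⟨rfl, h⟩ | ⟨hk0, -⟩
    · obtain rfl : p = j := hSmono.injective (by simpa using hi)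
      rw [h, he0, ← zero_add (2 * p), htp, ht0]
      ring
    · exact absurd hi.symm (hSmono.add_ne_of_lt hk0 (by rw [hSrec]; omega) p)
end

section
/- Let q be a positive integer, N ≥ q an integer, a an integer, and let (x_i)_{a ≤ i ≤ a+N} be real numbers with 0 < x_i ≤ 1 and q·x_i ∈ ℤ for all i, satisfying x_{i+1} = ⟨2x_i − x_{i−1}⟩ for all i with a+1 ≤ i ≤ a+N−1. Then x_{a+q+i} = x_{a+i} for all 0 ≤ i ≤ N−q. -/
/-- `⟨x⟩`: the unique element of `(0,1]` congruent to `x` modulo `ℤ`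
(`⟨x⟩ = x - ⌊x⌋` for `x ∉ ℤ`, and `⟨x⟩ = 1` for `x ∈ ℤ`). -/
noncomputable def ufrac (x : ℝ) : ℝ := x - ⌈x⌉ + 1

theorem eq_of_mem_Ioc_of_sub_eq_int {u v : ℝ} (hu : 0 < u ∧ u ≤ 1) (hv : 0 < v ∧ v ≤ 1)
    {k : ℤ} (h : u - v = k) : u = v := by
  have h1 : (k : ℝ) < 1 := by linarith
  have h2 : (-1 : ℝ) < k := by linarith
  have h3 : k < 1 := by exact_mod_cast h1
  have h4 : -1 < k := by exact_mod_cast h2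
  obtain rfl : k = 0 := by omega
  push_cast at h
  linarith

/-- A solution of the recursion is an arithmetic progression modulo `ℤ`; two consecutive terms
are treated together for the induction. -/
theorem ufrac_recurrence_progression_pair {N a : ℤ} {x : ℤ → ℝ}
    (hrec : ∀ i, a + 1 ≤ i → i ≤ a + N - 1 → x (i+1) = ufrac (2 * x i - x (i-1))) (n : ℕ)
    (hn : (n : ℤ) + 1 ≤ N) :
    (∃ k : ℤ, x (a + n) = x a + n * (x (a + 1) - x a) + k) ∧
      ∃ k : ℤ, x (a + n + 1) = x a + (n + 1) * (x (a + 1) - x a) + k := by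
  induction n with
  | zero => exact ⟨⟨0, by simp⟩, ⟨0, by simp⟩⟩
  | succ n ih =>
    push_cast at hn
    obtain ⟨⟨k, hk⟩, l, hl⟩ := ih (by omega)
    have h := hrec (a + n + 1) (by omega) (by omega)
    rw [add_sub_cancel_right, ufrac] at h
    push_cast
    rw [← add_assoc]
    refine ⟨⟨l, hl⟩, 2 * l - k - ⌈2 * x (a + n + 1) - x (a + n)⌉ + 1, ?_⟩
    rw [h]
    push_cast
    linear_combination 2 * hl - hk

theorem ufrac_recurrence_progression {N a : ℤ} {x : ℤ → ℝ}
    (hrec : ∀ i, a + 1 ≤ i → i ≤ a + N - 1 → x (i+1) = ufrac (2 * x i - x (i-1))) (n : ℕ)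
    (hn : (n : ℤ) ≤ N) : ∃ k : ℤ, x (a + n) = x a + n * (x (a + 1) - x a) + k := by
  cases n with
  | zero => exact ⟨0, by simp⟩
  | succ n =>
    push_cast at hn ⊢
    rw [← add_assoc]
    exact (ufrac_recurrence_progression_pair hrec n hn).2

/-- Periodicity: if `x_i ∈ (0,1]` with `q·x_i ∈ ℤ` for `a ≤ i ≤ a+N` (`N ≥ q`) satisfy
`x_{i+1} = ⟨2x_i - x_{i-1}⟩` for `a+1 ≤ i ≤ a+N-1`, then `x_{a+q+i} = x_{a+i}` for
`0 ≤ i ≤ N-q`. -/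
theorem stmt_13 (q : ℕ) (hq : 0 < q) (N : ℤ) (hN : (q:ℤ) ≤ N) (a : ℤ) (x : ℤ → ℝ)
    (hx : ∀ i, a ≤ i → i ≤ a + N → (0 < x i ∧ x i ≤ 1) ∧ ∃ z : ℤ, (q:ℝ) * x i = z)
    (hrec : ∀ i, a + 1 ≤ i → i ≤ a + N - 1 → x (i+1) = ufrac (2 * x i - x (i-1))) :
    ∀ i : ℤ, 0 ≤ i → i ≤ N - q → x (a + q + i) = x (a + i) := by
  intro i hi hiN
  lift i to ℕ using hi
  obtain ⟨k, hk⟩ := ufrac_recurrence_progression hrec i (by omega)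
  obtain ⟨l, hl⟩ := ufrac_recurrence_progression hrec (q + i) (by push_cast; omega)
  obtain ⟨-, s, hs⟩ := hx a le_rfl (by omega)
  obtain ⟨-, t, ht⟩ := hx (a + 1) (by omega) (by omega)
  push_cast at hl
  rw [← add_assoc] at hl
  refine eq_of_mem_Ioc_of_sub_eq_int (hx _ (by omega) (by omega)).1
    (hx _ (by omega) (by omega)).1 (k := t - s + l - k) ?_
  push_cast
  linear_combination hl - hk + ht - hs
end

section
/- Let q be a positive integer and let C, D be integers with 0 ≤ C, D ≤ q−1. Let (a_i)_{i≥0} be positive integers and (γ_i)_{i≥0} integers with 1 ≤ γ_i ≤ q, a_i ≡ γ_i (mod q), and a_i ≥ γ_i for all i. Define S₀ = 0, S_j = S_{j−1} + a_{2j−1}, and Γ₀ = 0, Γ_j = Γ_{j−1} + γ_{2j−1} for j ≥ 1. For i ≥ 0 set b_i = a_{2j} + 2 if i = S_j for some j ≥ 0 and b_i = 2 otherwise, and set c_i = γ_{2j} + 2 if i = Γ_j for some j ≥ 0 and c_i = 2 otherwise. Define x_{−1} = 1 − C/q, x₀ = ⟨D/q⟩, x_{i+1} = ⟨b_i·x_i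 − x_{i−1}⟩, and ν_{−1} = 1 − C/q, ν₀ = ⟨D/q⟩, ν_{i+1} = ⟨c_i·ν_i − ν_{i−1}⟩. Then for every j ≥ 0 and every integer i with 0 ≤ i ≤ γ_{2j+1}, x_{S_j + i} = ν_{Γ_j + i}. -/
theorem ufrac_eq_of_sub_eq_intCast {x y : ℝ} (k : ℤ) (h : x - y = k) : ufrac x = ufrac y := by
  obtain rfl : x = y + k := by linarith
  simp only [ufrac, Int.ceil_add_intCast]
  push_cast
  ring

theorem exists_ufrac_eq_add_intCast (x : ℝ) : ∃ k : ℤ, ufrac x = x + k :=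
  ⟨1 - ⌈x⌉, by simp only [ufrac]; push_cast; ring⟩

theorem ufrac_ufrac (x : ℝ) : ufrac (ufrac x) = ufrac x := by
  obtain ⟨k, hk⟩ := exists_ufrac_eq_add_intCast x
  exact ufrac_eq_of_sub_eq_intCast k (by rw [hk]; ring)

theorem exists_ufrac_intCast_div_eq {q : ℕ} (hq : 0 < q) (m : ℤ) :
    ∃ n : ℤ, ufrac ((m : ℝ) / q) = n / q := by
  obtain ⟨k, hk⟩ := exists_ufrac_eq_add_intCast ((m : ℝ) / q)
  refine ⟨m + k * q, ?_⟩
  rw [hk]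
  push_cast
  field_simp

theorem ufrac_intCast_div_congr {q : ℕ} (hq : 0 < q) {m n : ℤ} (h : (q : ℤ) ∣ m - n) :
    ufrac ((m : ℝ) / q) = ufrac ((n : ℝ) / q) := by
  obtain ⟨k, hk⟩ := h
  refine ufrac_eq_of_sub_eq_intCast k ?_
  have hk' : (m : ℝ) - n = q * k := mod_cast hk
  rw [← sub_div, hk']
  field_simp

/-- On a block where the recursion coefficient is `A + 2` at the start and `2` afterwards, the
recursion modulo `1` produces an arithmetic progression modulo `1`. -/
theorem ufrac_rec_eq_arithmetic (f : ℤ → ℝ) (e : ℕ → ℤ)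
    (hrec : ∀ i : ℕ, f ((i : ℤ) + 1) = ufrac ((e i : ℝ) * f i - f ((i : ℤ) - 1)))
    (s : ℕ) (A L : ℤ) (u w : ℝ) (hs : f s = u) (hu : ufrac u = u) (hw : f ((s : ℤ) - 1) = w)
    (hes : e s = A + 2) (he : ∀ i : ℕ, 0 < i → (i : ℤ) < L → e (s + i) = 2) :
    ∀ i : ℕ, (i : ℤ) ≤ L → f ((s : ℤ) + i) = ufrac (u + i * ((A + 1) * u - w)) := by
  intro i
  induction i using Nat.twoStepInduction with
  | zero => intro _; simp [hs, hu]
  | one =>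
    intro _
    have h := hrec s
    rw [hs, hw, hes] at h
    rw [Nat.cast_one, h]
    congr 1
    push_cast
    ring
  | more i ih₀ ih₁ =>
    intro hi
    push_cast at hi
    have h := hrec (s + (i + 1))
    rw [he (i + 1) (by omega) (by push_cast; omega)] at h
    have h₀ := ih₀ (by omega)
    have h₁ := ih₁ (by push_cast; omega)
    obtain ⟨k₀, hk₀⟩ := exists_ufrac_eq_add_intCast (u + (i : ℝ) * ((A + 1) * u - w))
    obtain ⟨k₁, hk₁⟩ :=
      exists_ufrac_eq_add_intCast (u + ((i + 1 : ℕ) : ℝ) * ((A + 1) * u - w))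
    have e₂ : ((s + (i + 1) : ℕ) : ℤ) + 1 = (s : ℤ) + ((i + 2 : ℕ) : ℤ) := by push_cast; ring
    have e₁ : ((s + (i + 1) : ℕ) : ℤ) = (s : ℤ) + ((i + 1 : ℕ) : ℤ) := by push_cast; ring
    have e₀ : ((s + (i + 1) : ℕ) : ℤ) - 1 = (s : ℤ) + (i : ℤ) := by push_cast; ring
    rw [e₂, e₀, e₁, h₀, h₁, hk₀, hk₁] at h
    rw [h]
    refine ufrac_eq_of_sub_eq_intCast (2 * k₁ - k₀) ?_
    push_cast
    ring

/-- No partial sum lies strictly between two consecutive ones. -/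
theorem ne_of_strictMono_of_lt_succ {S : ℕ → ℤ} (hS : StrictMono S) {j : ℕ} {n : ℤ}
    (h₁ : S j < n) (h₂ : n < S (j + 1)) : ¬ ∃ k, n = S k := by
  rintro ⟨k, rfl⟩
  have := hS.lt_iff_lt.1 h₁
  have := hS.lt_iff_lt.1 h₂
  omega

/-- Explicit form of the sequence on the block starting at the partial sum `S j`. -/
theorem ufrac_rec_block (f : ℤ → ℝ) (e a S : ℕ → ℤ) (ha : ∀ i, 1 ≤ a i)
    (hS0 : S 0 = 0) (hSrec : ∀ j : ℕ, S (j + 1) = S j + a (2 * j + 1))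
    (heS : ∀ i : ℕ, ∀ j : ℕ, (i : ℤ) = S j → e i = a (2 * j) + 2)
    (hen : ∀ i : ℕ, (¬ ∃ j : ℕ, (i : ℤ) = S j) → e i = 2)
    (hrec : ∀ i : ℕ, f ((i : ℤ) + 1) = ufrac ((e i : ℝ) * f i - f ((i : ℤ) - 1)))
    (q : ℕ) (j : ℕ) (m n : ℤ) (hm : f (S j) = m / q) (hm' : ufrac ((m : ℝ) / q) = m / q)
    (hn : f (S j - 1) = n / q) (i : ℤ) (hi : 0 ≤ i) (hiL : i ≤ a (2 * j + 1)) :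
    f (S j + i) = ufrac (((m + i * ((a (2 * j) + 1) * m - n) : ℤ) : ℝ) / q) := by
  have hmono : StrictMono S := strictMono_nat_of_lt_succ fun k ↦ by
    have := ha (2 * k + 1)
    rw [hSrec]
    omega
  obtain ⟨s, hs⟩ : ∃ s : ℕ, S j = s :=
    Int.eq_ofNat_of_zero_le (hS0 ▸ hmono.monotone (Nat.zero_le j))
  lift i to ℕ using hi
  have key := ufrac_rec_eq_arithmetic f e hrec s (a (2 * j)) (a (2 * j + 1)) (m / q) (n / q)
    (hs ▸ hm) hm' (hs ▸ hn) (heS s j hs.symm)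
    (fun k hk hkL ↦ hen _ (ne_of_strictMono_of_lt_succ hmono (j := j)
      (by push_cast; omega) (by rw [hSrec]; push_cast; omega))) i hiL
  rw [hs, key]
  congr 1
  push_cast
  ring

/-- Comparison of the sequence `x_i` (built from the `a_i` via `S_j` and `b_i`) with the
sequence `ν_i` (built from the residues `γ_i` via `Γ_j` and `c_i`):
`x_{S_j + i} = ν_{Γ_j + i}` for `0 ≤ i ≤ γ_{2j+1}`. -/
theorem stmt_14 (q : ℕ) (hq : 0 < q) (C D : ℤ)
    (hC : 0 ≤ C) (hCq : C ≤ (q:ℤ) - 1) (hD : 0 ≤ D) (hDq : D ≤ (q:ℤ) - 1)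
    (a γ : ℕ → ℤ) (ha : ∀ i, 1 ≤ a i) (hγ1 : ∀ i, 1 ≤ γ i) (hγq : ∀ i, γ i ≤ (q:ℤ))
    (hcong : ∀ i, (q:ℤ) ∣ (a i - γ i)) (hge : ∀ i, γ i ≤ a i)
    (S Γ' : ℕ → ℤ)
    (hS0 : S 0 = 0) (hSrec : ∀ j : ℕ, S (j+1) = S j + a (2*j+1))
    (hΓ0 : Γ' 0 = 0) (hΓrec : ∀ j : ℕ, Γ' (j+1) = Γ' j + γ (2*j+1))
    (b c : ℕ → ℤ)
    (hbS : ∀ i : ℕ, ∀ j : ℕ, (i:ℤ) = S j → b i = a (2*j) + 2)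
    (hbn : ∀ i : ℕ, (¬ ∃ j : ℕ, (i:ℤ) = S j) → b i = 2)
    (hcΓ : ∀ i : ℕ, ∀ j : ℕ, (i:ℤ) = Γ' j → c i = γ (2*j) + 2)
    (hcn : ∀ i : ℕ, (¬ ∃ j : ℕ, (i:ℤ) = Γ' j) → c i = 2)
    (x ν : ℤ → ℝ)
    (hxm1 : x (-1) = 1 - (C:ℝ)/q) (hx0 : x 0 = ufrac ((D:ℝ)/q))
    (hxrec : ∀ i : ℕ, x ((i:ℤ)+1) = ufrac ((b i : ℝ) * x i - x ((i:ℤ)-1)))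
    (hνm1 : ν (-1) = 1 - (C:ℝ)/q) (hν0 : ν 0 = ufrac ((D:ℝ)/q))
    (hνrec : ∀ i : ℕ, ν ((i:ℤ)+1) = ufrac ((c i : ℝ) * ν i - ν ((i:ℤ)-1))) :
    ∀ j : ℕ, ∀ i : ℤ, 0 ≤ i → i ≤ γ (2*j+1) → x (S j + i) = ν (Γ' j + i) := by
  have hx_block := ufrac_rec_block x b a S ha hS0 hSrec hbS hbn hxrec q
  have hν_block := ufrac_rec_block ν c γ Γ' hγ1 hΓ0 hΓrec hcΓ hcn hνrec q
  have hdvd : ∀ (j : ℕ) (m n i i' : ℤ), (q : ℤ) ∣ i - i' →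
      (q : ℤ) ∣ (m + i * ((a (2 * j) + 1) * m - n)) - (m + i' * ((γ (2 * j) + 1) * m - n)) := by
    intro j m n i i' hi
    have : (m + i * ((a (2 * j) + 1) * m - n)) - (m + i' * ((γ (2 * j) + 1) * m - n)) =
        (a (2 * j) - γ (2 * j)) * (i * m) + (i - i') * ((γ (2 * j) + 1) * m - n) := by ring
    rw [this]
    exact dvd_add ((hcong _).mul_right _) (hi.mul_right _)
  have start_eq : ∀ j : ℕ, ∃ m n : ℤ, ufrac ((m : ℝ) / q) = m / q ∧
      x (S j) = m / q ∧ ν (Γ' j) = m / q ∧ x (S j - 1) = n / q ∧ ν (Γ' j - 1) = n / q := by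
    intro j
    induction j with
    | zero =>
      obtain ⟨m, hm⟩ := exists_ufrac_intCast_div_eq hq D
      have hC' : 1 - (C : ℝ) / q = ((q - C : ℤ) : ℝ) / q := by
        push_cast
        field_simp
      refine ⟨m, q - C, ?_, ?_, ?_, ?_, ?_⟩
      · rw [← hm, ufrac_ufrac]
      · rw [hS0, hx0, hm]
      · rw [hΓ0, hν0, hm]
      · rw [hS0, zero_sub, hxm1, hC']
      · rw [hΓ0, zero_sub, hνm1, hC']
    | succ j ih =>
      obtain ⟨m, n, hm, hxm, hνm, hxn, hνn⟩ := ih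
      have ha' := ha (2 * j + 1)
      have hγ' := hγ1 (2 * j + 1)
      have hx₁ := hx_block j m n hxm hm hxn (a (2 * j + 1)) (by omega) le_rfl
      have hν₁ := hν_block j m n hνm hm hνn (γ (2 * j + 1)) (by omega) le_rfl
      have hx₀ := hx_block j m n hxm hm hxn (a (2 * j + 1) - 1) (by omega) (by omega)
      have hν₀ := hν_block j m n hνm hm hνn (γ (2 * j + 1) - 1) (by omega) (by omega)
      rw [ufrac_intCast_div_congr hq (hdvd j m n _ _ (hcong (2 * j + 1)))] at hx₁
      rw [ufrac_intCast_div_congr hq (hdvd j m n _ (γ (2 * j + 1) - 1)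
        (by simpa using hcong (2 * j + 1)))] at hx₀
      obtain ⟨m', hm'⟩ := exists_ufrac_intCast_div_eq hq
        (m + γ (2 * j + 1) * ((γ (2 * j) + 1) * m - n))
      obtain ⟨n', hn'⟩ := exists_ufrac_intCast_div_eq hq
        (m + (γ (2 * j + 1) - 1) * ((γ (2 * j) + 1) * m - n))
      refine ⟨m', n', ?_, ?_, ?_, ?_, ?_⟩
      · rw [← hm', ufrac_ufrac]
      · rw [hSrec, hx₁, hm']
      · rw [hΓrec, hν₁, hm']
      · rw [hSrec, add_sub_assoc, hx₀, hn']
      · rw [hΓrec, add_sub_assoc, hν₀, hn']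
  intro j i hi hiγ
  obtain ⟨m, n, hm, hxm, hνm, hxn, hνn⟩ := start_eq j
  rw [hx_block j m n hxm hm hxn i hi (hiγ.trans (hge _)), hν_block j m n hνm hm hνn i hi hiγ]
  exact ufrac_intCast_div_congr hq (hdvd j m n i i (by simp))
end

section
/- Let γ ≥ 1 and a be integers, and let (x_i)_{a ≤ i ≤ a+γ} be real numbers in (0,1] satisfying x_{i+1} = ⟨2x_i − x_{i−1}⟩ for all i with a+1 ≤ i ≤ a+γ−1. Set d = ⟨x_{a+1} − x_a⟩. Then Σ_{i=a+1}^{a+γ} (x_i − x_{i−1})² = γ·d² + (1 − 2d)·[x_a + dγ]₁. -/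
/-- `[x]₁ := x - ⟨x⟩`. -/
noncomputable def ipart (x : ℝ) : ℝ := x - ufrac x

theorem ufrac_mem_Ioc (y : ℝ) : ufrac y ∈ Set.Ioc (0 : ℝ) 1 := by
  have h₁ := Int.le_ceil y
  have h₂ := Int.ceil_lt_add_one y
  constructor <;> unfold ufrac <;> linarith

theorem exists_ufrac_eq_sub_int (y : ℝ) : ∃ m : ℤ, ufrac y = y - m :=
  ⟨⌈y⌉ - 1, by unfold ufrac; push_cast; ring⟩

theorem ipart_add_int {y : ℝ} (hy : y ∈ Set.Ioc (0 : ℝ) 1) (k : ℤ) : ipart (y + k) = k := by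
  have h : ⌈y⌉ = 1 := Int.ceil_eq_iff.2 (by simpa using hy)
  simp [ipart, ufrac, h]

theorem exists_sub_eq_ufrac_sub_int {γ a : ℤ} {x : ℤ → ℝ}
    (hrec : ∀ i, a + 1 ≤ i → i ≤ a + γ - 1 → x (i+1) = ufrac (2 * x i - x (i-1)))
    (n : ℕ) (hn : (n : ℤ) + 1 ≤ γ) :
    ∃ m : ℤ, x (a + n + 1) - x (a + n) = ufrac (x (a+1) - x a) - m := by
  induction n with
  | zero =>
    obtain ⟨m, hm⟩ := exists_ufrac_eq_sub_int (x (a+1) - x a)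
    exact ⟨-m, by simp [hm]⟩
  | succ n ih =>
    push_cast at hn ⊢
    obtain ⟨m, hm⟩ := ih (by omega)
    have h := hrec (a + (n + 1)) (by omega) (by omega)
    rw [show a + ((n : ℤ) + 1) - 1 = a + n by ring] at h
    obtain ⟨k, hk⟩ := exists_ufrac_eq_sub_int (2 * x (a + (n + 1)) - x (a + n))
    refine ⟨m + k, ?_⟩
    rw [h, hk]
    rw [add_assoc] at hm
    push_cast
    linarith

theorem sq_eq_of_eq_sub_int {d y : ℝ} (hd : d ∈ Set.Ioc (0 : ℝ) 1) (hy : y ∈ Set.Ioo (-1 : ℝ) 1)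
    {m : ℤ} (h : y = d - m) : y ^ 2 = d ^ 2 + (1 - 2 * d) * m := by
  obtain ⟨hd₀, hd₁⟩ := hd
  obtain ⟨hy₀, hy₁⟩ := hy
  have h₁ : -1 < m := by
    have : (-1 : ℝ) < m := by linarith
    exact_mod_cast this
  have h₂ : m < 2 := by
    have : (m : ℝ) < 2 := by linarith
    exact_mod_cast this
  subst h
  interval_cases m <;> push_cast <;> ring

theorem exists_int_sum_sq_sub {γ a : ℤ} {x : ℤ → ℝ}
    (hx : ∀ i, a ≤ i → i ≤ a + γ → x i ∈ Set.Ioc (0:ℝ) 1)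
    (hrec : ∀ i, a + 1 ≤ i → i ≤ a + γ - 1 → x (i+1) = ufrac (2 * x i - x (i-1)))
    (n : ℕ) (hn : (n : ℤ) ≤ γ) :
    ∃ k : ℤ, x a + ufrac (x (a+1) - x a) * n = x (a + n) + k ∧
      ∑ i ∈ Finset.Icc (a+1) (a+n), (x i - x (i-1))^2
        = n * (ufrac (x (a+1) - x a))^2 + (1 - 2 * ufrac (x (a+1) - x a)) * k := by
  induction n with
  | zero => exact ⟨0, by simp⟩
  | succ n ih =>
    push_cast at hn ⊢
    obtain ⟨k, hk, hsum⟩ := ih (by omega)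
    obtain ⟨m, hm⟩ := exists_sub_eq_ufrac_sub_int hrec n hn
    have hx₀ := hx (a + n) (by omega) (by omega)
    have hx₁ := hx (a + n + 1) (by omega) (by omega)
    have hsq := sq_eq_of_eq_sub_int (ufrac_mem_Ioc _)
      ⟨by linarith [hx₀.2, hx₁.1], by linarith [hx₀.1, hx₁.2]⟩ hm
    have hIcc : Finset.Icc (a + 1) (a + n + 1) =
        insert (a + n + 1) (Finset.Icc (a + 1) (a + n)) := by
      ext i
      simp only [Finset.mem_Icc, Finset.mem_insert]
      omega
    rw [← add_assoc a]
    refine ⟨k + m, ?_, ?_⟩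
    · push_cast
      linarith
    · rw [hIcc, Finset.sum_insert (by simp), hsum, add_sub_cancel_right, hsq]
      push_cast
      ring

/-- If `x_i ∈ (0,1]` for `a ≤ i ≤ a+γ` satisfy `x_{i+1} = ⟨2x_i - x_{i-1}⟩` for
`a+1 ≤ i ≤ a+γ-1`, and `d = ⟨x_{a+1} - x_a⟩`, then
`Σ_{i=a+1}^{a+γ} (x_i - x_{i-1})² = γd² + (1 - 2d)[x_a + dγ]₁`. -/
theorem stmt_15 (γ : ℤ) (hγ : 1 ≤ γ) (a : ℤ) (x : ℤ → ℝ)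
    (hx : ∀ i, a ≤ i → i ≤ a + γ → x i ∈ Set.Ioc (0:ℝ) 1)
    (hrec : ∀ i, a + 1 ≤ i → i ≤ a + γ - 1 → x (i+1) = ufrac (2 * x i - x (i-1))) :
    ∑ i ∈ Finset.Icc (a+1) (a+γ), (x i - x (i-1))^2
      = (γ : ℝ) * (ufrac (x (a+1) - x a))^2
        + (1 - 2 * ufrac (x (a+1) - x a)) * ipart (x a + ufrac (x (a+1) - x a) * γ) := by
  lift γ to ℕ using by omega
  obtain ⟨k, hk, hsum⟩ := exists_int_sum_sq_sub hx hrec γ le_rfl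
  rw [hsum, Int.cast_natCast, hk, ipart_add_int (hx _ (by omega) le_rfl)]
end
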